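/- Let Ω ⊆ ℝ^N be open, let B ⊆ Ω be a measurable set of finite perimeter in Ω, and let ε > 0. Then there exist a sequence {C_k} of sets relatively closed in Ω, each of finite perimeter in Ω, and a Borel set Z ⊆ Ω such that: (a) V(1_B − 1_{C_k}, Ω) → 0 and λ^N(B Δ C_k) → 0; (b) for every x ∈ Ω \ Z, 1_{C_k}(x) → 1_{B^+}(x); (c) H^{N-1}(Z) < ε. Here B^+ denotes the set of points x ∈ Ω where B has strictly positive upper density, i.e. limsup_{ρ→0⁺} λ^N(B∩B_ρ(x))/λ^N(B_ρ(x)) > 0. -/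

import Mathlib

open MeasureTheory Metric Filter Set
open scoped ENNReal Topology symmDiff

noncomputable section

abbrev Euc (N : ℕ) : Type := EuclideanSpace ℝ (Fin N)

variable {N : ℕ}

/-- The divergence of a vector field `φ : ℝ^N → ℝ^N`. -/
def diverg (φ : Euc N → Euc N) (x : Euc N) : ℝ :=
  ∑ i : Fin N, fderiv ℝ φ x (EuclideanSpace.single i 1) i

/-- The admissible test vector fields for the variation in `Ω`:
`C^1`, compactly supported in `Ω`, with `‖φ‖ ≤ 1`. -/
def TestVF (Ω : Set (Euc N)) : Set (Euc N → Euc N) :=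
  {φ | ContDiff ℝ 1 φ ∧ HasCompactSupport φ ∧ tsupport φ ⊆ Ω ∧ ∀ x, ‖φ x‖ ≤ 1}

/-- The total variation `V(u, Ω)`. -/
def variation (u : Euc N → ℝ) (Ω : Set (Euc N)) : ℝ≥0∞ :=
  ⨆ φ ∈ TestVF Ω, ENNReal.ofReal (∫ x in Ω, u x * diverg φ x)

/-- The perimeter `P(A, Ω)` of `A` in `Ω`. -/
def perimeter (A Ω : Set (Euc N)) : ℝ≥0∞ :=
  ⨆ φ ∈ TestVF Ω, ENNReal.ofReal (∫ x in A, diverg φ x)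

/-- `u ∈ BV(Ω)`. -/
def MemBV (u : Euc N → ℝ) (Ω : Set (Euc N)) : Prop :=
  IntegrableOn u Ω volume ∧ variation u Ω < ⊤

/-- `u ∈ BV_loc(Ω)`. -/
def MemBVloc (u : Euc N → ℝ) (Ω : Set (Euc N)) : Prop :=
  ∀ Ω' : Set (Euc N), IsOpen Ω' → IsCompact (closure Ω') → closure Ω' ⊆ Ω → MemBV u Ω'

/-- `u ∈ GBV(Ω)`: measurable, and every truncation `(-m) ∨ u ∧ m` is in `BV_loc(Ω)`. -/
def MemGBV (u : Euc N → ℝ) (Ω : Set (Euc N)) : Prop :=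
  AEMeasurable u (volume.restrict Ω) ∧
    ∀ m : ℝ, 0 < m → MemBVloc (fun x => max (-m) (min (u x) m)) Ω

/-- `A` has locally finite perimeter in `Ω`. -/
def HasLocFinPerimeter (A Ω : Set (Euc N)) : Prop :=
  ∀ Ω' : Set (Euc N), IsOpen Ω' → IsCompact (closure Ω') → closure Ω' ⊆ Ω →
    perimeter A Ω' < ⊤

/-- `A` has density `t` at `x`. -/
def HasDensity (A : Set (Euc N)) (x : Euc N) (t : ℝ) : Prop :=
  Tendsto (fun ρ : ℝ => volume (A ∩ ball x ρ) / volume (ball x ρ)) (𝓝[>] 0)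
    (𝓝 (ENNReal.ofReal t))

/-- The approximate upper limit `u⁺(x)` of `u` at `x` (relative to `Ω`), with `inf ∅ = ⊤`. -/
def approxUpper (u : Euc N → ℝ) (Ω : Set (Euc N)) (x : Euc N) : EReal :=
  sInf {t : EReal | ∃ s : ℝ, t = (s : EReal) ∧ HasDensity {y | y ∈ Ω ∧ s < u y} x 0}

/-- The approximate lower limit `u⁻(x)` of `u` at `x` (relative to `Ω`), with `sup ∅ = ⊥`. -/
def approxLower (u : Euc N → ℝ) (Ω : Set (Euc N)) (x : Euc N) : EReal :=
  sSup {t : EReal | ∃ s : ℝ, t = (s : EReal) ∧ HasDensity {y | y ∈ Ω ∧ u y < s} x 0}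

/-- The approximate limit `ũ(x)` exists (i.e. `u⁺(x) = u⁻(x)`) and is `+∞`. -/
def HasApproxLimitTop (u : Euc N → ℝ) (Ω : Set (Euc N)) (x : Euc N) : Prop :=
  approxUpper u Ω x = ⊤ ∧ approxLower u Ω x = ⊤

/-- The approximate limit `ũ(x)` exists and `|ũ(x)| = +∞`. -/
def HasInfApproxLimit (u : Euc N → ℝ) (Ω : Set (Euc N)) (x : Euc N) : Prop :=
  (approxUpper u Ω x = ⊤ ∧ approxLower u Ω x = ⊤) ∨
    (approxUpper u Ω x = ⊥ ∧ approxLower u Ω x = ⊥)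

/-- `C` is `L⁰`-polar in `Ω`. -/
def L0Polar (C Ω : Set (Euc N)) : Prop :=
  ∃ u : Euc N → ℝ, AEMeasurable u (volume.restrict Ω) ∧
    C ⊆ {x | x ∈ Ω ∧ HasInfApproxLimit u Ω x}

/-- `C` is `BV`-polar in `Ω`. -/
def BVPolar (C Ω : Set (Euc N)) : Prop :=
  ∃ u : Euc N → ℝ, MemBV u Ω ∧ C ⊆ {x | x ∈ Ω ∧ HasInfApproxLimit u Ω x}

/-- `C` is `GBV`-polar in `Ω`. -/
def GBVPolar (C Ω : Set (Euc N)) : Prop :=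
  ∃ u : Euc N → ℝ, MemGBV u Ω ∧ C ⊆ {x | x ∈ Ω ∧ HasInfApproxLimit u Ω x}

/-- The set `A^{(1)}` of points of `Ω` where `A` has density `1`. -/
def densityOne (A Ω : Set (Euc N)) : Set (Euc N) :=
  {x | x ∈ Ω ∧ HasDensity A x 1}

/-- The set `B⁺` of points of `Ω` where `B` has strictly positive upper density. -/
def posUpperDensity (B Ω : Set (Euc N)) : Set (Euc N) :=
  {x | x ∈ Ω ∧
    0 < limsup (fun ρ : ℝ => volume (B ∩ ball x ρ) / volume (ball x ρ)) (𝓝[>] 0)}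



/-- Compactly supported `C^1` vector fields in `Ω`. -/
def CC (Ω : Set (Euc N)) (φ : Euc N → Euc N) : Prop :=
  ContDiff ℝ 1 φ ∧ HasCompactSupport φ ∧ tsupport φ ⊆ Ω

lemma CC.diff {Ω : Set (Euc N)} {φ : Euc N → Euc N} (h : CC Ω φ) (x : Euc N) :
    DifferentiableAt ℝ φ x := (h.1.differentiable one_ne_zero) x

lemma diverg_smul {ψ : Euc N → ℝ} {φ : Euc N → Euc N} {x : Euc N}
    (hψ : DifferentiableAt ℝ ψ x) (hφ : DifferentiableAt ℝ φ x) :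
    diverg (fun y => ψ y • φ y) x = ψ x * diverg φ x + fderiv ℝ ψ x (φ x) := by
  unfold diverg
  have h1 : fderiv ℝ (fun y => ψ y • φ y) x =
      ψ x • fderiv ℝ φ x + (fderiv ℝ ψ x).smulRight (φ x) := fderiv_fun_smul hψ hφ
  have h2 : φ x = ∑ i, (φ x i) • (EuclideanSpace.single i (1:ℝ) : Euc N) := by
    ext j; simp [Finset.sum_apply, Pi.single_apply]
  conv_rhs => rw [h2]
  rw [h1, map_sum, Finset.mul_sum, ← Finset.sum_add_distrib]
  apply Finset.sum_congr rfl
  intro i _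
  simp [mul_comm]

lemma diverg_add {φ φ' : Euc N → Euc N} {x : Euc N}
    (hφ : DifferentiableAt ℝ φ x) (hφ' : DifferentiableAt ℝ φ' x) :
    diverg (fun y => φ y + φ' y) x = diverg φ x + diverg φ' x := by
  unfold diverg
  rw [fderiv_fun_add hφ hφ', ← Finset.sum_add_distrib]
  simp

lemma diverg_const_smul (c : ℝ) {φ : Euc N → Euc N} {x : Euc N}
    (hφ : DifferentiableAt ℝ φ x) :
    diverg (fun y => c • φ y) x = c * diverg φ x := by
  unfold diverg
  rw [fderiv_fun_const_smul hφ, Finset.mul_sum]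
  simp

lemma continuous_diverg {φ : Euc N → Euc N} (h : ContDiff ℝ 1 φ) : Continuous (diverg φ) := by
  unfold diverg
  have := h.continuous_fderiv one_ne_zero
  fun_prop

lemma tsupport_diverg (φ : Euc N → Euc N) : tsupport (diverg φ) ⊆ tsupport φ := by
  apply closure_minimal _ (isClosed_tsupport φ)
  intro x hx
  by_contra h
  apply hx
  have : fderiv ℝ φ x = 0 := by
    have := support_fderiv_subset ℝ (f := φ)
    by_contra h'
    exact h (this h')
  simp [diverg, this]

lemma diverg_compact {φ : Euc N → Euc N} (h : HasCompactSupport φ) :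
    HasCompactSupport (diverg φ) :=
  h.of_isClosed_subset (isClosed_tsupport _) (tsupport_diverg φ)

lemma CC.integrable {Ω : Set (Euc N)} {φ : Euc N → Euc N} (h : CC Ω φ) :
    Integrable (diverg φ) volume :=
  (continuous_diverg h.1).integrable_of_hasCompactSupport (diverg_compact h.2.1)

/-- The functional `φ ↦ ∫_B div φ`. -/
def DD (B : Set (Euc N)) (φ : Euc N → Euc N) : ℝ := ∫ x in B, diverg φ x

lemma CC.smul {Ω : Set (Euc N)} {φ : Euc N → Euc N} (h : CC Ω φ) {ψ : Euc N → ℝ}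
    (hψ : ContDiff ℝ 1 ψ) : CC Ω (fun x => ψ x • φ x) :=
  ⟨hψ.smul h.1, HasCompactSupport.smul_left (f := ψ) (f' := φ) h.2.1,
    (tsupport_smul_subset_right ψ φ).trans h.2.2⟩

lemma CC.smul_left {Ω : Set (Euc N)} {φ : Euc N → Euc N} (h : ContDiff ℝ 1 φ) {ψ : Euc N → ℝ}
    (hψ : ContDiff ℝ 1 ψ) (hc : HasCompactSupport ψ) (hs : tsupport ψ ⊆ Ω) :
    CC Ω (fun x => ψ x • φ x) :=
  ⟨hψ.smul h, HasCompactSupport.smul_right (f := ψ) (f' := φ) hc,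
    (tsupport_smul_subset_left ψ φ).trans hs⟩

lemma CC.add {Ω : Set (Euc N)} {φ φ' : Euc N → Euc N} (h : CC Ω φ) (h' : CC Ω φ') :
    CC Ω (fun x => φ x + φ' x) :=
  ⟨h.1.add h'.1, h.2.1.add h'.2.1,
    (tsupport_add φ φ').trans (union_subset h.2.2 h'.2.2)⟩

lemma CC.const_smul {Ω : Set (Euc N)} {φ : Euc N → Euc N} (h : CC Ω φ) (c : ℝ) :
    CC Ω (fun x => c • φ x) := h.smul contDiff_const

lemma CC.zero {Ω : Set (Euc N)} : CC Ω (fun _ => (0 : Euc N)) :=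
  ⟨contDiff_const, HasCompactSupport.zero, by
    have : tsupport (fun _ : Euc N => (0 : Euc N)) = ∅ := tsupport_eq_empty_iff.2 rfl
    rw [this]; exact empty_subset _⟩

lemma CC.mono {Ω Ω' : Set (Euc N)} {φ : Euc N → Euc N} (h : CC Ω φ) (hs : Ω ⊆ Ω') : CC Ω' φ :=
  ⟨h.1, h.2.1, h.2.2.trans hs⟩

lemma DD_add {B Ω : Set (Euc N)} {φ φ' : Euc N → Euc N} (h : CC Ω φ) (h' : CC Ω φ') :
    DD B (fun x => φ x + φ' x) = DD B φ + DD B φ' := by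
  unfold DD
  rw [← integral_add h.integrable.integrableOn h'.integrable.integrableOn]
  congr 1; ext x
  exact diverg_add (h.diff x) (h'.diff x)

lemma DD_const_smul {B Ω : Set (Euc N)} {φ : Euc N → Euc N} (h : CC Ω φ) (c : ℝ) :
    DD B (fun x => c • φ x) = c * DD B φ := by
  unfold DD
  rw [← integral_const_mul]
  congr 1; ext x
  exact diverg_const_smul c (h.diff x)

lemma DD_zero {B : Set (Euc N)} : DD B (fun _ => (0 : Euc N)) = 0 := by
  simp [DD, diverg]

lemma DD_sum {ι : Type*} {B Ω : Set (Euc N)} (s : Finset ι) {φ : ι → Euc N → Euc N}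
    (h : ∀ i ∈ s, CC Ω (φ i)) :
    CC Ω (fun x => ∑ i ∈ s, φ i x) ∧ DD B (fun x => ∑ i ∈ s, φ i x) = ∑ i ∈ s, DD B (φ i) := by
  classical
  induction s using Finset.induction_on with
  | empty => simpa using ⟨CC.zero, DD_zero⟩
  | insert a s ha ih =>
    have ih' := ih (fun i hi => h i (Finset.mem_insert_of_mem hi))
    have ha' := h a (Finset.mem_insert_self a s)
    simp only [Finset.sum_insert ha]
    exact ⟨ha'.add ih'.1, by rw [DD_add ha' ih'.1, ih'.2]⟩

lemma DD_smul_eq {B Ω : Set (Euc N)} {φ : Euc N → Euc N} (h : CC Ω φ) {ψ : Euc N → ℝ}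
    (hψ : ContDiff ℝ 1 ψ) :
    DD B (fun x => ψ x • φ x) =
      (∫ x in B, ψ x * diverg φ x) + ∫ x in B, fderiv ℝ ψ x (φ x) := by
  unfold DD
  rw [← integral_add]
  · congr 1; ext x
    exact diverg_smul (hψ.differentiable one_ne_zero x) (h.diff x)
  · apply Integrable.integrableOn
    exact (hψ.continuous.mul (continuous_diverg h.1)).integrable_of_hasCompactSupport
      (diverg_compact h.2.1).mul_left
  · apply Integrable.integrableOn
    have := hψ.continuous_fderiv one_ne_zero
    have h3 := h.1.continuous
    refine Continuous.integrable_of_hasCompactSupport (by fun_prop) ?_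
    apply h.2.1.mono
    intro x hx hx'
    apply hx
    simp [hx']

/-- The real perimeter. -/
def PP (B Ω : Set (Euc N)) : ℝ := (perimeter B Ω).toReal

lemma PP_nonneg (B Ω : Set (Euc N)) : 0 ≤ PP B Ω := ENNReal.toReal_nonneg

lemma DD_le_one {B Ω : Set (Euc N)} (hp : perimeter B Ω < ⊤) {φ : Euc N → Euc N} (h : CC Ω φ)
    (h1 : ∀ x, ‖φ x‖ ≤ 1) : DD B φ ≤ PP B Ω := by
  have h2 : ENNReal.ofReal (DD B φ) ≤ perimeter B Ω := by
    unfold perimeter DD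
    exact le_iSup₂_of_le (f := fun (φ : Euc N → Euc N) (_ : φ ∈ TestVF Ω) =>
      ENNReal.ofReal (∫ x in B, diverg φ x)) φ ⟨h.1, h.2.1, h.2.2, h1⟩ le_rfl
  exact (ENNReal.ofReal_le_iff_le_toReal hp.ne).1 h2

lemma DD_le {B Ω : Set (Euc N)} (hp : perimeter B Ω < ⊤) {φ : Euc N → Euc N} (h : CC Ω φ)
    {c : ℝ} (hc : 0 ≤ c) (h1 : ∀ x, ‖φ x‖ ≤ c) : DD B φ ≤ c * PP B Ω := by
  rcases hc.eq_or_lt with rfl | hc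
  · have : φ = fun _ => 0 := by
      ext1 x; exact norm_le_zero_iff.1 (h1 x)
    rw [this, DD_zero]; simp
  · have h2 := DD_le_one hp (h.const_smul c⁻¹) (by
      intro x
      rw [norm_smul, norm_inv, Real.norm_of_nonneg hc.le, inv_mul_le_iff₀ hc, mul_one]
      exact h1 x)
    rw [DD_const_smul h, inv_mul_le_iff₀ hc] at h2
    exact h2

lemma perimeter_le_of {B Ω : Set (Euc N)} {c : ℝ}
    (h : ∀ φ, CC Ω φ → (∀ x, ‖φ x‖ ≤ 1) → DD B φ ≤ c) : perimeter B Ω ≤ ENNReal.ofReal c := by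
  unfold perimeter
  refine iSup₂_le fun φ hφ => ?_
  exact ENNReal.ofReal_le_ofReal (h φ ⟨hφ.1, hφ.2.1, hφ.2.2.1⟩ hφ.2.2.2)

lemma exists_near_opt (B Ω : Set (Euc N)) {δ : ℝ} (hδ : 0 < δ) :
    ∃ φ, CC Ω φ ∧ (∀ x, ‖φ x‖ ≤ 1) ∧ PP B Ω - δ ≤ DD B φ := by
  by_contra hcon
  push Not at hcon
  have h1 := perimeter_le_of (B := B) (Ω := Ω) (c := PP B Ω - δ)
    (fun φ h h' => (hcon φ h h').le)
  have h0 := hcon _ CC.zero (by simp)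
  rw [DD_zero] at h0
  have h2 := ENNReal.toReal_mono ENNReal.ofReal_ne_top h1
  rw [ENNReal.toReal_ofReal h0.le] at h2
  unfold PP at *
  linarith

/-- Near-optimality lemma. -/
lemma near_opt {B Ω : Set (Euc N)} (hp : perimeter B Ω < ⊤) {δ : ℝ} {φ₀ : Euc N → Euc N}
    (h₀ : CC Ω φ₀) (h₀1 : ∀ x, ‖φ₀ x‖ ≤ 1) (hδ : PP B Ω - δ ≤ DD B φ₀)
    {φ : Euc N → Euc N} (h : CC Ω φ) {ψ : Euc N → ℝ} (hψ : ContDiff ℝ 1 ψ)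
    (hψ1 : ∀ x, ψ x ≤ 1) (hφψ : ∀ x, ‖φ x‖ ≤ ψ x) :
    DD B φ ≤ DD B (fun x => ψ x • φ₀ x) + δ := by
  have hA := h₀.smul hψ
  have h1 := DD_le_one hp ((h.add h₀).add (hA.const_smul (-1))) (by
    intro x
    have e : φ x + φ₀ x + (-1 : ℝ) • ψ x • φ₀ x = φ x + (1 - ψ x) • φ₀ x := by
      module
    rw [e]
    calc _ ≤ ‖φ x‖ + ‖(1 - ψ x) • φ₀ x‖ := norm_add_le _ _
      _ ≤ ψ x + (1 - ψ x) * 1 := by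
        rw [norm_smul, Real.norm_of_nonneg (by linarith [hψ1 x])]
        gcongr
        · exact hφψ x
        · linarith [hψ1 x]
        · exact h₀1 x
      _ = 1 := by ring)
  rw [DD_add (h.add h₀) (hA.const_smul (-1)), DD_add h h₀, DD_const_smul hA] at h1
  linarith


open scoped Manifold ContDiff in
lemma exists_cutoff {K O : Set (Euc N)} (hK : IsCompact K) (hO : IsOpen O) (h : K ⊆ O) :
    ∃ χ : Euc N → ℝ, ContDiff ℝ 1 χ ∧ HasCompactSupport χ ∧ tsupport χ ⊆ O ∧
      (∀ x, 0 ≤ χ x) ∧ (∀ x, χ x ≤ 1) ∧ ∀ x ∈ K, χ x = 1 := by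
  obtain ⟨K', hK', h1, h2⟩ := exists_compact_between hK hO h
  obtain ⟨f, hf1, hf0, hf⟩ := exists_contMDiffMap_one_nhds_of_subset_interior
    (n := 1) 𝓘(ℝ, Euc N) hK.isClosed h1
  have hs : tsupport f ⊆ K' := by
    apply closure_minimal _ hK'.isClosed
    intro x hx
    by_contra h
    exact hx (hf0 x h)
  refine ⟨f, f.contMDiff.contDiff, hK'.of_isClosed_subset (isClosed_tsupport _) hs,
    hs.trans h2, fun x => (hf x).1, fun x => (hf x).2, fun x hx => hf1.self_of_nhdsSet x hx⟩

/-- average of `χ` along a segment. -/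
def lineAvg (χ : Euc N → ℝ) (z x : Euc N) : ℝ := ∫ s in (0:ℝ)..1, χ (x + s • z)

lemma lineAvg_hasFDerivAt {χ : Euc N → ℝ} (h : ContDiff ℝ 1 χ) (hc : HasCompactSupport χ)
    (z x : Euc N) :
    HasFDerivAt (lineAvg χ z) (∫ s in (0:ℝ)..1, fderiv ℝ χ (x + s • z)) x := by
  have hd := h.continuous_fderiv one_ne_zero
  have hcd : HasCompactSupport (fderiv ℝ χ) := hc.fderiv ℝ
  obtain ⟨C, hC⟩ := hcd.exists_bound_of_continuous hd
  have hcont := h.continuous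
  refine intervalIntegral.hasFDerivAt_integral_of_dominated_of_fderiv_le
    (F := fun x s => χ (x + s • z)) (F' := fun x s => fderiv ℝ χ (x + s • z))
    (bound := fun _ => C) univ_mem ?_ ?_ ?_ ?_ ?_ ?_
  · refine Eventually.of_forall fun y => Continuous.aestronglyMeasurable (by fun_prop)
  · exact Continuous.intervalIntegrable (by fun_prop) _ _
  · exact Continuous.aestronglyMeasurable (by fun_prop)
  · exact Eventually.of_forall fun t _ y _ => hC _
  · exact intervalIntegrable_const
  · refine Eventually.of_forall fun t _ y _ => ?_
    have h1 : HasFDerivAt (fun y : Euc N => y + t • z) (ContinuousLinearMap.id ℝ (Euc N)) y :=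
      (hasFDerivAt_id y).add_const (t • z)
    have h2 := HasFDerivAt.comp (f := fun y : Euc N => y + t • z) y
      ((h.differentiable one_ne_zero (y + t • z)).hasFDerivAt) h1
    rw [ContinuousLinearMap.comp_id] at h2
    exact h2

lemma lineAvg_contDiff {χ : Euc N → ℝ} (h : ContDiff ℝ 1 χ) (hc : HasCompactSupport χ)
    (z : Euc N) : ContDiff ℝ 1 (lineAvg χ z) := by
  rw [contDiff_one_iff_fderiv]
  refine ⟨fun x => (lineAvg_hasFDerivAt h hc z x).differentiableAt, ?_⟩
  have : fderiv ℝ (lineAvg χ z) = fun x => ∫ s in (0:ℝ)..1, fderiv ℝ χ (x + s • z) := by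
    ext1 x; exact (lineAvg_hasFDerivAt h hc z x).fderiv
  rw [this]
  have hd := h.continuous_fderiv one_ne_zero
  exact intervalIntegral.continuous_parametric_intervalIntegral_of_continuous' (by fun_prop) _ _

lemma lineAvg_fderiv {χ : Euc N → ℝ} (h : ContDiff ℝ 1 χ) (hc : HasCompactSupport χ)
    (z x : Euc N) : fderiv ℝ (lineAvg χ z) x z = χ (x + z) - χ x := by
  have hd := h.continuous_fderiv one_ne_zero
  rw [(lineAvg_hasFDerivAt h hc z x).fderiv, ContinuousLinearMap.intervalIntegral_apply]
  · have := intervalIntegral.integral_eq_sub_of_hasDerivAt (a := 0) (b := 1)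
      (f := fun s : ℝ => χ (x + s • z)) (f' := fun s => fderiv ℝ χ (x + s • z) z) (by
        intro s _
        have h1 : HasDerivAt (fun s : ℝ => x + s • z) z s := by
          simpa using ((hasDerivAt_id s).smul_const z).const_add x
        exact ((h.differentiable one_ne_zero (x + s • z)).hasFDerivAt).comp_hasDerivAt s h1)
      (Continuous.intervalIntegrable (by fun_prop) _ _)
    rw [this]; simp
  · exact Continuous.intervalIntegrable (by fun_prop) _ _

lemma lineAvg_CC {χ : Euc N → ℝ} (h : ContDiff ℝ 1 χ) (hc : HasCompactSupport χ)
    {z : Euc N} {Ω : Set (Euc N)} (hs : ∀ x ∈ tsupport χ, ∀ s ∈ Icc (0:ℝ) 1, x - s • z ∈ Ω) :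
    CC Ω (fun x => lineAvg χ z x • (-z)) := by
  set K := (fun p : Euc N × ℝ => p.1 - p.2 • z) '' (tsupport χ ×ˢ Icc (0:ℝ) 1) with hKdef
  have hK : IsCompact K := (hc.isCompact.prod isCompact_Icc).image (by fun_prop)
  have hKΩ : K ⊆ Ω := by
    rintro _ ⟨⟨x, s⟩, ⟨hx, hs'⟩, rfl⟩
    exact hs x hx s hs'
  have hsup : tsupport (lineAvg χ z) ⊆ K := by
    apply closure_minimal _ hK.isClosed
    intro x hx
    by_contra hxK
    apply hx
    unfold lineAvg
    rw [intervalIntegral.integral_of_le zero_le_one]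
    apply setIntegral_eq_zero_of_forall_eq_zero
    intro s hs
    by_contra hne
    apply hxK
    exact ⟨⟨x + s • z, s⟩, ⟨subset_tsupport _ hne, ⟨hs.1.le, hs.2⟩⟩, by simp⟩
  exact CC.smul_left contDiff_const (lineAvg_contDiff h hc z)
    (hK.of_isClosed_subset (isClosed_tsupport _) hsup) (hsup.trans hKΩ)

lemma lineAvg_abs_le {χ : Euc N → ℝ} (h0 : ∀ x, 0 ≤ χ x)
    (h1 : ∀ x, χ x ≤ 1) (z x : Euc N) : |lineAvg χ z x| ≤ 1 := by
  have := intervalIntegral.norm_integral_le_of_norm_le_const (a := 0) (b := 1) (C := 1)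
    (f := fun s : ℝ => χ (x + s • z)) (by
      intro s _
      rw [Real.norm_of_nonneg (h0 _)]; exact h1 _)
  simpa [lineAvg] using this

/-- Translation estimate. -/
lemma translation_est {E U Ω : Set (Euc N)} (hE : MeasurableSet E) (hp : perimeter E Ω < ⊤)
    (hU : IsOpen U) {z : Euc N} (hs : ∀ x ∈ U, ∀ s ∈ Icc (0:ℝ) 1, x - s • z ∈ Ω) :
    volume {x | x ∈ U ∧ x ∈ E ∧ x - z ∉ E} ≤ ENNReal.ofReal (‖z‖ * PP E Ω) := by
  set A : Set (Euc N) := {x | x ∈ U ∧ x ∈ E ∧ x - z ∉ E} with hA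
  have hAm : MeasurableSet A := by
    have h1 : MeasurableSet {x : Euc N | x - z ∈ E} := hE.preimage (measurable_sub_const z)
    exact hU.measurableSet.inter (hE.inter h1.compl)
  rw [hAm.measure_eq_iSup_isCompact]
  refine iSup₂_le fun K hKA => iSup_le fun hK => ?_
  have hKfin : volume K ≠ ⊤ := hK.measure_lt_top.ne
  rw [← ENNReal.ofReal_toReal hKfin]
  apply ENNReal.ofReal_le_ofReal
  apply le_of_forall_pos_le_add
  intro ε hε
  -- open neighbourhood
  obtain ⟨O', hKO', hO', hvO'⟩ := K.exists_isOpen_lt_add hKfin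
    (ε := ENNReal.ofReal ε) (by simpa using hε)
  set O := O' ∩ U
  have hO : IsOpen O := hO'.inter hU
  have hKO : K ⊆ O := fun x hx => ⟨hKO' hx, (hKA hx).1⟩
  have hvO : volume (O \ K) ≤ ENNReal.ofReal ε := by
    rw [measure_sdiff hKO hK.measurableSet.nullMeasurableSet hKfin]
    rw [tsub_le_iff_left]
    exact (measure_mono inter_subset_left).trans hvO'.le
  obtain ⟨χ, hχ, hχc, hχs, hχ0, hχ1, hχK⟩ := exists_cutoff hK hO hKO
  have hCC := lineAvg_CC (z := z) (Ω := Ω) hχ hχc (fun x hx => hs x (hχs hx).2)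
  have hle := DD_le hp hCC (norm_nonneg z) (by
    intro x
    rw [norm_smul, norm_neg]
    have := lineAvg_abs_le hχ0 hχ1 z x
    exact mul_le_of_le_one_left (norm_nonneg _) this)
  have hdiv : DD E (fun x => lineAvg χ z x • (-z)) = ∫ x in E, (χ x - χ (x + z)) := by
    unfold DD
    congr 1; ext x
    rw [diverg_smul ((lineAvg_contDiff hχ hχc z).differentiable one_ne_zero x)
      (differentiableAt_const _), map_neg, lineAvg_fderiv hχ hχc]
    simp [diverg]
  rw [hdiv] at hle
  have hIntg : Integrable χ volume := hχ.continuous.integrable_of_hasCompactSupport hχc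
  have hIntg2 : Integrable (fun x => χ (x + z)) volume := hIntg.comp_add_right z
  have hEz : MeasurableSet {x : Euc N | x - z ∈ E} := hE.preimage (measurable_sub_const z)
  have e2 : ∫ x in E, χ (x + z) = ∫ x in {x | x - z ∈ E}, χ x := by
    rw [← integral_indicator hE, ← integral_indicator hEz]
    rw [← integral_add_right_eq_self (fun x => ({x | x - z ∈ E}).indicator χ x) z]
    congr 1; ext x
    have h1 : (x + z ∈ {x | x - z ∈ E}) = (x ∈ E) := by
      simp only [mem_ofPred_eq, add_sub_cancel_right]
    by_cases hx : x ∈ E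
    · rw [indicator_of_mem hx, indicator_of_mem (h1 ▸ hx)]
    · rw [indicator_of_notMem hx, indicator_of_notMem (h1 ▸ hx)]
  rw [integral_sub hIntg.integrableOn hIntg2.integrableOn, e2] at hle
  -- lower bound
  have hlow : (volume K).toReal - ε ≤ (∫ x in E, χ x) - ∫ x in {x | x - z ∈ E}, χ x := by
    have hOK : volume (O \ K) ≠ ⊤ := (hvO.trans_lt ENNReal.ofReal_lt_top).ne
    have h1 : ∫ x, (K.indicator (fun _ => (1:ℝ)) x - (O \ K).indicator (fun _ => (1:ℝ)) x) ≤
        ∫ x, (E.indicator χ x - ({x | x - z ∈ E}).indicator χ x) := by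
      apply integral_mono
      · apply Integrable.sub
        · exact (integrable_indicator_iff hK.measurableSet).2 (integrableOn_const hKfin)
        · exact (integrable_indicator_iff (hO.measurableSet.diff hK.measurableSet)).2
            (integrableOn_const hOK)
      · exact (hIntg.indicator hE).sub (hIntg.indicator hEz)
      · intro x
        by_cases hxK : x ∈ K
        · have h2 := hKA hxK
          have h3 : x ∉ {x | x - z ∈ E} := h2.2.2
          have h4 : x ∉ O \ K := fun h => h.2 hxK
          simp only [indicator_of_mem hxK, indicator_of_mem h2.2.1, indicator_of_notMem h3,
            indicator_of_notMem h4, hχK x hxK, le_refl]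
        · by_cases hxO : x ∈ O
          · have h4 : x ∈ O \ K := ⟨hxO, hxK⟩
            simp only [indicator_of_mem h4, indicator_of_notMem hxK]
            have h5 : 0 ≤ E.indicator χ x := indicator_nonneg (fun x _ => hχ0 x) x
            have h6 : ({x | x - z ∈ E}).indicator χ x ≤ 1 :=
              indicator_apply_le' (fun _ => hχ1 x) (fun _ => zero_le_one)
            linarith
          · have h4 : x ∉ O \ K := fun h => hxO h.1
            have h5 : χ x = 0 := by
              by_contra hne; exact hxO (hχs (subset_tsupport _ hne))
            have h6 : E.indicator χ x = 0 := indicator_apply_eq_zero.2 fun _ => h5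
            have h7 : ({x | x - z ∈ E}).indicator χ x = 0 :=
              indicator_apply_eq_zero.2 fun _ => h5
            simp only [indicator_of_notMem h4, indicator_of_notMem hxK, h6, h7, le_refl]
    rw [integral_sub, integral_sub, integral_indicator hE, integral_indicator hEz,
      integral_indicator hK.measurableSet,
      integral_indicator (hO.measurableSet.diff hK.measurableSet)] at h1
    · simp only [setIntegral_const, smul_eq_mul, mul_one, measureReal_def] at h1
      have h7 : (volume (O \ K)).toReal ≤ ε := ENNReal.toReal_le_of_le_ofReal hε.le hvO
      linarith
    · exact hIntg.indicator hE
    · exact hIntg.indicator hEz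
    · exact (integrable_indicator_iff hK.measurableSet).2 (integrableOn_const hKfin)
    · exact (integrable_indicator_iff (hO.measurableSet.diff hK.measurableSet)).2
            (integrableOn_const hOK)
  linarith


lemma rel_iso {E : Set (Euc N)} (hE : MeasurableSet E) {x₀ : Euc N} {r : ℝ}
    (hp : perimeter E (ball x₀ (3 * r)) < ⊤) :
    volume (E ∩ ball x₀ r) * volume (ball x₀ r \ E) ≤
      volume (ball (0 : Euc N) (2 * r)) * ENNReal.ofReal (2 * r * PP E (ball x₀ (3 * r))) := by
  set A := E ∩ ball x₀ r
  set C := ball x₀ r \ E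
  have hA : MeasurableSet A := hE.inter measurableSet_ball
  have hC : MeasurableSet C := measurableSet_ball.diff hE
  have e1 : volume A * volume C =
      ∫⁻ x, ∫⁻ z, A.indicator 1 x * C.indicator 1 (x - z) := by
    have : ∀ x : Euc N, ∫⁻ z, A.indicator (1 : Euc N → ℝ≥0∞) x * C.indicator 1 (x - z) =
        A.indicator 1 x * volume C := by
      intro x
      rw [lintegral_const_mul]
      · congr 1
        rw [lintegral_sub_left_eq_self (fun z => C.indicator (1 : Euc N → ℝ≥0∞) z) x,
          lintegral_indicator_one hC]
      · exact (measurable_one.indicator hC).comp (measurable_const_sub x)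
    simp_rw [this]
    rw [lintegral_mul_const _ (measurable_one.indicator hA), lintegral_indicator_one hA]
  rw [e1, lintegral_lintegral_swap]
  · set K : ℝ≥0∞ := ENNReal.ofReal (2 * r * PP E (ball x₀ (3 * r))) with hK
    calc _ ≤ ∫⁻ z, (ball (0 : Euc N) (2 * r)).indicator (fun _ => K) z := by
          apply lintegral_mono
          intro z
          by_cases hz : z ∈ ball (0 : Euc N) (2 * r)
          · rw [indicator_of_mem hz]
            have hz' : ‖z‖ < 2 * r := by simpa using hz
            have hT := translation_est (E := E) (U := ball x₀ r) (Ω := ball x₀ (3 * r)) hE hp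
              isOpen_ball (z := z) (by
                intro x hx s hs
                rw [mem_ball, dist_eq_norm] at *
                have : ‖s • z‖ ≤ ‖z‖ := by
                  rw [norm_smul, Real.norm_of_nonneg hs.1]
                  exact mul_le_of_le_one_left (norm_nonneg _) hs.2
                calc ‖x - s • z - x₀‖ = ‖(x - x₀) - s • z‖ := by congr 1; abel
                  _ ≤ ‖x - x₀‖ + ‖s • z‖ := norm_sub_le _ _
                  _ < 3 * r := by linarith)
            have hm : MeasurableSet {x : Euc N | x ∈ ball x₀ r ∧ x ∈ E ∧ x - z ∉ E} := by
              have h1 : MeasurableSet {x : Euc N | x - z ∈ E} :=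
                hE.preimage (measurable_sub_const z)
              exact measurableSet_ball.inter (hE.inter h1.compl)
            calc _ ≤ ∫⁻ x, ({x | x ∈ ball x₀ r ∧ x ∈ E ∧ x - z ∉ E}).indicator
                  (1 : Euc N → ℝ≥0∞) x := by
                  apply lintegral_mono
                  intro x
                  by_cases h1 : x ∈ A
                  · by_cases h2 : x - z ∈ C
                    · have h3 : x ∈ {x | x ∈ ball x₀ r ∧ x ∈ E ∧ x - z ∉ E} :=
                        ⟨h1.2, h1.1, h2.2⟩
                      beta_reduce
                      rw [indicator_of_mem h1, indicator_of_mem h2, indicator_of_mem h3]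
                      simp
                    · simp [indicator_of_notMem h2]
                  · simp [indicator_of_notMem h1]
              _ = volume {x | x ∈ ball x₀ r ∧ x ∈ E ∧ x - z ∉ E} := lintegral_indicator_one hm
              _ ≤ _ := hT
              _ ≤ _ := by
                apply ENNReal.ofReal_le_ofReal
                gcongr
                exact PP_nonneg _ _
          · rw [indicator_of_notMem hz, nonpos_iff_eq_zero]
            have : (fun x => A.indicator (1 : Euc N → ℝ≥0∞) x * C.indicator 1 (x - z)) =
                fun _ => 0 := by
              ext1 x
              by_cases h1 : x ∈ A
              · by_cases h2 : x - z ∈ C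
                · exfalso
                  apply hz
                  have h3 := h1.2
                  have h4 := h2.1
                  rw [mem_ball, dist_eq_norm] at *
                  calc ‖z - 0‖ = ‖(x - x₀) - (x - z - x₀)‖ := by congr 1; abel
                    _ ≤ ‖x - x₀‖ + ‖x - z - x₀‖ := norm_sub_le _ _
                    _ < _ := by linarith
                · simp [indicator_of_notMem h2]
              · simp [indicator_of_notMem h1]
            change ∫⁻ x, A.indicator (1 : Euc N → ℝ≥0∞) x * C.indicator 1 (x - z) = 0
            rw [this, lintegral_zero]
      _ = _ := by
        rw [lintegral_indicator measurableSet_ball, setLIntegral_const, mul_comm]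
  · apply Measurable.aemeasurable
    apply Measurable.mul
    · exact (measurable_one.indicator hA).comp measurable_fst
    · exact (measurable_one.indicator hC).comp (measurable_fst.sub measurable_snd)

lemma perimeter_mono {E Ω Ω' : Set (Euc N)} (h : Ω ⊆ Ω') : perimeter E Ω ≤ perimeter E Ω' := by
  unfold perimeter
  refine iSup₂_le fun φ hφ => ?_
  exact le_iSup₂_of_le (f := fun (φ : Euc N → Euc N) (_ : φ ∈ TestVF Ω') =>
      ENNReal.ofReal (∫ x in E, diverg φ x)) φ ⟨hφ.1, hφ.2.1, hφ.2.2.1.trans h, hφ.2.2.2⟩ le_rfl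

lemma PP_superadd {ι : Type*} {E Ω : Set (Euc N)} (hp : perimeter E Ω < ⊤) (s : Finset ι)
    (O : ι → Set (Euc N)) (hO : ∀ i ∈ s, O i ⊆ Ω)
    (hd : (s : Set ι).PairwiseDisjoint O) : ∑ i ∈ s, PP E (O i) ≤ PP E Ω := by
  classical
  apply le_of_forall_pos_le_add
  intro ε hε
  have hε' : 0 < ε / (s.card + 1) := by positivity
  have := fun i => exists_near_opt E (O i) hε'
  choose φ hφ hφ1 hφ2 using this
  have hsum := DD_sum (B := E) (Ω := Ω) s (φ := φ) (fun i hi => (hφ i).mono (hO i hi))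
  have h1 := DD_le_one hp hsum.1 (by
    intro x
    by_cases hx : ∃ i ∈ s, x ∈ O i
    · obtain ⟨i, hi, hxi⟩ := hx
      rw [Finset.sum_eq_single_of_mem i hi]
      · exact hφ1 i x
      · intro j hj hji
        by_contra hne
        have : x ∈ O j := (hφ j).2.2 (subset_tsupport _ hne)
        exact (disjoint_left.1 (hd hj hi hji) this) hxi
    · push Not at hx
      rw [Finset.sum_eq_zero]
      · simp
      · intro j hj
        by_contra hne
        exact hx j hj ((hφ j).2.2 (subset_tsupport _ hne)))
  rw [hsum.2] at h1
  have h2 : ∑ i ∈ s, (PP E (O i) - ε / (s.card + 1)) ≤ ∑ i ∈ s, DD E (φ i) :=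
    Finset.sum_le_sum fun i _ => hφ2 i
  rw [Finset.sum_sub_distrib, Finset.sum_const, nsmul_eq_mul] at h2
  have h3 : (s.card : ℝ) * (ε / (s.card + 1)) ≤ ε := by
    rw [mul_div_assoc', div_le_iff₀ (by positivity)]
    nlinarith
  linarith

lemma vol_ball (x : Euc N) {r : ℝ} (hr : 0 < r) :
    volume (ball x r) = ENNReal.ofReal (r ^ N) * volume (ball (0 : Euc N) 1) := by
  have := Measure.addHaar_ball_of_pos (volume : Measure (Euc N)) x hr
  simpa using this

/-- The volume of the unit ball. -/
def om (N : ℕ) : ℝ := (volume (ball (0 : Euc N) 1)).toReal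

lemma om_pos : 0 < om N :=
  ENNReal.toReal_pos (measure_ball_pos _ _ one_pos).ne' measure_ball_lt_top.ne

lemma vol_ball' (x : Euc N) {r : ℝ} (hr : 0 < r) :
    volume (ball x r) = ENNReal.ofReal (r ^ N * om N) := by
  rw [vol_ball x hr, ENNReal.ofReal_mul (by positivity), om,
    ENNReal.ofReal_toReal measure_ball_lt_top.ne]

lemma PP_lower {E : Set (Euc N)} (hE : MeasurableSet E) {x₀ : Euc N} {r η : ℝ} (hr : 0 < r)
    (hη : 0 < η)
    (hp : perimeter E (ball x₀ (3 * r)) < ⊤)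
    (h1 : ENNReal.ofReal η * volume (ball x₀ r) ≤ volume (E ∩ ball x₀ r))
    (h2 : volume (E ∩ ball x₀ r) ≤ ENNReal.ofReal (1/2) * volume (ball x₀ r)) :
    (η * om N / 2 ^ (N + 2)) * r ^ ((N : ℝ) - 1) ≤ PP E (ball x₀ (3 * r)) := by
  have h := rel_iso hE hp
  have hom := om_pos (N := N)
  have h3 : ENNReal.ofReal (1/2) * volume (ball x₀ r) ≤ volume (ball x₀ r \ E) := by
    have h4 : volume (ball x₀ r) ≤ volume (E ∩ ball x₀ r) + volume (ball x₀ r \ E) := by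
      rw [inter_comm]
      exact (measure_inter_add_sdiff _ hE).ge
    have h5 : volume (ball x₀ r) ≤
        ENNReal.ofReal (1/2) * volume (ball x₀ r) + volume (ball x₀ r \ E) :=
      h4.trans (by gcongr)
    rw [vol_ball' x₀ hr, ← ENNReal.ofReal_mul (by norm_num)] at h5 ⊢
    rw [← tsub_le_iff_left, ← ENNReal.ofReal_sub _ (by positivity)] at h5
    refine le_trans (ENNReal.ofReal_le_ofReal (by linarith)) h5
  have h6 := (mul_le_mul' h1 h3).trans h
  rw [vol_ball' x₀ hr, vol_ball' 0 (by positivity), ← ENNReal.ofReal_mul (by positivity),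
    ← ENNReal.ofReal_mul (by positivity), ← ENNReal.ofReal_mul (by positivity),
    ← ENNReal.ofReal_mul (by positivity), ENNReal.ofReal_le_ofReal_iff (by
      have := PP_nonneg E (ball x₀ (3 * r)); positivity)] at h6
  have h7 : r ^ ((N : ℝ) - 1) = r ^ N / r := by
    rw [Real.rpow_sub hr, Real.rpow_natCast, Real.rpow_one]
  rw [h7]
  have hrN : 0 < r ^ N := by positivity
  have h8 : (r ^ N * om N) * (η * (r ^ N * om N)) ≤
      (r ^ N * om N) * (2 ^ (N + 2) * r * PP E (ball x₀ (3 * r))) := by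
    rw [mul_pow] at h6
    rw [pow_add]
    nlinarith [h6]
  have h9 := le_of_mul_le_mul_left h8 (by positivity)
  rw [div_mul_div_comm, div_le_iff₀ (by positivity)]
  nlinarith [h9]

lemma cover_lemma {E Ω X : Set (Euc N)} (hN : 1 ≤ N) (hp : perimeter E Ω < ⊤) {c R : ℝ}
    (hc : 0 < c)
    (h : ∀ x ∈ X, ∃ r, 0 < r ∧ r ≤ R ∧ ball x (3 * r) ⊆ Ω ∧
      c * r ^ ((N : ℝ) - 1) ≤ PP E (ball x (3 * r))) :
    ∃ (u : Set (Euc N)) (t : u → Set (Euc N)), u.Countable ∧ X ⊆ ⋃ i, t i ∧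
      (∀ i, ediam (t i) ≤ ENNReal.ofReal (30 * R)) ∧
      ∑' i, ediam (t i) ^ ((N : ℝ) - 1) ≤
        ENNReal.ofReal (30 ^ ((N : ℝ) - 1) / c * PP E Ω) := by
  classical
  have hd : 0 ≤ (N : ℝ) - 1 := by
    have : (1 : ℝ) ≤ N := by exact_mod_cast hN
    linarith
  choose! r hr0 hrR hrΩ hrP using h
  obtain ⟨u, huX, hdis, hcov⟩ := Vitali.exists_disjoint_subfamily_covering_enlargement_ball X
    (fun x => x) (fun x => 3 * r x) (3 * R) (fun a ha => by have := hrR a ha; linarith) 5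
    (by norm_num)
  refine ⟨u, fun i => ball (i : Euc N) (15 * r i), ?_, ?_, ?_, ?_⟩
  · refine hdis.countable_of_isOpen (fun i _ => isOpen_ball) fun i hi => ?_
    exact nonempty_ball.2 (by have := hr0 i (huX hi); linarith)
  · intro x hx
    obtain ⟨b, hb, hsub⟩ := hcov x hx
    refine mem_iUnion.2 ⟨⟨b, hb⟩, ?_⟩
    have := hsub (mem_ball_self (by have := hr0 x hx; linarith))
    convert this using 2
    ring
  · intro i
    have h1 := hr0 i (huX i.2)
    have h2 := hrR i (huX i.2)
    calc _ ≤ ediam (closedBall (i : Euc N) (15 * r i)) := ediam_mono ball_subset_closedBall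
      _ ≤ ENNReal.ofReal (30 * r i) := by
        refine ediam_le fun y hy z hz => ?_
        rw [edist_dist]
        apply ENNReal.ofReal_le_ofReal
        rw [mem_closedBall] at hy hz
        linarith [dist_triangle_right y z (i : Euc N)]
      _ ≤ _ := ENNReal.ofReal_le_ofReal (by linarith)
  · have hone : ∀ i : u, ediam (ball (i : Euc N) (15 * r i)) ^ ((N : ℝ) - 1) ≤
        ENNReal.ofReal (30 ^ ((N : ℝ) - 1) / c * PP E (ball (i : Euc N) (3 * r i))) := by
      intro i
      have h1 := hr0 i (huX i.2)
      have h2 := hrP i (huX i.2)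
      have h3 : ediam (ball (i : Euc N) (15 * r i)) ≤ ENNReal.ofReal (30 * r i) := by
        refine ediam_le fun y hy z hz => ?_
        rw [edist_dist]
        apply ENNReal.ofReal_le_ofReal
        rw [mem_ball] at hy hz
        linarith [dist_triangle_right y z (i : Euc N)]
      calc _ ≤ (ENNReal.ofReal (30 * r i)) ^ ((N : ℝ) - 1) := ENNReal.rpow_le_rpow h3 hd
        _ = ENNReal.ofReal ((30 * r i) ^ ((N : ℝ) - 1)) :=
          ENNReal.ofReal_rpow_of_pos (by positivity)
        _ ≤ _ := by
          apply ENNReal.ofReal_le_ofReal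
          rw [Real.mul_rpow (by norm_num) h1.le, div_mul_eq_mul_div, mul_div_assoc]
          gcongr
          rw [le_div_iff₀ hc]
          linarith
    rw [ENNReal.tsum_eq_iSup_sum]
    refine iSup_le fun s => ?_
    calc _ ≤ ∑ i ∈ s, ENNReal.ofReal
          (30 ^ ((N : ℝ) - 1) / c * PP E (ball (i : Euc N) (3 * r i))) :=
          Finset.sum_le_sum fun i _ => hone i
      _ = ENNReal.ofReal (∑ i ∈ s, 30 ^ ((N : ℝ) - 1) / c * PP E (ball (i : Euc N) (3 * r i))) :=
        (ENNReal.ofReal_sum_of_nonneg fun i _ => by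
          have := PP_nonneg E (ball (i : Euc N) (3 * r i)); positivity).symm
      _ ≤ _ := by
        apply ENNReal.ofReal_le_ofReal
        rw [← Finset.mul_sum]
        gcongr
        apply PP_superadd hp s (fun i : u => ball (i : Euc N) (3 * r i))
        · exact fun i _ => hrΩ i (huX i.2)
        · intro i _ j _ hij
          exact hdis i.2 j.2 (fun h => hij (Subtype.ext h))

lemma good_radius {F : Set (Euc N)} {x : Euc N} {R η : ℝ} (hR : 0 < R)
    (hF : volume F < ENNReal.ofReal η * volume (ball (0 : Euc N) R))
    (hfr : ∃ᶠ r in 𝓝[>] (0:ℝ), ENNReal.ofReal η * volume (ball x r) ≤ volume (F ∩ ball x r)) :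
    ∃ r, 0 < r ∧ r ≤ 2 * R ∧
      ENNReal.ofReal ((2⁻¹) ^ N * η) * volume (ball x r) ≤ volume (F ∩ ball x r) ∧
      volume (F ∩ ball x r) ≤ ENNReal.ofReal η * volume (ball x r) := by
  obtain ⟨r₀, hr₀, hr₀'⟩ := (hfr.and_eventually (Ioo_mem_nhdsGT hR)).exists
  have hbig : ∀ ρ, R ≤ ρ → volume F < ENNReal.ofReal η * volume (ball x ρ) := by
    intro ρ hρ
    refine hF.trans_le ?_
    refine mul_le_mul_right ?_ _
    rw [vol_ball' 0 hR, vol_ball' x (hR.trans_le hρ)]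
    apply ENNReal.ofReal_le_ofReal
    have := om_pos (N := N)
    gcongr
  have hex : ∃ i : ℕ, ¬ (ENNReal.ofReal η * volume (ball x (2 ^ i * r₀)) ≤
      volume (F ∩ ball x (2 ^ i * r₀))) := by
    obtain ⟨n, hn⟩ := pow_unbounded_of_one_lt (R / r₀) (one_lt_two : (1:ℝ) < 2)
    refine ⟨n, ?_⟩
    push Not
    refine (measure_mono inter_subset_left).trans_lt (hbig _ ?_)
    rw [div_lt_iff₀ hr₀'.1] at hn
    exact hn.le
  classical
  obtain ⟨i, hi, hi'⟩ : ∃ i : ℕ, (ENNReal.ofReal η * volume (ball x (2 ^ i * r₀)) ≤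
      volume (F ∩ ball x (2 ^ i * r₀))) ∧ ¬ (ENNReal.ofReal η * volume (ball x (2 ^ (i+1) * r₀)) ≤
      volume (F ∩ ball x (2 ^ (i+1) * r₀))) := by
    have h0 : Nat.find hex ≠ 0 := by
      intro h0
      have := Nat.find_spec hex
      rw [h0] at this
      simp only [pow_zero, one_mul] at this
      exact this hr₀
    obtain ⟨j, hj⟩ := Nat.exists_eq_succ_of_ne_zero h0
    refine ⟨j, ?_, ?_⟩
    · have := Nat.find_min hex (m := j) (by omega)
      exact not_not.1 this
    · have := Nat.find_spec hex
      rw [hj] at this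
      exact this
  have hpos : 0 < 2 ^ i * r₀ := mul_pos (by positivity) hr₀'.1
  refine ⟨2 ^ (i+1) * r₀, mul_pos (by positivity) hr₀'.1, ?_, ?_, (not_le.1 hi').le⟩
  · by_contra hcon
    push Not at hcon
    have h1 : R ≤ 2 ^ i * r₀ := by
      rw [pow_succ] at hcon
      linarith
    exact absurd (hi.trans (measure_mono inter_subset_left)) (not_le.2 (hbig _ h1))
  · have h1 : ENNReal.ofReal ((2⁻¹) ^ N * η) * volume (ball x (2 ^ (i+1) * r₀)) =
        ENNReal.ofReal η * volume (ball x (2 ^ i * r₀)) := by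
      have e : (2 : ℝ) ^ (i+1) * r₀ = 2 * (2 ^ i * r₀) := by ring
      rw [e, vol_ball' x hpos, vol_ball' x (by positivity), ENNReal.ofReal_mul (by positivity),
        mul_right_comm, mul_comm, ← ENNReal.ofReal_mul (by positivity)]
      congr 2
      rw [mul_pow, ← mul_assoc, ← mul_assoc, ← mul_pow]
      norm_num
    rw [h1]
    refine hi.trans (measure_mono (inter_subset_inter_right _ (ball_subset_ball ?_)))
    rw [pow_succ]
    linarith

lemma HZ_aux {Ω X : Set (Euc N)} (hN : 1 ≤ N) {F : ℕ → Set (Euc N)}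
    (hF : ∀ k, MeasurableSet (F k)) (hp : ∀ k, perimeter (F k) Ω < ⊤)
    (hP : Tendsto (fun k => PP (F k) Ω) atTop (𝓝 0))
    (hV : Tendsto (fun k => volume (F k)) atTop (𝓝 0)) {η R₀ : ℝ} (hη : 0 < η) (hη2 : η ≤ 1/2)
    (hR₀ : 0 < R₀) (hX : ∀ x ∈ X, ball x R₀ ⊆ Ω)
    (h : ∀ x ∈ X, ∀ k, ∃ᶠ r in 𝓝[>] (0:ℝ),
      ENNReal.ofReal η * volume (ball x r) ≤ volume (F k ∩ ball x r)) :
    (μH[(N : ℝ) - 1] : Measure (Euc N)) X = 0 := by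
  have hom := om_pos (N := N)
  set c : ℝ := ((2⁻¹) ^ N * η) * om N / 2 ^ (N + 2) with hc
  have hc0 : 0 < c := by positivity
  have key : ∀ n : ℕ, ∃ (u : Set (Euc N)) (t : u → Set (Euc N)), u.Countable ∧ X ⊆ ⋃ i, t i ∧
      (∀ i, ediam (t i) ≤ ENNReal.ofReal (10 * R₀ * (1 / ((n : ℝ) + 1)))) ∧
      ∑' i, ediam (t i) ^ ((N : ℝ) - 1) ≤
        ENNReal.ofReal (30 ^ ((N : ℝ) - 1) / c * (1 / ((n : ℝ) + 1))) := by
    intro n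
    set R := R₀ / 6 * (1 / ((n : ℝ) + 1)) with hR
    have hn1 : 1 / ((n : ℝ) + 1) ≤ 1 := by
      rw [div_le_one (by positivity)]
      linarith [n.cast_nonneg (α := ℝ)]
    have hR0 : 0 < R := by positivity
    have hR1 : 6 * R ≤ R₀ := by
      rw [hR]
      nlinarith
    have e1 : ∀ᶠ k in atTop, PP (F k) Ω < 1 / ((n : ℝ) + 1) :=
      hP.eventually_lt_const (by positivity)
    have e2 : ∀ᶠ k in atTop, volume (F k) < ENNReal.ofReal η * volume (ball (0 : Euc N) R) := by
      apply hV.eventually_lt_const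
      rw [vol_ball' _ hR0, ← ENNReal.ofReal_mul hη.le]
      exact ENNReal.ofReal_pos.2 (by positivity)
    obtain ⟨k, hk1, hk2⟩ := (e1.and e2).exists
    obtain ⟨u, t, hu, ht1, ht2, ht3⟩ := cover_lemma (X := X) hN (hp k) (R := 2 * R) hc0 (by
      intro x hx
      obtain ⟨r, hr0, hr2, h1, h2⟩ := good_radius hR0 hk2 (h x hx k)
      have hsub : ball x (3 * r) ⊆ Ω := (ball_subset_ball (by linarith)).trans (hX x hx)
      refine ⟨r, hr0, hr2, hsub, ?_⟩
      refine PP_lower (hF k) hr0 (by positivity) ((perimeter_mono hsub).trans_lt (hp k)) h1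
        (h2.trans ?_)
      gcongr)
    refine ⟨u, t, hu, ht1, fun i => (ht2 i).trans_eq ?_, ht3.trans ?_⟩
    · congr 1
      rw [hR]; ring
    · apply ENNReal.ofReal_le_ofReal
      gcongr
  choose u t hu ht1 ht2 ht3 using key
  have : ∀ n, Countable (u n) := fun n => (hu n).to_subtype
  have hlim : ∀ a : ℝ, Tendsto (fun n : ℕ => ENNReal.ofReal (a * (1 / ((n : ℝ) + 1)))) atTop
      (𝓝 0) := by
    intro a
    have := ENNReal.tendsto_ofReal (tendsto_one_div_add_atTop_nhds_zero_nat.const_mul a)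
    simpa using this
  have h1 := Measure.hausdorffMeasure_le_liminf_tsum ((N : ℝ) - 1) X (l := atTop)
    (fun n : ℕ => ENNReal.ofReal (10 * R₀ * (1 / ((n : ℝ) + 1)))) (hlim _) t
    (Eventually.of_forall ht2) (Eventually.of_forall ht1)
  have h2 : Tendsto (fun n => ∑' i, ediam (t n i) ^ ((N : ℝ) - 1)) atTop (𝓝 0) :=
    tendsto_of_tendsto_of_tendsto_of_le_of_le tendsto_const_nhds
      (hlim (30 ^ ((N : ℝ) - 1) / c)) (fun _ => zero_le) ht3
  rw [h2.liminf_eq] at h1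
  exact le_antisymm h1 zero_le

lemma HZ {Ω X : Set (Euc N)} (hN : 1 ≤ N) (hΩ : IsOpen Ω) {F : ℕ → Set (Euc N)}
    (hF : ∀ k, MeasurableSet (F k)) (hp : ∀ k, perimeter (F k) Ω < ⊤)
    (hP : Tendsto (fun k => PP (F k) Ω) atTop (𝓝 0))
    (hV : Tendsto (fun k => volume (F k)) atTop (𝓝 0)) (hX : X ⊆ Ω)
    (h : ∀ x ∈ X, ∃ η : ℝ, 0 < η ∧ ∀ k, ∃ᶠ r in 𝓝[>] (0:ℝ),
      ENNReal.ofReal η * volume (ball x r) ≤ volume (F k ∩ ball x r)) :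
    (μH[(N : ℝ) - 1] : Measure (Euc N)) X = 0 := by
  set Y : ℕ → Set (Euc N) := fun n => {x | x ∈ X ∧ ball x (1 / ((n : ℝ) + 2)) ⊆ Ω ∧
    ∀ k, ∃ᶠ r in 𝓝[>] (0:ℝ),
      ENNReal.ofReal (1 / ((n : ℝ) + 2)) * volume (ball x r) ≤ volume (F k ∩ ball x r)} with hY
  have hsub : X ⊆ ⋃ n, Y n := by
    intro x hx
    obtain ⟨η, hη, h1⟩ := h x hx
    obtain ⟨ρ, hρ, hρΩ⟩ := Metric.isOpen_iff.1 hΩ x (hX hx)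
    obtain ⟨n, hn⟩ := exists_nat_one_div_lt (lt_min hη hρ)
    have hn2 : 1 / ((n : ℝ) + 2) ≤ 1 / ((n : ℝ) + 1) := by
      apply one_div_le_one_div_of_le <;> linarith [n.cast_nonneg (α := ℝ)]
    refine mem_iUnion.2 ⟨n, hx, (ball_subset_ball ?_).trans hρΩ, fun k => (h1 k).mono ?_⟩
    · exact hn2.trans (hn.le.trans (min_le_right _ _))
    · intro r hr
      refine le_trans ?_ hr
      gcongr
      exact hn2.trans (hn.le.trans (min_le_left _ _))
  refine measure_mono_null hsub (measure_iUnion_null fun n => ?_)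
  refine HZ_aux hN hF hp hP hV (η := 1 / ((n : ℝ) + 2)) (R₀ := 1 / ((n : ℝ) + 2))
    (by positivity) ?_ (by positivity) (fun x hx => hx.2.1) (fun x hx => hx.2.2)
  apply one_div_le_one_div_of_le <;> linarith [n.cast_nonneg (α := ℝ)]


/-- The base bump. -/
def bump0 (N : ℕ) : ContDiffBump (0 : Euc N) := ⟨1/2, 1, by norm_num, by norm_num⟩

/-- The base mollifier. -/
def rho0 : Euc N → ℝ := (bump0 N).normed volume

lemma rho0_contDiff : ContDiff ℝ 1 (rho0 (N := N)) :=
  (bump0 N).contDiff_normed (n := 1)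

lemma rho0_compact : HasCompactSupport (rho0 (N := N)) := (bump0 N).hasCompactSupport_normed

/-- The scaled mollifier. -/
def rho (r : ℝ) (z : Euc N) : ℝ := (r ^ N)⁻¹ * rho0 (r⁻¹ • z)

lemma rho_contDiff (r : ℝ) : ContDiff ℝ 1 (rho r : Euc N → ℝ) := by
  unfold rho
  have := rho0_contDiff (N := N)
  fun_prop

lemma rho_nonneg {r : ℝ} (hr : 0 < r) (z : Euc N) : 0 ≤ rho r z :=
  mul_nonneg (by positivity) ((bump0 N).nonneg_normed _)

lemma rho_neg (r : ℝ) (z : Euc N) : rho r (-z) = rho r z := by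
  unfold rho rho0
  rw [smul_neg, ContDiffBump.normed_neg]

lemma rho_eq_zero {r : ℝ} (hr : 0 < r) {z : Euc N} (hz : r ≤ ‖z‖) : rho r z = 0 := by
  unfold rho
  have h : rho0 (r⁻¹ • z) = 0 := by
    rw [← Function.notMem_support]
    unfold rho0
    rw [ContDiffBump.support_normed_eq]
    simp only [mem_ball, dist_zero_right, not_lt, norm_smul, norm_inv, Real.norm_of_nonneg hr.le]
    show (1:ℝ) ≤ _
    rw [le_inv_mul_iff₀ hr]
    linarith
  rw [h, mul_zero]

lemma rho_compact {r : ℝ} (hr : 0 < r) : HasCompactSupport (rho r : Euc N → ℝ) := by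
  apply HasCompactSupport.intro (isCompact_closedBall (0 : Euc N) r)
  intro z hz
  apply rho_eq_zero hr
  simp at hz
  exact hz.le

lemma rho_integrable {r : ℝ} (hr : 0 < r) : Integrable (rho r : Euc N → ℝ) :=
  (rho_contDiff r).continuous.integrable_of_hasCompactSupport (rho_compact hr)

lemma rho_integral {r : ℝ} (hr : 0 < r) : ∫ z : Euc N, rho r z = 1 := by
  unfold rho
  rw [integral_const_mul, Measure.integral_comp_inv_smul]
  unfold rho0
  rw [ContDiffBump.integral_normed]
  simp only [finrank_euclideanSpace, Fintype.card_fin, smul_eq_mul, mul_one]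
  rw [abs_of_pos (by positivity)]
  field_simp

/-- A bound for the base mollifier. -/
lemma rho0_bound : ∃ C : ℝ, 0 < C ∧ (∀ z : Euc N, rho0 z ≤ C) ∧
    ∀ z : Euc N, ‖fderiv ℝ (rho0 (N := N)) z‖ ≤ C := by
  obtain ⟨C₁, h1⟩ := rho0_compact.exists_bound_of_continuous (rho0_contDiff (N := N)).continuous
  obtain ⟨C₂, h2⟩ := (rho0_compact.fderiv ℝ).exists_bound_of_continuous
    ((rho0_contDiff (N := N)).continuous_fderiv one_ne_zero)
  refine ⟨max 1 (max C₁ C₂), by positivity, fun z => ?_, fun z => ?_⟩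
  · exact (le_abs_self _).trans ((h1 z).trans ((le_max_left _ _).trans (le_max_right _ _)))
  · exact (h2 z).trans ((le_max_right _ _).trans (le_max_right _ _))

/-- The constant. -/
def Crho (N : ℕ) : ℝ := (rho0_bound (N := N)).choose

lemma Crho_pos : 0 < Crho N := (rho0_bound (N := N)).choose_spec.1

lemma rho_le {r : ℝ} (hr : 0 < r) (z : Euc N) : rho r z ≤ Crho N / r ^ N := by
  unfold rho
  rw [div_eq_inv_mul]
  gcongr
  exact (rho0_bound (N := N)).choose_spec.2.1 _

lemma rho_fderiv_le {r : ℝ} (hr : 0 < r) (z : Euc N) :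
    ‖fderiv ℝ (rho r) z‖ ≤ Crho N / r ^ N / r := by
  have h1 : HasFDerivAt (rho r) ((r ^ N)⁻¹ • ((fderiv ℝ rho0 (r⁻¹ • z)).comp
      (r⁻¹ • ContinuousLinearMap.id ℝ (Euc N)))) z := by
    have h2 : HasFDerivAt (fun z : Euc N => r⁻¹ • z) (r⁻¹ • ContinuousLinearMap.id ℝ (Euc N)) z :=
      (hasFDerivAt_id z).const_smul r⁻¹
    have h3 : HasFDerivAt rho0 (fderiv ℝ (rho0 (N := N)) (r⁻¹ • z)) (r⁻¹ • z) :=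
      ((rho0_contDiff (N := N)).differentiable one_ne_zero _).hasFDerivAt
    exact (h3.comp z h2).const_smul ((r ^ N)⁻¹)
  rw [h1.fderiv, norm_smul, ContinuousLinearMap.comp_smul, norm_smul,
    ContinuousLinearMap.comp_id, norm_inv, norm_inv, Real.norm_of_nonneg hr.le,
    Real.norm_of_nonneg (by positivity)]
  have := (rho0_bound (N := N)).choose_spec.2.2 (r⁻¹ • z)
  calc _ ≤ (r ^ N)⁻¹ * (r⁻¹ * Crho N) := by gcongr; exact this
    _ = _ := by field_simp

lemma rho_fderiv_eq_zero {r : ℝ} (hr : 0 < r) {z : Euc N} (hz : r < ‖z‖) :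
    fderiv ℝ (rho r) z = 0 := by
  have : rho r =ᶠ[𝓝 z] fun _ => 0 := by
    have : ∀ᶠ y : Euc N in 𝓝 z, r < ‖y‖ := continuous_norm.continuousAt.eventually_const_lt hz
    filter_upwards [this] with y hy using rho_eq_zero hr hy.le
  rw [this.fderiv_eq]
  simp

lemma rho_fderiv_neg (r : ℝ) (z : Euc N) : fderiv ℝ (rho r) (-z) = - fderiv ℝ (rho r) z := by
  have h1 : HasFDerivAt (rho r) (fderiv ℝ (rho r) z) (- -z) := by
    rw [neg_neg]
    exact ((rho_contDiff (N := N) r).differentiable one_ne_zero z).hasFDerivAt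
  have h2 := h1.comp (-z) ((hasFDerivAt_id (-z)).neg)
  have h3 : (rho r : Euc N → ℝ) ∘ Neg.neg = rho r := by
    ext y; exact rho_neg r y
  have h4 : HasFDerivAt (rho r) ((fderiv ℝ (rho r) z).comp
      (-ContinuousLinearMap.id ℝ (Euc N))) (-z) := by
    rwa [h3] at h2
  rw [h4.fderiv]
  ext y
  simp

set_option linter.unusedSectionVars false

section moll
variable {E : Type*} [NormedAddCommGroup E] [NormedSpace ℝ E] [CompleteSpace E]

/-- Mollification. -/
def moll (r : ℝ) (f : Euc N → E) (x : Euc N) : E := ∫ z, rho r z • f (x - z)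

lemma moll_eq (r : ℝ) (f : Euc N → E) :
    moll r f = convolution (rho r) f (ContinuousLinearMap.lsmul ℝ ℝ) volume := rfl

lemma moll_swap (r : ℝ) (f : Euc N → E) (x : Euc N) :
    moll r f x = ∫ y, rho r (x - y) • f y := by
  rw [moll_eq, convolution_lsmul_swap]

lemma moll_contDiff {r : ℝ} (hr : 0 < r) {f : Euc N → E} (hf : LocallyIntegrable f) :
    ContDiff ℝ 1 (moll r f) := by
  rw [moll_eq]
  exact (rho_compact hr).contDiff_convolution_left (n := 1) _ (rho_contDiff r) hf

lemma moll_integrand {r : ℝ} (hr : 0 < r) {f : Euc N → E} (hf : LocallyIntegrable f) (x : Euc N) :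
    Integrable (fun z => rho r z • f (x - z)) :=
  ((rho_compact hr).convolutionExists_left (ContinuousLinearMap.lsmul ℝ ℝ)
    (rho_contDiff r).continuous hf) x

lemma moll_dist {r : ℝ} (hr : 0 < r) {f : Euc N → E} (hf : Continuous f) {L : ℝ}
    (hL : ∀ x y, ‖f x - f y‖ ≤ L * ‖x - y‖) (hL0 : 0 ≤ L) (x : Euc N) :
    ‖moll r f x - f x‖ ≤ L * r := by
  have h1 : f x = ∫ z : Euc N, rho r z • f x := by
    rw [integral_smul_const, rho_integral hr, one_smul]
  have hi1 := moll_integrand hr hf.locallyIntegrable x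
  have hi2 : Integrable (fun z : Euc N => rho r z • f x) := (rho_integrable hr).smul_const _
  have h2 : moll r f x - f x = ∫ z : Euc N, (rho r z • f (x - z) - rho r z • f x) := by
    rw [integral_sub hi1 hi2, ← h1, moll]
  rw [h2]
  calc _ ≤ ∫ z : Euc N, rho r z * (L * r) := by
        apply norm_integral_le_of_norm_le ((rho_integrable hr).mul_const _)
        apply Eventually.of_forall
        intro z
        rw [← smul_sub, norm_smul, Real.norm_of_nonneg (rho_nonneg hr z)]
        by_cases hz : r ≤ ‖z‖
        · rw [rho_eq_zero hr hz]; simp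
        · push Not at hz
          apply mul_le_mul_of_nonneg_left _ (rho_nonneg hr z)
          refine (hL _ _).trans ?_
          have : x - z - x = -z := by abel
          rw [this, norm_neg]
          gcongr
    _ = L * r := by rw [integral_mul_const, rho_integral hr, one_mul]

lemma moll_norm_le {r : ℝ} (hr : 0 < r) {f : Euc N → E} {g : Euc N → ℝ}
    (hg : LocallyIntegrable g) (hfg : ∀ x, ‖f x‖ ≤ g x) (x : Euc N) :
    ‖moll r f x‖ ≤ moll r g x := by
  unfold moll
  apply norm_integral_le_of_norm_le (moll_integrand hr hg x)
  apply Eventually.of_forall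
  intro z
  rw [norm_smul, Real.norm_of_nonneg (rho_nonneg hr z), smul_eq_mul]
  exact mul_le_mul_of_nonneg_left (hfg _) (rho_nonneg hr z)

lemma moll_nonneg {r : ℝ} (hr : 0 < r) {g : Euc N → ℝ} (h : ∀ x, 0 ≤ g x) (x : Euc N) :
    0 ≤ moll r g x :=
  integral_nonneg fun z => mul_nonneg (rho_nonneg hr z) (h _)

lemma moll_le_one {r : ℝ} (hr : 0 < r) {g : Euc N → ℝ} (hg : LocallyIntegrable g)
    (h : ∀ x, g x ≤ 1) (x : Euc N) : moll r g x ≤ 1 := by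
  rw [← rho_integral (N := N) hr]
  apply integral_mono (moll_integrand hr hg x) (rho_integrable hr)
  intro z
  show rho r z * g (x - z) ≤ rho r z
  exact mul_le_of_le_one_right (rho_nonneg hr z) (h _)

lemma moll_tsupport {r : ℝ} (hr : 0 < r) (f : Euc N → E) :
    tsupport (moll r f) ⊆ cthickening r (tsupport f) := by
  apply closure_minimal _ isClosed_cthickening
  intro x hx
  by_contra hcon
  apply hx
  unfold moll
  rw [← integral_zero (Euc N) E (μ := volume)]
  congr 1; ext1 z
  by_cases hz : r ≤ ‖z‖
  · rw [rho_eq_zero hr hz, zero_smul]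
  · push Not at hz
    have : f (x - z) = 0 := by
      by_contra h
      apply hcon
      apply mem_cthickening_of_dist_le x (x - z) r _ (subset_tsupport _ h)
      rw [dist_eq_norm]
      simpa using hz.le
    rw [this, smul_zero]

lemma moll_compact {r : ℝ} (hr : 0 < r) {f : Euc N → E} (hf : HasCompactSupport f) :
    HasCompactSupport (moll r f) :=
  IsCompact.of_isClosed_subset (hf.isCompact.cthickening) (isClosed_tsupport _) (moll_tsupport hr f)

end moll

lemma moll_CC {r : ℝ} (hr : 0 < r) {Ω : Set (Euc N)} {φ : Euc N → Euc N} (h : CC Ω φ)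
    (hs : cthickening r (tsupport φ) ⊆ Ω) : CC Ω (moll r φ) :=
  ⟨moll_contDiff hr h.1.continuous.locallyIntegrable, moll_compact hr h.2.1,
    (moll_tsupport hr φ).trans hs⟩

lemma moll_diverg {r : ℝ} (hr : 0 < r) {Ω : Set (Euc N)} {φ : Euc N → Euc N} (h : CC Ω φ)
    (x : Euc N) : diverg (moll r φ) x = moll r (diverg φ) x := by
  have h1 := (h.2.1.hasFDerivAt_convolution_right (ContinuousLinearMap.lsmul ℝ ℝ)
    (rho_contDiff (N := N) r).continuous.locallyIntegrable h.1 x (μ := volume))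
  have hcf := h.1.continuous_fderiv one_ne_zero
  unfold diverg
  rw [moll_eq, h1.fderiv]
  have hIntg : ∀ i : Fin N, Integrable
      (fun z => rho r z • fderiv ℝ φ (x - z) (EuclideanSpace.single i 1)) := by
    intro i
    exact moll_integrand hr (f := fun y => fderiv ℝ φ y (EuclideanSpace.single i 1))
      (Continuous.locallyIntegrable (by fun_prop)) x
  have h2 : ∀ i : Fin N, (convolution (rho r) (fderiv ℝ φ)
      ((ContinuousLinearMap.lsmul ℝ ℝ).precompR (Euc N)) volume x)
        (EuclideanSpace.single i 1) i = ∫ z, rho r z * fderiv ℝ φ (x - z)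
        (EuclideanSpace.single i 1) i := by
    intro i
    rw [convolution_precompR_apply _ (rho_contDiff (N := N) r).continuous.locallyIntegrable
      (h.2.1.fderiv ℝ) hcf, convolution_lsmul]
    exact (ContinuousLinearMap.integral_comp_comm (EuclideanSpace.proj i : Euc N →L[ℝ] ℝ)
      (hIntg i)).symm
  simp_rw [h2]
  rw [← integral_finsetSum]
  · unfold moll
    congr 1; ext z
    rw [smul_eq_mul, Finset.mul_sum]
  · intro i _
    exact (EuclideanSpace.proj i : Euc N →L[ℝ] ℝ).integrable_comp (hIntg i)

/-- Divergence theorem. -/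
lemma DD_univ {Ω : Set (Euc N)} {φ : Euc N → Euc N} (h : CC Ω φ) : DD univ φ = 0 := by
  unfold DD diverg
  have hcf := h.1.continuous_fderiv one_ne_zero
  have hIntg : ∀ i : Fin N, Integrable
      (fun z => fderiv ℝ φ z (EuclideanSpace.single i 1) i) := by
    intro i
    apply Continuous.integrable_of_hasCompactSupport (by fun_prop)
    apply (h.2.1.fderiv ℝ).mono
    intro x hx hx'
    apply hx
    simp [hx']
  rw [Measure.restrict_univ, integral_finsetSum _ fun i _ => hIntg i]
  apply Finset.sum_eq_zero
  intro i _
  have hd : ∀ z, HasFDerivAt (fun y => φ y i)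
      ((EuclideanSpace.proj i : Euc N →L[ℝ] ℝ).comp (fderiv ℝ φ z)) z := by
    intro z
    exact (EuclideanSpace.proj i : Euc N →L[ℝ] ℝ).hasFDerivAt.comp z (h.diff z).hasFDerivAt
  have hd' : ∀ z, fderiv ℝ φ z (EuclideanSpace.single i 1) i =
      1 * fderiv ℝ (fun y => φ y i) z (EuclideanSpace.single i 1) := by
    intro z
    rw [(hd z).fderiv]; simp
  simp_rw [hd']
  rw [integral_mul_fderiv_eq_neg_fderiv_mul_of_integrable (f := fun _ : Euc N => (1:ℝ))
    (g := fun y => φ y i)]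
  · simp
  · simp
  · simp_rw [← hd']; exact hIntg i
  · simp only [one_mul]
    have hφ := h.1.continuous
    apply Continuous.integrable_of_hasCompactSupport (by fun_prop)
    apply h.2.1.mono
    intro x hx hx'
    apply hx
    simp [hx']
  · intro x _; fun_prop
  · intro x _; exact (hd x).differentiableAt

/-- Integration by parts. -/
lemma ibp {Ω : Set (Euc N)} {φ : Euc N → Euc N} (h : CC Ω φ) {ψ : Euc N → ℝ}
    (hψ : ContDiff ℝ 1 ψ) : (∫ x, ψ x * diverg φ x) = - ∫ x, fderiv ℝ ψ x (φ x) := by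
  have h1 := DD_univ (h.smul hψ)
  rw [DD_smul_eq h hψ] at h1
  simp only [Measure.restrict_univ] at h1
  linarith


/-- The mollified indicator. -/
def vv (B : Set (Euc N)) (r : ℝ) : Euc N → ℝ := moll r (B.indicator fun _ => (1:ℝ))

lemma ind_locInt {B : Set (Euc N)} (hB : MeasurableSet B) :
    LocallyIntegrable (B.indicator fun _ => (1:ℝ)) :=
  (locallyIntegrable_const (1:ℝ)).indicator hB

lemma vv_contDiff {B : Set (Euc N)} (hB : MeasurableSet B) {r : ℝ} (hr : 0 < r) :
    ContDiff ℝ 1 (vv B r) := moll_contDiff hr (ind_locInt hB)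

lemma vv_nonneg (B : Set (Euc N)) {r : ℝ} (hr : 0 < r) (x : Euc N) : 0 ≤ vv B r x :=
  moll_nonneg hr (fun x => indicator_nonneg (fun _ _ => zero_le_one) x) x

lemma vv_le_one {B : Set (Euc N)} (hB : MeasurableSet B) {r : ℝ} (hr : 0 < r) (x : Euc N) :
    vv B r x ≤ 1 :=
  moll_le_one hr (ind_locInt hB) (fun x => indicator_le_self' (fun _ _ => zero_le_one) x) x

lemma vv_swap {B : Set (Euc N)} (hB : MeasurableSet B) (r : ℝ) (x : Euc N) :
    vv B r x = ∫ y in B, rho r (x - y) := by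
  unfold vv
  rw [moll_swap, ← integral_indicator hB]
  congr 1; ext y
  by_cases hy : y ∈ B <;> simp [hy]

lemma vv_fderiv {B : Set (Euc N)} (hB : MeasurableSet B) {r : ℝ} (hr : 0 < r) (x e : Euc N) :
    fderiv ℝ (vv B r) x e = ∫ y in B, fderiv ℝ (rho r) (x - y) e := by
  have h1 := (rho_compact (N := N) hr).hasFDerivAt_convolution_left (ContinuousLinearMap.lsmul ℝ ℝ)
    (rho_contDiff r) (ind_locInt hB) x (μ := volume)
  have h2 := (((rho_compact (N := N) hr).fderiv ℝ).convolutionExists_left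
    ((ContinuousLinearMap.lsmul ℝ ℝ : ℝ →L[ℝ] ℝ →L[ℝ] ℝ).precompL (Euc N))
    ((rho_contDiff r).continuous_fderiv one_ne_zero) (ind_locInt hB) x).integrable_swap
  unfold vv
  rw [moll_eq, h1.fderiv, convolution_eq_swap, ContinuousLinearMap.integral_apply h2,
    ← integral_indicator hB]
  congr 1; ext y
  by_cases hy : y ∈ B <;> simp [hy, ContinuousLinearMap.precompL_apply]

lemma prod_integrable {F : Euc N × Euc N → ℝ} (hF : Continuous F) {K : Set (Euc N)}
    (hK : IsCompact K) {r : ℝ} (h0 : ∀ x y, x ∉ K → F (x, y) = 0)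
    (h1 : ∀ x y, r < ‖x - y‖ → F (x, y) = 0) (A B : Set (Euc N)) :
    Integrable F ((volume.restrict A).prod (volume.restrict B)) := by
  have h : Integrable F ((volume : Measure (Euc N)).prod volume) := by
    apply hF.integrable_of_hasCompactSupport
    apply HasCompactSupport.intro (hK.prod (hK.cthickening (r := r)))
    rintro ⟨x, y⟩ hxy
    by_cases hx : x ∈ K
    · apply h1
      by_contra hcon
      push Not at hcon
      apply hxy
      refine ⟨hx, mem_cthickening_of_dist_le y x r K hx ?_⟩
      rw [dist_comm, dist_eq_norm]; exact hcon
    · exact h0 x y hx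
  rw [Measure.prod_restrict]
  exact h.integrableOn

lemma vv_diverg {B Ω : Set (Euc N)} (hB : MeasurableSet B) {r : ℝ} (hr : 0 < r)
    {φ : Euc N → Euc N} (h : CC Ω φ) :
    ∫ x, vv B r x * diverg φ x = DD B (moll r φ) := by
  have hc1 := (rho_contDiff (N := N) r).continuous
  have hc2 := continuous_diverg h.1
  calc _ = ∫ x, ∫ y in B, rho r (x - y) * diverg φ x := by
        congr 1; ext x
        rw [vv_swap hB, integral_mul_const]
    _ = ∫ y in B, ∫ x, rho r (x - y) * diverg φ x := by
        apply integral_integral_swap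
        have := prod_integrable (F := fun p : Euc N × Euc N => rho r (p.1 - p.2) * diverg φ p.1)
          (by fun_prop) (diverg_compact h.2.1) (r := r) (fun x y hx => by
            simp [image_eq_zero_of_notMem_tsupport hx])
          (fun x y hxy => by simp [rho_eq_zero hr hxy.le]) univ B
        rw [Measure.restrict_univ] at this
        exact this
    _ = _ := by
        unfold DD
        congr 1; ext y
        rw [moll_diverg hr h, moll_swap]
        congr 1; ext x
        rw [← rho_neg, neg_sub, smul_eq_mul]

lemma vv_dens {B : Set (Euc N)} (hB : MeasurableSet B) {r : ℝ} (hr : 0 < r) (x : Euc N) :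
    ENNReal.ofReal (vv B r x) * volume (ball x r) ≤
      ENNReal.ofReal (Crho N * om N) * volume (B ∩ ball x r) := by
  have hC := Crho_pos (N := N)
  have hom := om_pos (N := N)
  have hfin : volume (B ∩ ball x r) ≠ ⊤ :=
    ((measure_mono inter_subset_right).trans_lt measure_ball_lt_top).ne
  have h1 : vv B r x ≤ Crho N / r ^ N * (volume (B ∩ ball x r)).toReal := by
    rw [vv_swap hB]
    calc _ ≤ ∫ y in B, (ball x r).indicator (fun _ => Crho N / r ^ N) y := by
          apply integral_mono
          · have := (rho_integrable (N := N) hr).comp_sub_left x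
            exact this.integrableOn
          · apply Integrable.integrableOn
            exact (integrable_indicator_iff measurableSet_ball).2
              (integrableOn_const measure_ball_lt_top.ne)
          · intro y
            beta_reduce
            by_cases hy : y ∈ ball x r
            · rw [indicator_of_mem hy]
              exact rho_le hr _
            · rw [indicator_of_notMem hy]
              apply le_of_eq
              apply rho_eq_zero hr
              rw [mem_ball, dist_comm, dist_eq_norm] at hy
              exact not_lt.1 hy
      _ = _ := by
          rw [integral_indicator measurableSet_ball, Measure.restrict_restrict measurableSet_ball,
            setIntegral_const, smul_eq_mul, mul_comm, inter_comm]
          rfl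
  rw [vol_ball' x hr, ← ENNReal.ofReal_toReal hfin, ← ENNReal.ofReal_mul (vv_nonneg B hr x),
    ← ENNReal.ofReal_mul (by positivity)]
  apply ENNReal.ofReal_le_ofReal
  calc _ ≤ Crho N / r ^ N * (volume (B ∩ ball x r)).toReal * (r ^ N * om N) := by gcongr
    _ = _ := by field_simp

lemma te_lemma {B U Ω : Set (Euc N)} (hB : MeasurableSet B) (hp : perimeter B Ω < ⊤)
    (hU : IsOpen U) {r : ℝ} (hs : ∀ x ∈ U, ∀ z, ‖z‖ ≤ r → x - z ∈ Ω)
    {h : Euc N → ℝ≥0∞} (hh : Measurable h) (h0 : ∀ z, r < ‖z‖ → h z = 0) :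
    ∫⁻ x in B ∩ U, ∫⁻ z, h z * Bᶜ.indicator 1 (x - z) ≤
      ENNReal.ofReal (r * PP B Ω) * ∫⁻ z, h z := by
  have hPP := PP_nonneg B Ω
  rw [lintegral_lintegral_swap]
  · rw [← lintegral_const_mul _ hh]
    apply lintegral_mono
    intro z
    beta_reduce
    have hm' : Measurable fun x => Bᶜ.indicator (1 : Euc N → ℝ≥0∞) (x - z) :=
      (measurable_one.indicator hB.compl).comp (measurable_sub_const z)
    rw [lintegral_const_mul _ hm', mul_comm]
    by_cases hz : r < ‖z‖
    · simp [h0 z hz]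
    push Not at hz
    refine mul_le_mul_left ?_ _
    have hT := translation_est hB hp hU (z := z) (by
      intro x hx s hs'
      apply hs x hx
      rw [norm_smul, Real.norm_of_nonneg hs'.1]
      exact (mul_le_of_le_one_left (norm_nonneg _) hs'.2).trans hz)
    calc _ = volume {x | x ∈ U ∧ x ∈ B ∧ x - z ∉ B} := by
          have hm : MeasurableSet ((fun x => x - z) ⁻¹' Bᶜ) :=
            (measurable_sub_const z) hB.compl
          have e : (fun x => Bᶜ.indicator (1 : Euc N → ℝ≥0∞) (x - z)) =
              ((fun x => x - z) ⁻¹' Bᶜ).indicator 1 := by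
            ext x; rfl
          rw [e, lintegral_indicator_one hm, Measure.restrict_apply hm]
          congr 1
          ext x
          simp only [mem_inter_iff, mem_preimage, mem_compl_iff, mem_ofPred_eq]
          tauto
      _ ≤ _ := hT
      _ ≤ _ := by
        apply ENNReal.ofReal_le_ofReal
        gcongr
  · apply Measurable.aemeasurable
    apply Measurable.mul
    · exact hh.comp measurable_snd
    · exact (measurable_one.indicator hB.compl).comp (measurable_fst.sub measurable_snd)

lemma vv_good {B U Ω : Set (Euc N)} (hB : MeasurableSet B) (hp : perimeter B Ω < ⊤)
    (hU : IsOpen U) {r : ℝ} (hr : 0 < r) (hs : ∀ x ∈ U, ∀ z, ‖z‖ ≤ r → x - z ∈ Ω) :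
    ∫⁻ x in B ∩ U, ENNReal.ofReal (1 - vv B r x) ≤ ENNReal.ofReal (r * PP B Ω) := by
  have hc := (rho_contDiff (N := N) r).continuous
  have h := te_lemma hB hp hU hs (h := fun z => ENNReal.ofReal (rho r z))
    (by fun_prop) (fun z hz => by simp [rho_eq_zero hr hz.le])
  rw [← ofReal_integral_eq_lintegral_ofReal (rho_integrable hr)
    (Eventually.of_forall (rho_nonneg hr)), rho_integral hr, ENNReal.ofReal_one, mul_one] at h
  refine le_trans (le_of_eq ?_) h
  congr 1; ext x
  have hi := moll_integrand hr (ind_locInt hB) x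
  have e : 1 - vv B r x = ∫ z, rho r z * Bᶜ.indicator (fun _ => (1:ℝ)) (x - z) := by
    have h1 : 1 - vv B r x = (∫ z : Euc N, rho r z) - vv B r x := by rw [rho_integral hr]
    rw [h1]
    unfold vv moll
    rw [← integral_sub (rho_integrable hr) hi]
    congr 1; ext z
    by_cases hz : x - z ∈ B <;> simp [hz]
  have hi2 : Integrable fun z => rho r z * Bᶜ.indicator (fun _ => (1:ℝ)) (x - z) := by
    exact moll_integrand hr (ind_locInt hB.compl) x
  rw [e, ofReal_integral_eq_lintegral_ofReal hi2 (Eventually.of_forall fun z =>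
    mul_nonneg (rho_nonneg hr z) (indicator_nonneg (fun _ _ => zero_le_one) _))]
  congr 1; ext z
  by_cases hz : x - z ∈ B <;> simp [hz]

lemma exists_nbhd {K Ω : Set (Euc N)} (hK : IsCompact K) (hΩ : IsOpen Ω) (h : K ⊆ Ω) :
    ∃ δ > 0, ∃ U : Set (Euc N), IsOpen U ∧ cthickening δ K ⊆ U ∧ U ⊆ Ω ∧
      ∀ x ∈ U, ∀ z, ‖z‖ ≤ δ → x - z ∈ Ω := by
  obtain ⟨ε, hε, hsub⟩ := hK.exists_thickening_subset_open hΩ h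
  refine ⟨ε / 4, by positivity, thickening (ε / 2) K, isOpen_thickening,
    cthickening_subset_thickening' (by positivity) (by linarith) K,
    (thickening_mono (by linarith) K).trans hsub, ?_⟩
  intro x hx z hz
  apply hsub
  rw [mem_thickening_iff] at hx ⊢
  obtain ⟨y, hy, hxy⟩ := hx
  refine ⟨y, hy, ?_⟩
  calc dist (x - z) y ≤ dist (x - z) x + dist x y := dist_triangle _ _ _
    _ = ‖z‖ + dist x y := by rw [dist_eq_norm]; simp
    _ < ε := by linarith

/-- Using the goodness bound. -/
lemma good_use {B U : Set (Euc N)} (hB : MeasurableSet B) (hU : IsOpen U) {v : Euc N → ℝ} {ε : ℝ}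
    (hε : 0 ≤ ε)
    (hv : Continuous v)
    (hg : ∫⁻ x in B ∩ U, ENNReal.ofReal (1 - v x) ≤ ENNReal.ofReal ε)
    {E : Type*} [NormedAddCommGroup E] [NormedSpace ℝ E]
    {q : Euc N → E} {M : ℝ} (hM : 0 ≤ M) (hq : ∀ x ∈ U, ‖q x‖ ≤ M * (1 - v x))
    (hqU : ∀ x, x ∉ U → q x = 0) (hqm : Continuous q) :
    (∫ x in B, ‖q x‖ ≤ M * ε) ∧ ‖∫ x in B, q x‖ ≤ M * ε := by
  have h1 : ∫ x in B, ‖q x‖ ≤ M * ε := by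
    rw [integral_norm_eq_lintegral_enorm hqm.aestronglyMeasurable]
    apply ENNReal.toReal_le_of_le_ofReal (by positivity)
    have e : ∫⁻ x in B, ‖q x‖ₑ = ∫⁻ x in B ∩ U, ‖q x‖ₑ := by
      rw [← lintegral_indicator hB, ← lintegral_indicator (hB.inter hU.measurableSet)]
      congr 1; ext x
      by_cases hx : x ∈ U
      · by_cases hb : x ∈ B <;> simp [indicator, hx, hb, mem_inter_iff]
      · simp [indicator, hx, hqU x hx]
    rw [e, ENNReal.ofReal_mul hM]
    calc _ ≤ ∫⁻ x in B ∩ U, ENNReal.ofReal M * ENNReal.ofReal (1 - v x) := by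
          apply setLIntegral_mono' (hB.inter hU.measurableSet)
          intro x hx
          rw [← ENNReal.ofReal_mul hM, ← ofReal_norm]
          exact ENNReal.ofReal_le_ofReal (hq x hx.2)
      _ = ENNReal.ofReal M * ∫⁻ x in B ∩ U, ENNReal.ofReal (1 - v x) :=
        lintegral_const_mul _ (by fun_prop)
      _ ≤ _ := by gcongr
  exact ⟨h1, (norm_integral_le_integral_norm _).trans h1⟩


lemma lip_of {E : Type*} [NormedAddCommGroup E] [NormedSpace ℝ E] {f : Euc N → E}
    (h : ContDiff ℝ 1 f) (hc : HasCompactSupport f) :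
    ∃ L : ℝ, 0 ≤ L ∧ ∀ x y, ‖f x - f y‖ ≤ L * ‖x - y‖ := by
  obtain ⟨C, hC⟩ := h.lipschitzWith_of_hasCompactSupport hc one_ne_zero
  refine ⟨C, C.2, fun x y => ?_⟩
  have := hC.dist_le_mul x y
  rwa [dist_eq_norm, dist_eq_norm] at this

lemma bdd_of {E : Type*} [NormedAddCommGroup E] {f : Euc N → E}
    (h : Continuous f) (hc : HasCompactSupport f) :
    ∃ M : ℝ, 0 ≤ M ∧ ∀ x, ‖f x‖ ≤ M := by
  obtain ⟨C, hC⟩ := hc.exists_bound_of_continuous h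
  exact ⟨C, (norm_nonneg _).trans (hC 0), hC⟩

lemma moll_close {B Ω : Set (Euc N)} (hp : perimeter B Ω < ⊤) {Φ : Euc N → Euc N} (h : CC Ω Φ)
    {L : ℝ} (hL0 : 0 ≤ L) (hL : ∀ x y, ‖Φ x - Φ y‖ ≤ L * ‖x - y‖) {r : ℝ} (hr : 0 < r)
    (hs : cthickening r (tsupport Φ) ⊆ Ω) :
    |DD B (moll r Φ) - DD B Φ| ≤ L * r * PP B Ω := by
  have h1 := moll_CC hr h hs
  have h2 := h.const_smul (-1)
  have h3 := h1.add h2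
  have e := DD_add (B := B) h1 h2
  rw [DD_const_smul h] at e
  have hb : ∀ x, ‖moll r Φ x + (-1 : ℝ) • Φ x‖ ≤ L * r := by
    intro x
    rw [neg_one_smul, ← sub_eq_add_neg]
    exact moll_dist hr h.1.continuous hL hL0 x
  have a1 := DD_le hp h3 (by positivity) hb
  have a2 := DD_le hp (h3.const_smul (-1)) (c := L * r) (by positivity) (by
    intro x; rw [neg_one_smul, norm_neg]; exact hb x)
  rw [DD_const_smul h3] at a2
  rw [abs_le]; constructor <;> linarith

lemma kern_zero {r : ℝ} (hr : 0 < r) (x e : Euc N) :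
    ∫ y, fderiv ℝ (rho r) (x - y) e = 0 := by
  have h1 := vv_fderiv (B := (univ : Set (Euc N))) MeasurableSet.univ hr x e
  rw [Measure.restrict_univ] at h1
  rw [← h1]
  have : vv (univ : Set (Euc N)) r = fun _ => 1 := by
    ext x
    rw [vv_swap MeasurableSet.univ, Measure.restrict_univ,
      integral_sub_left_eq_self (rho r) volume x, rho_integral hr]
  rw [this]; simp

lemma kern_int {r : ℝ} (hr : 0 < r) (x : Euc N) {f : Euc N → Euc N} (hf : Continuous f) :
    Integrable (fun y => fderiv ℝ (rho r) (x - y) (f y)) := by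
  have hk := (rho_contDiff (N := N) r).continuous_fderiv one_ne_zero
  apply Continuous.integrable_of_hasCompactSupport (by fun_prop)
  apply HasCompactSupport.intro (isCompact_closedBall x r)
  intro y hy
  rw [mem_closedBall, dist_comm, dist_eq_norm, not_le] at hy
  rw [rho_fderiv_eq_zero hr hy]; simp

lemma kern_J {Ω : Set (Euc N)} {Φ : Euc N → Euc N} (h : CC Ω Φ) {r : ℝ} (hr : 0 < r)
    (x : Euc N) :
    ∫ y, fderiv ℝ (rho r) (x - y) (Φ x - Φ y) = - diverg (moll r Φ) x := by
  have hc := h.1.continuous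
  have hψ : ContDiff ℝ 1 (fun y => rho r (x - y)) :=
    (rho_contDiff (N := N) r).comp (contDiff_const.sub contDiff_id)
  have h1 := ibp h hψ
  have e : ∀ y, fderiv ℝ (fun y => rho r (x - y)) y (Φ y) = - fderiv ℝ (rho r) (x - y) (Φ y) := by
    intro y
    have hd : HasFDerivAt (fun y => rho r (x - y)) ((fderiv ℝ (rho r) (x - y)).comp
        (-ContinuousLinearMap.id ℝ (Euc N))) y :=
      (((rho_contDiff (N := N) r).differentiable one_ne_zero) (x - y)).hasFDerivAt.comp y
        ((hasFDerivAt_id y).const_sub x)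
    rw [hd.fderiv]; simp
  simp_rw [e, integral_neg, neg_neg] at h1
  rw [moll_diverg hr h, moll_swap]
  simp_rw [map_sub, smul_eq_mul]
  rw [integral_sub (kern_int hr x continuous_const) (kern_int hr x hc), kern_zero hr, h1]
  simp

lemma kern_L1 {r : ℝ} (hr : 0 < r) :
    ∫⁻ z : Euc N, ‖fderiv ℝ (rho r) z‖ₑ ≤ ENNReal.ofReal (Crho N * om N / r) := by
  have hC := Crho_pos (N := N)
  have hom := om_pos (N := N)
  calc _ ≤ ∫⁻ z : Euc N, (closedBall 0 r).indicator (fun _ => ENNReal.ofReal (Crho N / r ^ N / r)) z := by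
        apply lintegral_mono
        intro z
        beta_reduce
        by_cases hz : z ∈ closedBall (0 : Euc N) r
        · rw [indicator_of_mem hz, ← ofReal_norm]
          exact ENNReal.ofReal_le_ofReal (rho_fderiv_le hr z)
        · rw [mem_closedBall_zero_iff, not_le] at hz
          rw [← ofReal_norm, rho_fderiv_eq_zero hr hz, norm_zero, ENNReal.ofReal_zero]; exact zero_le
    _ = ENNReal.ofReal (Crho N / r ^ N / r) * ENNReal.ofReal (r ^ N * om N) := by
        have hcb : volume (closedBall (0 : Euc N) r) = volume (ball (0 : Euc N) r) := by
          rw [vol_ball _ hr, Measure.addHaar_closedBall _ _ hr.le, finrank_euclideanSpace_fin]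
        rw [lintegral_indicator_const measurableSet_closedBall, hcb, vol_ball' 0 hr]
    _ ≤ _ := by
        rw [← ENNReal.ofReal_mul (by positivity)]
        apply ENNReal.ofReal_le_ofReal
        apply le_of_eq
        field_simp

lemma kern_anti {B Ω : Set (Euc N)} {Φ : Euc N → Euc N} (h : CC Ω Φ) {r : ℝ} (hr : 0 < r) :
    2 * ∫ x in B, ∫ y in B, fderiv ℝ (rho r) (x - y) (Φ x) =
      ∫ x in B, ∫ y in B, fderiv ℝ (rho r) (x - y) (Φ x - Φ y) := by
  have hc := h.1.continuous
  have hk := (rho_contDiff (N := N) r).continuous_fderiv one_ne_zero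
  have hI := prod_integrable (F := fun p : Euc N × Euc N => fderiv ℝ (rho r) (p.1 - p.2) (Φ p.1))
    (by fun_prop) h.2.1 (r := r) (fun x y hx => by simp [image_eq_zero_of_notMem_tsupport hx])
    (fun x y hxy => by simp [rho_fderiv_eq_zero hr hxy]) B B
  have hI2 : Integrable (fun p : Euc N × Euc N => fderiv ℝ (rho r) (p.1 - p.2) (Φ p.2))
      ((volume.restrict B).prod (volume.restrict B)) := by
    refine hI.swap.neg.congr (Eventually.of_forall ?_)
    rintro ⟨x, y⟩
    simp only [Pi.neg_apply, Function.comp_apply, Prod.swap_prod_mk]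
    rw [← neg_sub, rho_fderiv_neg]; simp
  have e2 : ∫ x in B, ∫ y in B, fderiv ℝ (rho r) (x - y) (Φ y) =
      - ∫ x in B, ∫ y in B, fderiv ℝ (rho r) (x - y) (Φ x) := by
    rw [integral_integral_swap hI2, ← integral_neg]
    congr 1; ext x
    rw [← integral_neg]
    congr 1; ext y
    rw [← neg_sub, rho_fderiv_neg]; simp
  have e3 : ∫ x in B, ∫ y in B, fderiv ℝ (rho r) (x - y) (Φ x - Φ y) =
      (∫ x in B, ∫ y in B, fderiv ℝ (rho r) (x - y) (Φ x)) -
      ∫ x in B, ∫ y in B, fderiv ℝ (rho r) (x - y) (Φ y) := by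
    rw [← integral_integral_sub hI hI2]
    simp only [map_sub]
  rw [e3, e2]; ring

lemma kern_err {B U Ω : Set (Euc N)} (hB : MeasurableSet B) (hp : perimeter B Ω < ⊤)
    (hU : IsOpen U) {Φ : Euc N → Euc N} (h : CC Ω Φ)
    {L : ℝ} (hL0 : 0 ≤ L) (hL : ∀ x y, ‖Φ x - Φ y‖ ≤ L * ‖x - y‖) {r : ℝ} (hr : 0 < r)
    (hs : cthickening r (tsupport Φ) ⊆ U) (hs' : ∀ x ∈ U, ∀ z, ‖z‖ ≤ r → x - z ∈ Ω) :
    |∫ x in B, ∫ y in Bᶜ, fderiv ℝ (rho r) (x - y) (Φ x - Φ y)| ≤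
      L * (Crho N * om N) * r * PP B Ω := by
  have hC := Crho_pos (N := N)
  have hom := om_pos (N := N)
  have hPP := PP_nonneg B Ω
  have hc := h.1.continuous
  have hk := (rho_contDiff (N := N) r).continuous_fderiv one_ne_zero
  have hte := te_lemma hB hp hU hs' (h := fun z => ENNReal.ofReal (L * r) * ‖fderiv ℝ (rho r) z‖ₑ)
    (by fun_prop) (fun z hz => by rw [← ofReal_norm, rho_fderiv_eq_zero hr hz, norm_zero, ENNReal.ofReal_zero, mul_zero])
  have key : ∫⁻ x in B, ‖∫ y in Bᶜ, fderiv ℝ (rho r) (x - y) (Φ x - Φ y)‖ₑ ≤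
      ENNReal.ofReal (L * (Crho N * om N) * r * PP B Ω) := by
    calc _ = ∫⁻ x in B ∩ U, ‖∫ y in Bᶜ, fderiv ℝ (rho r) (x - y) (Φ x - Φ y)‖ₑ := by
          rw [← lintegral_indicator hB, ← lintegral_indicator (hB.inter hU.measurableSet)]
          congr 1; ext x
          by_cases hx : x ∈ U
          · by_cases hb : x ∈ B <;> simp [indicator, hx, hb, mem_inter_iff]
          · have : ∀ y, fderiv ℝ (rho r) (x - y) (Φ x - Φ y) = 0 := by
              intro y
              by_cases hxy : r < ‖x - y‖
              · rw [rho_fderiv_eq_zero hr hxy]; simp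
              · have hy : y ∉ tsupport Φ := fun hy => hx (hs (mem_cthickening_of_dist_le x y r _ hy
                  (by rw [dist_eq_norm]; exact not_lt.1 hxy)))
                have hx' : x ∉ tsupport Φ := fun hx' => hx (hs (self_subset_cthickening _ hx'))
                rw [image_eq_zero_of_notMem_tsupport hy, image_eq_zero_of_notMem_tsupport hx']
                simp
            simp [indicator, hx, this]
      _ ≤ ∫⁻ x in B ∩ U, ∫⁻ z, ENNReal.ofReal (L * r) * ‖fderiv ℝ (rho r) z‖ₑ *
            Bᶜ.indicator 1 (x - z) := by
          apply lintegral_mono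
          intro x
          beta_reduce
          refine (enorm_integral_le_lintegral_enorm _).trans ?_
          rw [← lintegral_indicator hB.compl, ← lintegral_sub_left_eq_self _ x]
          apply lintegral_mono
          intro z
          beta_reduce
          by_cases hz : x - z ∈ Bᶜ
          · rw [indicator_of_mem hz, indicator_of_mem hz, Pi.one_apply, mul_one, sub_sub_cancel]
            rw [← ofReal_norm, ← ofReal_norm, ← ENNReal.ofReal_mul (by positivity)]
            apply ENNReal.ofReal_le_ofReal
            by_cases hzr : r < ‖z‖
            · simp [rho_fderiv_eq_zero hr hzr]
            · push Not at hzr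
              calc _ ≤ ‖fderiv ℝ (rho r) z‖ * ‖Φ x - Φ (x - z)‖ := ContinuousLinearMap.le_opNorm _ _
                _ ≤ ‖fderiv ℝ (rho r) z‖ * (L * r) := by
                  gcongr
                  refine (hL _ _).trans ?_
                  rw [sub_sub_cancel]; gcongr
                _ = _ := mul_comm _ _
          · rw [indicator_of_notMem hz]; exact zero_le
      _ ≤ _ := hte
      _ ≤ ENNReal.ofReal (r * PP B Ω) * (ENNReal.ofReal (L * r) *
            ENNReal.ofReal (Crho N * om N / r)) := by
          refine mul_le_mul_right ?_ _
          rw [lintegral_const_mul _ (by fun_prop)]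
          exact mul_le_mul_right (kern_L1 hr) _
      _ = _ := by
          rw [← ENNReal.ofReal_mul (by positivity), ← ENNReal.ofReal_mul (by positivity)]
          congr 1
          field_simp
  rw [← Real.norm_eq_abs]
  have := (enorm_integral_le_lintegral_enorm (μ := volume.restrict B)
    (fun x => ∫ y in Bᶜ, fderiv ℝ (rho r) (x - y) (Φ x - Φ y))).trans key
  rw [← ofReal_norm] at this
  exact (ENNReal.ofReal_le_ofReal_iff (by positivity)).1 this

lemma star {B Ω : Set (Euc N)} (hB : MeasurableSet B) (hp : perimeter B Ω < ⊤) (hΩ : IsOpen Ω)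
    {Φ : Euc N → Euc N} (h : CC Ω Φ) :
    ∃ K : ℝ, ∃ r0 > 0, ∀ r, 0 < r → r < r0 →
      |DD B (fun x => vv B r x • Φ x) - DD B Φ / 2| ≤ K * r := by
  obtain ⟨L, hL0, hL⟩ := lip_of h.1 h.2.1
  obtain ⟨M, hM0, hM⟩ := bdd_of (continuous_diverg h.1) (diverg_compact h.2.1)
  obtain ⟨δ, hδ, U, hU, hKU, hUΩ, hUs⟩ := exists_nbhd h.2.1 hΩ h.2.2
  have hPP := PP_nonneg B Ω
  refine ⟨(L + L * (Crho N * om N) + M) * PP B Ω, δ, hδ, ?_⟩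
  intro r hr hrδ
  have hs : cthickening r (tsupport Φ) ⊆ U := (cthickening_mono hrδ.le _).trans hKU
  have hs' : ∀ x ∈ U, ∀ z, ‖z‖ ≤ r → x - z ∈ Ω := fun x hx z hz => hUs x hx z (hz.trans hrδ.le)
  have hC := Crho_pos (N := N)
  have hom := om_pos (N := N)
  have hc := h.1.continuous
  have hk := (rho_contDiff (N := N) r).continuous_fderiv one_ne_zero
  have hvc := (vv_contDiff hB hr).continuous
  have hdc := continuous_diverg h.1
  have a1 := moll_close (B := B) hp h hL0 hL hr (hs.trans hUΩ)
  have a2 := kern_err hB hp hU h hL0 hL hr hs hs'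
  have a3 := (good_use hB hU (v := vv B r) (ε := r * PP B Ω) (by positivity) hvc
    (vv_good hB hp hU hr hs') (q := fun x => (1 - vv B r x) * diverg Φ x) hM0 (by
      intro x hx
      rw [norm_mul, mul_comm, Real.norm_of_nonneg (sub_nonneg.2 (vv_le_one hB hr x))]
      exact mul_le_mul_of_nonneg_right (hM x) (sub_nonneg.2 (vv_le_one hB hr x))) (by
      intro x hx
      have : x ∉ tsupport (diverg Φ) := fun hx' => hx (hs (self_subset_cthickening _
        (tsupport_diverg _ hx')))
      rw [image_eq_zero_of_notMem_tsupport this, mul_zero]) (by fun_prop)).2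
  rw [Real.norm_eq_abs] at a3
  have b1 := DD_smul_eq (B := B) h (vv_contDiff hB hr)
  have b2 : ∫ x in B, (1 - vv B r x) * diverg Φ x = DD B Φ - ∫ x in B, vv B r x * diverg Φ x := by
    unfold DD
    rw [← integral_sub]
    · congr 1; ext x; ring
    · exact h.integrable.integrableOn
    · apply Integrable.integrableOn
      exact (hvc.mul hdc).integrable_of_hasCompactSupport ((diverg_compact h.2.1).mul_left)
  have b3 : ∫ x in B, fderiv ℝ (vv B r) x (Φ x) =
      ∫ x in B, ∫ y in B, fderiv ℝ (rho r) (x - y) (Φ x) := by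
    congr 1; ext x; rw [vv_fderiv hB hr]
  have b4 := kern_anti (B := B) h hr
  have hki : ∀ x, Integrable (fun y => fderiv ℝ (rho r) (x - y) (Φ x - Φ y)) := fun x =>
    kern_int hr x (f := fun y => Φ x - Φ y) (by fun_prop)
  have hIall : ∀ A : Set (Euc N), Integrable (fun p : Euc N × Euc N =>
      fderiv ℝ (rho r) (p.1 - p.2) (Φ p.1 - Φ p.2))
      ((volume.restrict B).prod (volume.restrict A)) := fun A =>
    prod_integrable (by fun_prop) (h.2.1.cthickening (r := r)) (r := r) (fun x y hx => by
      show fderiv ℝ (rho r) (x - y) (Φ x - Φ y) = 0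
      by_cases hxy : r < ‖x - y‖
      · rw [rho_fderiv_eq_zero hr hxy]; simp
      · have hy : y ∉ tsupport Φ := fun hy => hx (mem_cthickening_of_dist_le x y r _ hy
          (by rw [dist_eq_norm]; exact not_lt.1 hxy))
        have hx' : x ∉ tsupport Φ := fun hx' => hx (self_subset_cthickening _ hx')
        rw [image_eq_zero_of_notMem_tsupport hy, image_eq_zero_of_notMem_tsupport hx']
        simp) (fun x y hxy => by simp [rho_fderiv_eq_zero hr hxy]) B A
  have b5 : (∫ x in B, ∫ y in B, fderiv ℝ (rho r) (x - y) (Φ x - Φ y)) +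
      ∫ x in B, ∫ y in Bᶜ, fderiv ℝ (rho r) (x - y) (Φ x - Φ y) = - DD B (moll r Φ) := by
    unfold DD
    rw [← integral_add (hIall B).integral_prod_left (hIall Bᶜ).integral_prod_left, ← integral_neg]
    congr 1; ext x
    rw [integral_add_compl hB (hki x), kern_J h hr]
  rw [abs_le] at a1 a2 a3 ⊢
  rw [b1, b3]
  have n1 : 0 ≤ L * r * PP B Ω := by positivity
  have n2 : 0 ≤ L * (Crho N * om N) * r * PP B Ω := by positivity
  have n3 : 0 ≤ M * (r * PP B Ω) := by positivity
  have e : (L + L * (Crho N * om N) + M) * PP B Ω * r =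
    L * r * PP B Ω + L * (Crho N * om N) * r * PP B Ω + M * (r * PP B Ω) := by ring
  rw [e]
  constructor <;> linarith [a1.1, a1.2, a2.1, a2.2, a3.1, a3.2]


lemma rho_contDiff2 (r : ℝ) : ContDiff ℝ 2 (rho r : Euc N → ℝ) := by
  unfold rho rho0
  have := (bump0 N).contDiff_normed (n := 2) (μ := volume)
  fun_prop

lemma vv_contDiff2 {B : Set (Euc N)} (hB : MeasurableSet B) {r : ℝ} (hr : 0 < r) :
    ContDiff ℝ 2 (vv B r) := by
  unfold vv
  rw [moll_eq]
  exact (rho_compact hr).contDiff_convolution_left _ (rho_contDiff2 r) (ind_locInt hB)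

/-- Average of finitely many mollifications. -/
def av (B : Set (Euc N)) (M : ℕ) (r : ℕ → ℝ) (x : Euc N) : ℝ :=
  (M : ℝ)⁻¹ * ∑ i ∈ Finset.range M, vv B (r i) x

section av
variable {B Ω : Set (Euc N)} {M : ℕ} {r : ℕ → ℝ} 

lemma avg_bound {M : ℕ} (hM : 0 < M) {a : ℕ → ℝ} {c : ℝ} (h : ∀ i, a i ≤ c) :
    (M : ℝ)⁻¹ * ∑ i ∈ Finset.range M, a i ≤ c := by
  have hM' : (0 : ℝ) < M := by exact_mod_cast hM
  have h1 : ∑ i ∈ Finset.range M, a i ≤ M * c := by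
    calc _ ≤ ∑ i ∈ Finset.range M, c := Finset.sum_le_sum fun i _ => h i
      _ = _ := by simp
  rw [inv_mul_le_iff₀ hM']; exact h1

lemma avg_bound' {M : ℕ} (hM : 0 < M) {a : ℕ → ℝ} {c : ℝ} (h : ∀ i, c ≤ a i) :
    c ≤ (M : ℝ)⁻¹ * ∑ i ∈ Finset.range M, a i := by
  have hM' : (0 : ℝ) < M := by exact_mod_cast hM
  have h1 : M * c ≤ ∑ i ∈ Finset.range M, a i := by
    calc (M:ℝ) * c = ∑ i ∈ Finset.range M, c := by simp
      _ ≤ _ := Finset.sum_le_sum fun i _ => h i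
  rw [le_inv_mul_iff₀ hM']; exact h1

lemma av_contDiff2 (hB : MeasurableSet B) (hr : ∀ i, 0 < r i) : ContDiff ℝ 2 (av B M r) := by
  unfold av
  exact contDiff_const.mul (ContDiff.sum fun i _ => vv_contDiff2 hB (hr i))

lemma av_nonneg (hM : 0 < M) (hr : ∀ i, 0 < r i) (x : Euc N) : 0 ≤ av B M r x :=
  avg_bound' hM fun i => vv_nonneg B (hr i) x

lemma av_le_one (hB : MeasurableSet B) (hM : 0 < M) (hr : ∀ i, 0 < r i) (x : Euc N) :
    av B M r x ≤ 1 :=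
  avg_bound hM fun i => vv_le_one hB (hr i) x

lemma av_exists {c : ℝ} (hM : 0 < M) {x : Euc N} (h : c ≤ av B M r x) : ∃ i, c ≤ vv B (r i) x := by
  by_contra hcon
  push Not at hcon
  have hM' : (0 : ℝ) < M := by exact_mod_cast hM
  have h1 : ∑ i ∈ Finset.range M, vv B (r i) x < M * c := by
    calc _ < ∑ i ∈ Finset.range M, c := Finset.sum_lt_sum_of_nonempty (by simpa using hM.ne') 
            fun i _ => hcon i
      _ = _ := by simp
  unfold av at h
  rw [le_inv_mul_iff₀ hM'] at h
  linarith

lemma av_good (hB : MeasurableSet B) (hp : perimeter B Ω < ⊤) (hM : 0 < M) (hr : ∀ i, 0 < r i)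
    {U : Set (Euc N)} (hU : IsOpen U) {R : ℝ} (hR : ∀ i, r i ≤ R)
    (hs : ∀ x ∈ U, ∀ z, ‖z‖ ≤ R → x - z ∈ Ω) :
    ∫⁻ x in B ∩ U, ENNReal.ofReal (1 - av B M r x) ≤ ENNReal.ofReal (R * PP B Ω) := by
  have hM' : (0 : ℝ) < M := by exact_mod_cast hM
  have hPP := PP_nonneg B Ω
  have e : ∀ x, ENNReal.ofReal (1 - av B M r x) = ENNReal.ofReal (M : ℝ)⁻¹ *
      ∑ i ∈ Finset.range M, ENNReal.ofReal (1 - vv B (r i) x) := by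
    intro x
    rw [← ENNReal.ofReal_sum_of_nonneg (fun i _ => sub_nonneg.2 (vv_le_one hB (hr i) x)),
      ← ENNReal.ofReal_mul (by positivity)]
    congr 1
    rw [Finset.sum_sub_distrib, mul_sub]
    unfold av
    congr 1
    simp [hM'.ne']
  have hc : ∀ i, Measurable fun x => ENNReal.ofReal (1 - vv B (r i) x) := fun i => by
    have := (vv_contDiff hB (hr i)).continuous
    fun_prop
  simp_rw [e]
  rw [lintegral_const_mul _ (Finset.measurable_fun_sum _ fun i _ => hc i),
    lintegral_finsetSum _ fun i _ => hc i]
  calc _ ≤ ENNReal.ofReal (M : ℝ)⁻¹ * ∑ i ∈ Finset.range M, ENNReal.ofReal (R * PP B Ω) := by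
        refine mul_le_mul_right (Finset.sum_le_sum fun i _ => ?_) _
        refine (vv_good hB hp hU (hr i) fun x hx z hz => hs x hx z (hz.trans (hR i))).trans ?_
        apply ENNReal.ofReal_le_ofReal
        exact mul_le_mul_of_nonneg_right (hR i) hPP
    _ = _ := by
        rw [Finset.sum_const, Finset.card_range, nsmul_eq_mul, ← mul_assoc,
          ENNReal.ofReal_inv_of_pos hM', ENNReal.ofReal_natCast, ENNReal.inv_mul_cancel
          (by exact_mod_cast hM.ne') (ENNReal.natCast_ne_top M), one_mul]

lemma av_diverg (hB : MeasurableSet B) (hr : ∀ i, 0 < r i) {φ : Euc N → Euc N} (h : CC Ω φ) :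
    ∫ x, av B M r x * diverg φ x = (M : ℝ)⁻¹ * ∑ i ∈ Finset.range M, DD B (moll (r i) φ) := by
  unfold av
  simp_rw [mul_assoc, Finset.sum_mul]
  rw [integral_const_mul, integral_finsetSum]
  · congr 1
    exact Finset.sum_congr rfl fun i _ => vv_diverg hB (hr i) h
  · intro i _
    exact ((vv_contDiff hB (hr i)).continuous.mul
      (continuous_diverg h.1)).integrable_of_hasCompactSupport ((diverg_compact h.2.1).mul_left)

end av

lemma star_half {B Ω : Set (Euc N)} (hB : MeasurableSet B) (hp : perimeter B Ω < ⊤) (hΩ : IsOpen Ω)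
    {Φ : Euc N → Euc N} (h : CC Ω Φ) {δ : ℝ} (hδ : 0 < δ) :
    ∀ᶠ r in 𝓝[>] (0:ℝ), |DD B (fun x => (vv B r x - 1/2) • Φ x)| ≤ δ := by
  obtain ⟨K, r0, hr0, hK⟩ := star hB hp hΩ h
  have h1 : ∀ᶠ r in 𝓝[>] (0:ℝ), r ∈ Ioo 0 (min r0 (δ / (|K| + 1))) :=
    Ioo_mem_nhdsGT (by positivity)
  filter_upwards [h1] with r hr
  have hr1 := lt_min_iff.1 hr.2
  have h2 := hK r hr.1 hr1.1
  have h3 := DD_add (B := B) (h.smul (vv_contDiff hB hr.1)) (h.const_smul (-(1/2)))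
  rw [DD_const_smul h] at h3
  have e : (fun x => (vv B r x - 1/2) • Φ x) = fun x => vv B r x • Φ x + (-(1/2):ℝ) • Φ x := by
    ext1 x; rw [← add_smul, sub_eq_add_neg]
  rw [e, h3]
  have h4 : K * r ≤ δ := by
    have := (lt_div_iff₀ (by positivity : 0 < |K| + 1)).1 hr1.2
    have := le_abs_self K
    nlinarith [hr.1]
  calc _ = |DD B (fun x => vv B r x • Φ x) - DD B Φ / 2| := by congr 1; ring
    _ ≤ _ := h2.trans h4

lemma exists_av {B Ω : Set (Euc N)} (hB : MeasurableSet B) (hp : perimeter B Ω < ⊤)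
    (hΩ : IsOpen Ω) {Φ : Euc N → Euc N} (h : CC Ω Φ) (h1 : ∀ x, ‖Φ x‖ ≤ 1) {δ R : ℝ} (hδ : 0 < δ)
    (hR : 0 < R) :
    ∃ M : ℕ, 0 < M ∧ ∃ r : ℕ → ℝ, (∀ i, 0 < r i) ∧ (∀ i, r i < R) ∧
      DD B (fun x => (av B M r x - 1/2) ^ 2 • Φ x) ≤ δ := by
  obtain ⟨r, hr, hrr⟩ := exists_seq_of_forall_finset_exists (fun r : ℝ => 0 < r ∧ r < R)
    (fun a b => |DD B (fun x => (vv B b x - 1/2) • ((vv B a x - 1/2) • Φ x))| ≤ δ / 2) (by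
      intro s hs
      have e1 : ∀ᶠ b in 𝓝[>] (0:ℝ), ∀ a ∈ s,
          |DD B (fun x => (vv B b x - 1/2) • ((vv B a x - 1/2) • Φ x))| ≤ δ / 2 := by
        rw [Filter.eventually_all_finset]
        intro a ha
        exact star_half hB hp hΩ (h.smul ((vv_contDiff hB (hs a ha).1).sub contDiff_const))
          (half_pos hδ)
      have e2 : ∀ᶠ b in 𝓝[>] (0:ℝ), b ∈ Ioo 0 R := Ioo_mem_nhdsGT hR
      obtain ⟨b, hb1, hb2⟩ := (e1.and e2).exists
      exact ⟨b, hb2, hb1⟩)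
  have hPP := PP_nonneg B Ω
  obtain ⟨M, hM⟩ := exists_nat_gt (PP B Ω / (δ / 2))
  have hM' : (0 : ℝ) < M := lt_of_le_of_lt (by positivity) hM
  have hM0 : 0 < M := by exact_mod_cast hM'
  refine ⟨M, hM0, r, fun i => (hr i).1, fun i => (hr i).2, ?_⟩
  set X : ℕ → Euc N → ℝ := fun i x => vv B (r i) x - 1/2 with hX
  have hXc : ∀ i, ContDiff ℝ 1 (X i) := fun i => (vv_contDiff hB (hr i).1).sub contDiff_const
  have hX1 : ∀ i x, |X i x| ≤ 1/2 := by
    intro i x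
    have a := vv_nonneg B (hr i).1 x
    have b := vv_le_one hB (hr i).1 x
    rw [abs_le]; constructor <;> simp only [hX] <;> linarith
  have hCC : ∀ i j, CC Ω (fun x => X i x • (X j x • Φ x)) := fun i j =>
    (h.smul (hXc j)).smul (hXc i)
  have e : (fun x => (av B M r x - 1/2) ^ 2 • Φ x) = fun x => ((M:ℝ)⁻¹ ^ 2) •
      ∑ i ∈ Finset.range M, ∑ j ∈ Finset.range M, X i x • (X j x • Φ x) := by
    ext1 x
    have : av B M r x - 1/2 = (M:ℝ)⁻¹ * ∑ i ∈ Finset.range M, X i x := by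
      simp only [hX, Finset.sum_sub_distrib, mul_sub, av]
      congr 1
      simp [hM'.ne']
    rw [this, mul_pow, mul_smul]
    congr 1
    rw [sq, Finset.sum_mul_sum, Finset.sum_smul]
    refine Finset.sum_congr rfl fun i _ => ?_
    rw [Finset.sum_smul]
    exact Finset.sum_congr rfl fun j _ => mul_smul _ _ _
  have hs1 := fun i => DD_sum (B := B) (Finset.range M) (φ := fun j x => X i x • (X j x • Φ x))
    (fun j _ => hCC i j)
  have hs2 := DD_sum (B := B) (Finset.range M)
    (φ := fun i x => ∑ j ∈ Finset.range M, X i x • (X j x • Φ x)) (fun i _ => (hs1 i).1)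
  rw [e, DD_const_smul hs2.1, hs2.2]
  have hoff : ∀ i j, j < i → DD B (fun x => X i x • (X j x • Φ x)) ≤ δ / 2 := fun i j hij =>
    (le_abs_self _).trans (hrr j i hij)
  have hdiag : ∀ i j, DD B (fun x => X i x • (X j x • Φ x)) ≤ PP B Ω := fun i j =>
    DD_le_one hp (hCC i j) (by
      intro x
      rw [norm_smul, norm_smul, Real.norm_eq_abs, Real.norm_eq_abs]
      have := hX1 i x; have := hX1 j x; have := h1 x
      calc |X i x| * (|X j x| * ‖Φ x‖) ≤ (1/2) * ((1/2) * 1) := by gcongr <;> assumption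
        _ ≤ 1 := by norm_num)
  have hall : ∀ i j, DD B (fun x => X i x • (X j x • Φ x)) ≤
      δ / 2 + if i = j then PP B Ω else 0 := by
    intro i j
    rcases lt_trichotomy j i with hij | hij | hij
    · rw [if_neg hij.ne']; linarith [hoff i j hij]
    · rw [if_pos hij.symm]; linarith [hdiag i j]
    · rw [if_neg hij.ne]
      have : (fun x => X i x • (X j x • Φ x)) = fun x => X j x • (X i x • Φ x) := by
        ext1 x; rw [smul_comm]
      rw [this]; linarith [hoff j i hij]
  calc _ ≤ (M:ℝ)⁻¹ ^ 2 * ∑ i ∈ Finset.range M, ∑ j ∈ Finset.range M,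
        (δ / 2 + if i = j then PP B Ω else 0) := by
        gcongr with i hi
        rw [(hs1 i).2]
        exact Finset.sum_le_sum fun j _ => hall i j
    _ = (M:ℝ)⁻¹ ^ 2 * (M * (M * (δ / 2)) + M * PP B Ω) := by
        congr 1
        simp only [Finset.sum_add_distrib, Finset.sum_ite_eq, Finset.sum_const, Finset.card_range,
          nsmul_eq_mul]
        congr 1
        rw [Finset.sum_congr rfl (g := fun _ => PP B Ω) (fun i hi => by rw [if_pos hi])]
        simp
    _ = δ / 2 + PP B Ω / M := by field_simp
    _ ≤ _ := by
        have : PP B Ω / M ≤ δ / 2 := by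
          rw [div_lt_iff₀ (by positivity)] at hM
          rw [div_le_iff₀ hM']; linarith
        linarith


/-- squared positive part of `1/2 - s` -/
def gg (s : ℝ) : ℝ := (max (1/2 - s) 0) ^ 2

lemma gg_hasDerivAt (s : ℝ) : HasDerivAt gg (-(2 * max (1/2 - s) 0)) s := by
  have hne : ∀ y : ℝ, y ≠ 1/2 → HasDerivAt gg (-(2 * max (1/2 - y) 0)) y := by
    intro y hy
    rcases lt_or_gt_of_ne hy with h | h
    · rw [max_eq_left (by linarith)]
      have h1 : HasDerivAt (fun s : ℝ => (1/2 - s) ^ 2) (-(2 * (1/2 - y))) y := by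
        have := ((hasDerivAt_id y).const_sub (1/2)).pow 2
        refine this.congr_deriv ?_
        simp
      refine h1.congr_of_eventuallyEq ?_
      filter_upwards [gt_mem_nhds h] with z hz
      unfold gg
      rw [max_eq_left (by linarith)]
    · rw [max_eq_right (by linarith)]
      have h1 : HasDerivAt (fun _ : ℝ => (0:ℝ)) (-(2 * 0)) y := by
        simpa using hasDerivAt_const y (0:ℝ)
      refine h1.congr_of_eventuallyEq ?_
      filter_upwards [lt_mem_nhds h] with z hz
      unfold gg
      rw [max_eq_right (by linarith)]; simp
  by_cases hs : s = 1/2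
  · subst hs
    refine hasDerivAt_of_hasDerivAt_of_ne (g := fun y => -(2 * max (1/2 - y) 0)) hne ?_ ?_
    · unfold gg; fun_prop
    · fun_prop
  · exact hne s hs

lemma gg_contDiff : ContDiff ℝ 1 gg := by
  rw [contDiff_one_iff_deriv]
  refine ⟨fun s => (gg_hasDerivAt s).differentiableAt, ?_⟩
  have : deriv gg = fun s => -(2 * max (1/2 - s) 0) := by
    ext s; exact (gg_hasDerivAt s).deriv
  rw [this]; fun_prop

lemma gg_nonneg (s : ℝ) : 0 ≤ gg s := sq_nonneg _

lemma gg_le_sq (s : ℝ) : gg s ≤ (s - 1/2) ^ 2 := by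
  unfold gg
  rcases le_total (1/2 - s) 0 with h | h
  · rw [max_eq_right h]; nlinarith [sq_nonneg (s - 1/2)]
  · rw [max_eq_left h]; apply le_of_eq; ring

lemma gg_le {s : ℝ} (h0 : 0 ≤ s) (h1 : s ≤ 1) : gg s ≤ 1 - s ∧ gg s ≤ 1/4 := by
  unfold gg
  rcases le_total (1/2 - s) 0 with h | h
  · rw [max_eq_right h]; constructor <;> norm_num <;> linarith
  · rw [max_eq_left h]; constructor <;> nlinarith

lemma gg_pos {s : ℝ} (h : 0 < gg s) : s < 1/2 := by
  by_contra hs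
  unfold gg at h
  rw [max_eq_right (by linarith)] at h
  simp at h

lemma gg_small {s : ℝ} (h : gg s ≤ 1/8) : 1/8 ≤ s := by
  by_contra hs
  push Not at hs
  unfold gg at h
  rw [max_eq_left (by linarith)] at h
  nlinarith

/-- gradient as a vector -/
def gr (u : Euc N → ℝ) (x : Euc N) : Euc N :=
  WithLp.toLp 2 fun i => fderiv ℝ u x (EuclideanSpace.single i 1)

lemma gr_apply (u : Euc N → ℝ) (x w : Euc N) : fderiv ℝ u x w = inner ℝ (gr u x) w := by
  have hw : w = ∑ i, w i • EuclideanSpace.single i (1:ℝ) := by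
    ext j
    simp [Finset.sum_apply, Pi.single_apply]
  conv_lhs => rw [hw]
  rw [map_sum, PiLp.inner_apply]
  refine Finset.sum_congr rfl fun i _ => ?_
  simp [gr]

lemma gr_norm (u : Euc N → ℝ) (x : Euc N) : ‖fderiv ℝ u x‖ ≤ ‖gr u x‖ := by
  apply ContinuousLinearMap.opNorm_le_bound _ (norm_nonneg _)
  intro w
  rw [gr_apply]
  exact norm_inner_le_norm _ _

lemma gr_contDiff {u : Euc N → ℝ} (h : ContDiff ℝ 2 u) : ContDiff ℝ 1 (gr u) := by
  rw [contDiff_euclidean]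
  intro i
  show ContDiff ℝ 1 fun x => fderiv ℝ u x (EuclideanSpace.single i 1)
  have : ContDiff ℝ 1 (fderiv ℝ u) := h.fderiv_right (by norm_num)
  exact this.clm_apply contDiff_const

lemma e2a {Ω : Set (Euc N)} {u ζ : Euc N → ℝ} (hu : ContDiff ℝ 2 u) (hζ : ContDiff ℝ 1 ζ)
    (hζc : HasCompactSupport ζ) (hζs : tsupport ζ ⊆ Ω) (h0 : ∀ x, 0 ≤ ζ x) {κ : ℝ} (hκ : 0 < κ) :
    ∃ φ, CC Ω φ ∧ (∀ x, ‖φ x‖ ≤ ζ x) ∧ tsupport φ ⊆ tsupport ζ ∧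
      ∫ x, ζ x * ‖fderiv ℝ u x‖ ≤ κ * (∫ x, ζ x) + ∫ x, u x * diverg φ x := by
  have hG := gr_contDiff hu
  set D : Euc N → ℝ := fun x => Real.sqrt (‖gr u x‖ ^ 2 + κ ^ 2) with hD
  have hDpos : ∀ x, 0 < D x := fun x => Real.sqrt_pos.2 (by positivity)
  have hDge : ∀ x, ‖gr u x‖ ≤ D x := fun x => Real.le_sqrt_of_sq_le (by nlinarith [sq_nonneg κ])
  have hDle : ∀ x, D x ≤ ‖gr u x‖ + κ := fun x => by
    apply Real.sqrt_le_iff.2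
    constructor
    · positivity
    · nlinarith [norm_nonneg (gr u x)]
  have hDsq : ∀ x, D x ^ 2 = ‖gr u x‖ ^ 2 + κ ^ 2 := fun x => Real.sq_sqrt (by positivity)
  have hDc : ContDiff ℝ 1 D := by
    apply ContDiff.sqrt
    · exact (hG.norm_sq ℝ).add contDiff_const
    · intro x; positivity
  have hφ1 : ContDiff ℝ 1 fun x => -((D x)⁻¹ • gr u x) :=
    ((hDc.inv fun x => (hDpos x).ne').smul hG).neg
  have hCC : CC Ω (fun x => ζ x • -((D x)⁻¹ • gr u x)) := CC.smul_left hφ1 hζ hζc hζs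
  have hu1 : ContDiff ℝ 1 u := hu.of_le (by norm_num)
  have hfc := hu1.continuous_fderiv one_ne_zero
  refine ⟨_, hCC, ?_, tsupport_smul_subset_left ζ _, ?_⟩
  · intro x
    rw [norm_smul, norm_neg, norm_smul, Real.norm_of_nonneg (h0 x), norm_inv,
      Real.norm_of_nonneg (hDpos x).le]
    apply mul_le_of_le_one_right (h0 x)
    rw [inv_mul_le_iff₀ (hDpos x), mul_one]
    exact hDge x
  · rw [ibp hCC hu1, ← integral_neg, ← integral_const_mul, ← integral_add]
    · apply integral_mono
      · exact (hζ.continuous.mul hfc.norm).integrable_of_hasCompactSupport hζc.mul_right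
      · refine Integrable.add ?_ ?_
        · exact (hζ.continuous.integrable_of_hasCompactSupport hζc).const_mul κ
        · refine Integrable.neg ?_
          apply (hfc.clm_apply hCC.1.continuous).integrable_of_hasCompactSupport
          exact hCC.2.1.mono (fun x hx h => hx (by simp only [h, map_zero]))
      · intro x
        show ζ x * ‖fderiv ℝ u x‖ ≤ κ * ζ x + -fderiv ℝ u x (ζ x • -((D x)⁻¹ • gr u x))
        rw [map_smul, map_neg, map_smul, gr_apply, real_inner_self_eq_norm_sq]
        simp only [smul_eq_mul]
        have key : ‖fderiv ℝ u x‖ ≤ κ + (D x)⁻¹ * ‖gr u x‖ ^ 2 := by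
          refine (gr_norm u x).trans ?_
          have : (D x)⁻¹ * ‖gr u x‖ ^ 2 = D x - (D x)⁻¹ * κ ^ 2 := by
            have := hDsq x
            have := (hDpos x).ne'
            field_simp
            linarith
          rw [this]
          have h3 : (D x)⁻¹ * κ ^ 2 ≤ κ := by
            rw [inv_mul_le_iff₀ (hDpos x)]
            have : κ ≤ D x := Real.le_sqrt_of_sq_le (by nlinarith [sq_nonneg ‖gr u x‖])
            nlinarith
          linarith [hDge x]
        nlinarith [h0 x]
    · exact (hζ.continuous.integrable_of_hasCompactSupport hζc).const_mul κ
    · refine Integrable.neg ?_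
      apply (hfc.clm_apply hCC.1.continuous).integrable_of_hasCompactSupport
      exact hCC.2.1.mono (fun x hx h => hx (by simp only [h, map_zero]))

lemma e2 {B Ω : Set (Euc N)} (hB : MeasurableSet B) (hp : perimeter B Ω < ⊤) {ζ : Euc N → ℝ}
    (hζ : ContDiff ℝ 1 ζ)
    (hζc : HasCompactSupport ζ) (hζs : tsupport ζ ⊆ Ω) (h0 : ∀ x, 0 ≤ ζ x) (h1 : ∀ x, ζ x ≤ 1)
    {δ : ℝ} (hδ : 0 < δ) {φ₀ : Euc N → Euc N}
    (h₀ : CC Ω φ₀) (h₀1 : ∀ x, ‖φ₀ x‖ ≤ 1) (hopt : PP B Ω - δ ≤ DD B φ₀)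
    {L : ℝ} (hL0 : 0 ≤ L) (hL : ∀ x y, ‖ζ x - ζ y‖ ≤ L * ‖x - y‖)
    {M : ℕ} (hM : 0 < M) {r : ℕ → ℝ} (hr : ∀ i, 0 < r i) {R : ℝ} (hR : ∀ i, r i ≤ R)
    (hs : cthickening R (tsupport ζ) ⊆ Ω) :
    ∫ x, ζ x * ‖fderiv ℝ (av B M r) x‖ ≤ DD B (fun x => ζ x • φ₀ x) + 2 * δ + L * R * PP B Ω := by
  have hPP := PP_nonneg B Ω
  have hζi : 0 ≤ ∫ x, ζ x := integral_nonneg h0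
  obtain ⟨φ, hφ, hφζ, hφs, hφi⟩ := e2a (av_contDiff2 (M := M) hB hr) hζ hζc hζs h0
    (κ := δ / ((∫ x, ζ x) + 1)) (by positivity)
  have k1 : δ / ((∫ x, ζ x) + 1) * (∫ x, ζ x) ≤ δ := by
    rw [div_mul_eq_mul_div, div_le_iff₀ (by positivity)]; nlinarith
  have k2 : ∫ x, av B M r x * diverg φ x ≤
      DD B (fun x => ζ x • φ₀ x) + δ + L * R * PP B Ω := by
    rw [av_diverg hB hr hφ]
    apply avg_bound hM
    intro i
    have hζl := hζ.continuous.locallyIntegrable (μ := (volume : Measure (Euc N)))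
    have hmz : ContDiff ℝ 1 (moll (r i) ζ) := moll_contDiff (hr i) hζl
    have m1 := near_opt hp h₀ h₀1 hopt (φ := moll (r i) φ) (ψ := moll (r i) ζ)
      (moll_CC (hr i) hφ ((cthickening_mono (hR i) _).trans
        ((cthickening_subset_of_subset _ hφs).trans hs)))
      hmz (moll_le_one (hr i) hζl h1) (moll_norm_le (hr i) hζl hφζ)
    have m2 := DD_add (B := B) (h₀.smul hζ) (h₀.smul (hmz.sub hζ))
    have m3 := DD_le hp (h₀.smul (hmz.sub hζ)) (c := L * r i) (by have := hr i; positivity) (by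
      intro x
      rw [norm_smul]
      have := moll_dist (hr i) hζ.continuous hL hL0 x
      exact (mul_le_of_le_one_right (norm_nonneg _) (h₀1 x)).trans this)
    have e : (fun x => ζ x • φ₀ x + (moll (r i) ζ x - ζ x) • φ₀ x) =
        fun x => moll (r i) ζ x • φ₀ x := by
      ext1 x; rw [← add_smul]; congr 1; ring
    rw [e] at m2
    have m4 : L * r i * PP B Ω ≤ L * R * PP B Ω := by gcongr; exact hR i
    linarith
  linarith


lemma core_grad {B Ω : Set (Euc N)} (hB : MeasurableSet B)
    {ζ v : Euc N → ℝ} (hζ : ContDiff ℝ 1 ζ) (hζc : HasCompactSupport ζ)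
    (h0 : ∀ x, 0 ≤ ζ x)
    {φ₀ : Euc N → Euc N} (h₀ : CC Ω φ₀) (h₀1 : ∀ x, ‖φ₀ x‖ ≤ 1)
    (hv : ContDiff ℝ 1 v) (hv0 : ∀ x, 0 ≤ v x)
    {a b c : ℝ} (ha : ∫ x, ζ x * ‖fderiv ℝ v x‖ ≤ a)
    (hb : b ≤ - ∫ x, fderiv ℝ v x (ζ x • φ₀ x))
    (hc : ∫ x in B, fderiv ℝ (fun y => gg (v y)) x (ζ x • φ₀ x) ≤ c) :
    ∫ x in B, ζ x * (2 * max (1/2 - v x) 0) * ‖fderiv ℝ v x‖ ≤ a - b + c := by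
  have hfc := hv.continuous_fderiv one_ne_zero
  have hζcont := hζ.continuous
  have hφc := h₀.1.continuous
  have hvc := hv.continuous
  have hfd : ∀ x, fderiv ℝ (fun y => gg (v y)) x (ζ x • φ₀ x) =
      -(2 * max (1/2 - v x) 0) * fderiv ℝ v x (ζ x • φ₀ x) := by
    intro x
    have := (gg_hasDerivAt (v x)).comp_hasFDerivAt x (hv.differentiable one_ne_zero x).hasFDerivAt
    have e : fderiv ℝ (fun y => gg (v y)) x = -(2 * max (1/2 - v x) 0) • fderiv ℝ v x := this.fderiv
    rw [e]; rfl
  simp_rw [hfd] at hc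
  have hIntg : ∀ {f : Euc N → ℝ}, Continuous f → (∀ x, ζ x = 0 → f x = 0) → Integrable f := by
    intro f hf hf0
    exact hf.integrable_of_hasCompactSupport (hζc.mono fun x hx h => hx (hf0 x h))
  have i1 : Integrable fun x => ζ x * ‖fderiv ℝ v x‖ :=
    hIntg (by fun_prop) fun x hx => by simp [hx]
  have i2 : Integrable fun x => fderiv ℝ v x (ζ x • φ₀ x) :=
    hIntg (by fun_prop) fun x hx => by simp [hx]
  have i3 : Integrable fun x => ζ x * (2 * max (1/2 - v x) 0) * ‖fderiv ℝ v x‖ :=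
    hIntg (by fun_prop) fun x hx => by simp [hx]
  have i4 : Integrable fun x => -(2 * max (1/2 - v x) 0) * fderiv ℝ v x (ζ x • φ₀ x) :=
    hIntg (by fun_prop) fun x hx => by simp [hx]
  have hpt : ∀ x, - fderiv ℝ v x (ζ x • φ₀ x) ≤ ζ x * ‖fderiv ℝ v x‖ := by
    intro x
    rw [map_smul, smul_eq_mul, ← mul_neg]
    refine mul_le_mul_of_nonneg_left ?_ (h0 x)
    refine (neg_le_abs _).trans ?_
    rw [← Real.norm_eq_abs]
    refine (ContinuousLinearMap.le_opNorm _ _).trans ?_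
    exact mul_le_of_le_one_right (norm_nonneg _) (h₀1 x)
  rw [← integral_add_compl hB i1] at ha
  rw [← integral_add_compl hB i2] at hb
  have c1 : - ∫ x in Bᶜ, fderiv ℝ v x (ζ x • φ₀ x) ≤ ∫ x in Bᶜ, ζ x * ‖fderiv ℝ v x‖ := by
    rw [← integral_neg]
    exact integral_mono i2.neg.integrableOn i1.integrableOn hpt
  have c2 : ∫ x in B, (ζ x * (2 * max (1/2 - v x) 0) * ‖fderiv ℝ v x‖
      - -(2 * max (1/2 - v x) 0) * fderiv ℝ v x (ζ x • φ₀ x)) ≤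
      ∫ x in B, (ζ x * ‖fderiv ℝ v x‖ + fderiv ℝ v x (ζ x • φ₀ x)) := by
    apply integral_mono (i3.sub i4).integrableOn (i1.add i2).integrableOn
    intro x
    show ζ x * (2 * max (1/2 - v x) 0) * ‖fderiv ℝ v x‖
      - -(2 * max (1/2 - v x) 0) * fderiv ℝ v x (ζ x • φ₀ x) ≤
      ζ x * ‖fderiv ℝ v x‖ + fderiv ℝ v x (ζ x • φ₀ x)
    have hF : 2 * max (1/2 - v x) 0 ≤ 1 := by
      have : max (1/2 - v x) 0 ≤ 1/2 := max_le (by linarith [hv0 x]) (by norm_num)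
      linarith
    have := mul_nonneg (sub_nonneg.2 hF) (sub_nonneg.2 (hpt x))
    nlinarith
  rw [integral_sub i3.integrableOn i4.integrableOn,
    integral_add i1.integrableOn i2.integrableOn] at c2
  linarith

theorem core1 {B Ω : Set (Euc N)} (hB : MeasurableSet B) (hp : perimeter B Ω < ⊤)
    (hΩ : IsOpen Ω) {ζ : Euc N → ℝ} (hζ : ContDiff ℝ 1 ζ) (hζc : HasCompactSupport ζ)
    (hζs : tsupport ζ ⊆ Ω) (h0 : ∀ x, 0 ≤ ζ x) (h1 : ∀ x, ζ x ≤ 1) {δ : ℝ} (hδ : 0 < δ) :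
    ∃ ψ : Euc N → ℝ, ContDiff ℝ 1 ψ ∧ HasCompactSupport ψ ∧ tsupport ψ ⊆ Ω ∧ (∀ x, 0 ≤ ψ x) ∧
      (∀ φ, CC Ω φ → (∀ x, ‖φ x‖ ≤ ψ x) → DD B φ ≤ δ) ∧
      ∫ x in B, ‖fderiv ℝ ψ x‖ ≤ δ ∧ volume (B ∩ {x | 0 < ψ x}) ≤ ENNReal.ofReal δ ∧
      ∀ x, ζ x = 1 → ψ x ≤ 1/8 → ∃ r, 0 < r ∧ r < δ ∧
        ENNReal.ofReal (1/8) * volume (ball x r) ≤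
          ENNReal.ofReal (Crho N * om N) * volume (B ∩ ball x r) := by
  have hPP := PP_nonneg B Ω
  obtain ⟨L, hL0, hL⟩ := lip_of hζ hζc
  set δ1 := δ / 10 with hδ1
  have hδ1p : 0 < δ1 := by positivity
  obtain ⟨φ₀, h₀, h₀1, hopt⟩ := exists_near_opt B Ω hδ1p
  have hΦ : CC Ω (fun x => ζ x • φ₀ x) := h₀.smul hζ
  have hΦ1 : ∀ x, ‖ζ x • φ₀ x‖ ≤ 1 := fun x => by
    rw [norm_smul, Real.norm_of_nonneg (h0 x)]
    exact mul_le_one₀ (h1 x) (norm_nonneg _) (h₀1 x)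
  obtain ⟨L', hL'0, hL'⟩ := lip_of hΦ.1 hΦ.2.1
  obtain ⟨D, hD0, hD⟩ := bdd_of (continuous_diverg hΦ.1) (diverg_compact hΦ.2.1)
  obtain ⟨G, hG0, hG⟩ := bdd_of (hζ.continuous_fderiv one_ne_zero) (hζc.fderiv ℝ)
  obtain ⟨δ₀, hδ₀, U, hU, hKU, hUΩ, hUs⟩ := exists_nbhd hζc hΩ hζs
  set S := L + L' + D + G + 2 with hS
  have hSp : 0 < S := by positivity
  set R := min δ₀ (min δ (δ1 / (S * (PP B Ω + 1)))) with hRdef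
  have hR : 0 < R := by positivity
  have hR1 : R ≤ δ₀ := min_le_left _ _
  have hR2 : R ≤ δ := (min_le_right _ _).trans (min_le_left _ _)
  have hR3 : S * (R * PP B Ω) ≤ δ1 := by
    have : R ≤ δ1 / (S * (PP B Ω + 1)) := (min_le_right _ _).trans (min_le_right _ _)
    rw [le_div_iff₀ (by positivity)] at this
    nlinarith [mul_pos hSp hR]
  have n0 : 0 ≤ R * PP B Ω := by positivity
  have n1 : 0 ≤ L * (R * PP B Ω) := by positivity
  have n2 : 0 ≤ L' * (R * PP B Ω) := by positivity
  have n3 : 0 ≤ D * (R * PP B Ω) := by positivity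
  have n4 : 0 ≤ G * (R * PP B Ω) := by positivity
  have hsum : L * (R * PP B Ω) + L' * (R * PP B Ω) + D * (R * PP B Ω) + G * (R * PP B Ω)
      + 2 * (R * PP B Ω) ≤ δ1 := by
    have : S * (R * PP B Ω) = L * (R * PP B Ω) + L' * (R * PP B Ω) + D * (R * PP B Ω) +
      G * (R * PP B Ω) + 2 * (R * PP B Ω) := by rw [hS]; ring
    linarith
  have hKR : cthickening R (tsupport ζ) ⊆ U := (cthickening_mono hR1 _).trans hKU
  have hUR : ∀ x ∈ U, ∀ z, ‖z‖ ≤ R → x - z ∈ Ω := fun x hx z hz => hUs x hx z (hz.trans hR1)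
  obtain ⟨M, hM, r, hr, hrR, hav⟩ := exists_av hB hp hΩ hΦ hΦ1 hδ1p hR
  have hrR' : ∀ i, r i ≤ R := fun i => (hrR i).le
  set v := av B M r with hvdef
  have hv2 : ContDiff ℝ 2 v := av_contDiff2 hB hr
  have hv : ContDiff ℝ 1 v := hv2.of_le (by norm_num)
  have hv0 : ∀ x, 0 ≤ v x := av_nonneg hM hr
  have hv1 : ∀ x, v x ≤ 1 := av_le_one hB hM hr
  have hgood := av_good (M := M) hB hp hM hr hU hrR' hUR
  have hgv : ContDiff ℝ 1 (fun x => gg (v x)) := gg_contDiff.comp hv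
  have hψ : ContDiff ℝ 1 (fun x => ζ x * gg (v x)) := hζ.mul hgv
  have hUζ : ∀ x, x ∉ U → x ∉ tsupport ζ := fun x hx h => hx (hKR (self_subset_cthickening _ h))
  have hψ1 : ∀ x, ζ x * gg (v x) ≤ 1 := fun x =>
    mul_le_one₀ (h1 x) (gg_nonneg _) (by linarith [(gg_le (hv0 x) (hv1 x)).2])
  have hgvc := hgv.continuous
  have hvc := hv.continuous
  have hfc := hv.continuous_fderiv one_ne_zero
  have hfζ := hζ.continuous_fderiv one_ne_zero
  have hζcont := hζ.continuous
  -- DD of psi phi0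
  have d1 : DD B (fun x => gg (v x) • (ζ x • φ₀ x)) ≤ 2 * δ1 := by
    have := near_opt hp h₀ h₀1 hopt (hΦ.smul hgv) (ψ := fun x => (v x - 1/2) ^ 2 * ζ x)
      (((hv.sub contDiff_const).pow 2).mul hζ) (by
        intro x
        refine mul_le_one₀ ?_ (h0 x) (h1 x)
        nlinarith [hv0 x, hv1 x]) (by
        intro x
        beta_reduce
        rw [norm_smul, norm_smul, Real.norm_of_nonneg (gg_nonneg _), Real.norm_of_nonneg (h0 x)]
        refine mul_le_mul (gg_le_sq _) ?_ (by have := h0 x; positivity) (sq_nonneg _)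
        exact mul_le_of_le_one_right (h0 x) (h₀1 x))
    have e : (fun x => ((v x - 1/2) ^ 2 * ζ x) • φ₀ x) =
        fun x => (v x - 1/2) ^ 2 • ζ x • φ₀ x := by ext1 x; rw [mul_smul]
    rw [e] at this
    linarith
  have d2 : DD B (fun x => (ζ x * gg (v x)) • φ₀ x) ≤ 2 * δ1 := by
    have e : (fun x => (ζ x * gg (v x)) • φ₀ x) = fun x => gg (v x) • (ζ x • φ₀ x) := by
      ext1 x; rw [mul_comm, mul_smul]
    rw [e]; exact d1
  -- e4
  have e4 : ∫ x in B, fderiv ℝ (fun y => gg (v y)) x (ζ x • φ₀ x) ≤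
      2 * δ1 + D * (R * PP B Ω) := by
    have a1 := DD_smul_eq (B := B) hΦ hgv
    have hdc := continuous_diverg hΦ.1
    have a2 := (good_use hB hU n0 hvc hgood (q := fun x => gg (v x) * diverg (fun x => ζ x • φ₀ x) x)
      hD0 (by
        intro x hx
        rw [norm_mul, mul_comm, Real.norm_of_nonneg (gg_nonneg _)]
        exact mul_le_mul (hD x) (gg_le (hv0 x) (hv1 x)).1 (gg_nonneg _) hD0) (by
        intro x hx
        have : x ∉ tsupport (diverg (fun x => ζ x • φ₀ x)) := fun h => hUζ x hx
          (tsupport_smul_subset_left ζ φ₀ (tsupport_diverg _ h))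
        rw [image_eq_zero_of_notMem_tsupport this, mul_zero]) (by fun_prop)).2
    rw [Real.norm_eq_abs, abs_le] at a2
    linarith [a2.1]
  have e3 : DD B (fun x => ζ x • φ₀ x) - L' * (R * PP B Ω) ≤
      - ∫ x, fderiv ℝ v x (ζ x • φ₀ x) := by
    rw [← ibp hΦ hv, hvdef, av_diverg hB hr hΦ]
    apply avg_bound' hM
    intro i
    have := moll_close (B := B) hp hΦ hL'0 hL' (hr i) ((cthickening_subset_of_subset _
      (tsupport_smul_subset_left ζ φ₀)).trans ((cthickening_mono (hrR' i) _).trans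
        (hKR.trans hUΩ)))
    rw [abs_le] at this
    have m4 : L' * r i * PP B Ω ≤ L' * R * PP B Ω := by gcongr; exact hrR' i
    linarith [this.1]
  have e2' := e2 hB hp hζ hζc hζs h0 h1 hδ1p h₀ h₀1 hopt hL0 hL hM hr hrR' (hKR.trans hUΩ)
  have hgrad := core_grad hB hζ hζc h0 h₀ h₀1 hv hv0 e2' e3 e4
  refine ⟨fun x => ζ x * gg (v x), hψ, hζc.mul_right, (tsupport_mul_subset_left).trans hζs,
    fun x => mul_nonneg (h0 x) (gg_nonneg _), ?_, ?_, ?_, ?_⟩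
  · intro φ hφ hφψ
    have := near_opt hp h₀ h₀1 hopt hφ hψ hψ1 hφψ
    linarith
  · have hfd : ∀ x, fderiv ℝ (fun x => ζ x * gg (v x)) x =
        ζ x • (-(2 * max (1/2 - v x) 0) • fderiv ℝ v x) + gg (v x) • fderiv ℝ ζ x := by
      intro x
      have := (gg_hasDerivAt (v x)).comp_hasFDerivAt x (hv.differentiable one_ne_zero x).hasFDerivAt
      have e : fderiv ℝ (fun y => gg (v y)) x = -(2 * max (1/2 - v x) 0) • fderiv ℝ v x :=
        this.fderiv
      rw [fderiv_fun_mul (hζ.differentiable one_ne_zero x) (hgv.differentiable one_ne_zero x), e]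
    have a2 := (good_use hB hU n0 hvc hgood (q := fun x => gg (v x) • fderiv ℝ ζ x)
      hG0 (by
        intro x hx
        rw [norm_smul, mul_comm, Real.norm_of_nonneg (gg_nonneg _)]
        exact mul_le_mul (hG x) (gg_le (hv0 x) (hv1 x)).1 (gg_nonneg _) hG0) (by
        intro x hx
        have : x ∉ tsupport (fderiv ℝ ζ) := fun h => hUζ x hx (tsupport_fderiv_subset ℝ h)
        rw [image_eq_zero_of_notMem_tsupport this, smul_zero]) (by fun_prop)).1
    have i1 : Integrable fun x => ζ x * (2 * max (1/2 - v x) 0) * ‖fderiv ℝ v x‖ :=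
      Continuous.integrable_of_hasCompactSupport (by fun_prop)
        (hζc.mono fun x hx h => hx (by simp [h]))
    have i2 : Integrable fun x => ‖gg (v x) • fderiv ℝ ζ x‖ :=
      Continuous.integrable_of_hasCompactSupport (by fun_prop)
        ((hζc.fderiv ℝ).mono fun x hx h => hx (by simp only [h, smul_zero, norm_zero]))
    have a3 : ∫ x in B, ‖fderiv ℝ (fun x => ζ x * gg (v x)) x‖ ≤
        ∫ x in B, (ζ x * (2 * max (1/2 - v x) 0) * ‖fderiv ℝ v x‖ + ‖gg (v x) • fderiv ℝ ζ x‖) := by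
      apply integral_mono_of_nonneg (Eventually.of_forall fun x => norm_nonneg _)
        (i1.add i2).integrableOn (Eventually.of_forall fun x => ?_)
      beta_reduce
      rw [hfd]
      refine (norm_add_le _ _).trans ?_
      refine add_le_add (le_of_eq ?_) le_rfl
      rw [norm_smul, norm_smul, norm_neg, Real.norm_of_nonneg (h0 x), Real.norm_of_nonneg
        (by positivity : 0 ≤ 2 * max (1/2 - v x) 0)]
      beta_reduce
      ring
    rw [integral_add i1.integrableOn i2.integrableOn] at a3
    linarith
  · have hsub : B ∩ {x | 0 < ζ x * gg (v x)} ⊆ (B ∩ U) ∩ {x | 1/2 ≤ 1 - v x} := by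
      rintro x ⟨hxB, hx⟩
      have hx : 0 < ζ x * gg (v x) := hx
      refine ⟨⟨hxB, ?_⟩, ?_⟩
      · by_contra hxU
        rw [image_eq_zero_of_notMem_tsupport (hUζ x hxU), zero_mul] at hx
        exact lt_irrefl _ hx
      · have : 0 < gg (v x) := (gg_nonneg _).lt_of_ne fun h => by simp [← h] at hx
        show 1/2 ≤ 1 - v x
        linarith [gg_pos this]
    have hm := mul_meas_ge_le_lintegral₀ (μ := volume.restrict (B ∩ U))
      (f := fun x => ENNReal.ofReal (1 - v x)) (by fun_prop) (ENNReal.ofReal (1/2))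
    have hmeas : MeasurableSet {x | 1/2 ≤ 1 - v x} :=
      (isClosed_le continuous_const (by fun_prop)).measurableSet
    have hset : {x | ENNReal.ofReal (1/2) ≤ ENNReal.ofReal (1 - v x)} = {x | 1/2 ≤ 1 - v x} := by
      ext x
      exact ENNReal.ofReal_le_ofReal_iff (by linarith [hv1 x])
    rw [hset, Measure.restrict_apply hmeas, inter_comm] at hm
    have h2 : volume (B ∩ U ∩ {x | 1/2 ≤ 1 - v x}) ≤ ENNReal.ofReal 2 * ENNReal.ofReal (R * PP B Ω) := by
      calc _ = ENNReal.ofReal 2 * (ENNReal.ofReal (1/2) * volume (B ∩ U ∩ {x | 1/2 ≤ 1 - v x})) := by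
            rw [← mul_assoc, ← ENNReal.ofReal_mul (by norm_num)]; norm_num
        _ ≤ _ := mul_le_mul_right (hm.trans hgood) _
    refine (measure_mono hsub).trans (h2.trans ?_)
    rw [← ENNReal.ofReal_mul (by norm_num)]
    apply ENNReal.ofReal_le_ofReal
    linarith
  · intro x hζx hψx
    have hψx : ζ x * gg (v x) ≤ 1/8 := hψx
    rw [hζx, one_mul] at hψx
    obtain ⟨i, hi⟩ := av_exists hM (gg_small hψx)
    refine ⟨r i, hr i, (hrR i).trans_le hR2, ?_⟩
    refine le_trans (mul_le_mul_left (ENNReal.ofReal_le_ofReal hi) _) (vv_dens hB (hr i) x)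


/-- A cut-off which is cheap for `B`. -/
def Cut (B Ω : Set (Euc N)) (w : Euc N → ℝ) (δ : ℝ) : Prop :=
  ContDiff ℝ 1 w ∧ HasCompactSupport w ∧ (∀ x, 0 ≤ w x) ∧ (∀ x, w x ≤ 1) ∧
    (∀ φ, CC Ω φ → (∀ x, ‖φ x‖ ≤ 1) → DD B (fun x => w x • φ x) ≤ δ) ∧
    ∫ x in B, ‖fderiv ℝ w x‖ ≤ δ

lemma Cut.union {B Ω : Set (Euc N)} {w w' : Euc N → ℝ} {δ δ' : ℝ} (h : Cut B Ω w δ)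
    (h' : Cut B Ω w' δ') : Cut B Ω (fun x => w x + (1 - w x) * w' x) (δ + δ') := by
  obtain ⟨h1, h2, h3, h4, h5, h6⟩ := h
  obtain ⟨h1', h2', h3', h4', h5', h6'⟩ := h'
  have hc : ContDiff ℝ 1 (fun x => 1 - w x) := contDiff_const.sub h1
  refine ⟨h1.add (hc.mul h1'), h2.add (h2'.mul_left), ?_, ?_, ?_, ?_⟩
  · intro x; nlinarith [h3 x, h4 x, h3' x, h4' x]
  · intro x; nlinarith [h3 x, h4 x, h3' x, h4' x]
  · intro φ hφ hφ1
    have a := DD_add (B := B) (hφ.smul h1) ((hφ.smul hc).smul h1')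
    have e : (fun x => (w x + (1 - w x) * w' x) • φ x) =
        fun x => w x • φ x + w' x • ((1 - w x) • φ x) := by
      ext1 x; rw [add_smul, mul_comm, mul_smul]
    rw [e, a]
    refine add_le_add (h5 φ hφ hφ1) (h5' _ (hφ.smul hc) fun x => ?_)
    rw [norm_smul, Real.norm_of_nonneg (by linarith [h4 x])]
    exact mul_le_one₀ (by linarith [h3 x]) (norm_nonneg _) (hφ1 x)
  · have hw := h1.continuous_fderiv one_ne_zero
    have hw' := h1'.continuous_fderiv one_ne_zero
    have i1 : Integrable fun x => ‖fderiv ℝ w x‖ :=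
      (hw.norm).integrable_of_hasCompactSupport ((h2.fderiv ℝ).norm)
    have i2 : Integrable fun x => ‖fderiv ℝ w' x‖ :=
      (hw'.norm).integrable_of_hasCompactSupport ((h2'.fderiv ℝ).norm)
    have a : ∫ x in B, ‖fderiv ℝ (fun x => w x + (1 - w x) * w' x) x‖ ≤
        ∫ x in B, (‖fderiv ℝ w x‖ + ‖fderiv ℝ w' x‖) := by
      apply integral_mono_of_nonneg (Eventually.of_forall fun x => norm_nonneg _)
        (i1.add i2).integrableOn (Eventually.of_forall fun x => ?_)
      beta_reduce
      have d1 := h1.differentiable one_ne_zero x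
      have d2 := h1'.differentiable one_ne_zero x
      have e : fderiv ℝ (fun x => w x + (1 - w x) * w' x) x =
          (1 - w' x) • fderiv ℝ w x + (1 - w x) • fderiv ℝ w' x := by
        rw [fderiv_fun_add d1 ((hc.mul h1').differentiable one_ne_zero x),
          fderiv_fun_mul (hc.differentiable one_ne_zero x) d2, fderiv_const_sub]
        module
      rw [e]
      refine (norm_add_le _ _).trans ?_
      rw [norm_smul, norm_smul, Real.norm_of_nonneg (by linarith [h4' x]),
        Real.norm_of_nonneg (by linarith [h4 x])]
      refine add_le_add ?_ ?_
      · exact mul_le_of_le_one_left (norm_nonneg _) (by linarith [h3' x])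
      · exact mul_le_of_le_one_left (norm_nonneg _) (by linarith [h3 x])
    rw [integral_add i1.integrableOn i2.integrableOn] at a
    linarith

/-- Sets approximable by cheap cut-offs. -/
def CutSet (B Ω U : Set (Euc N)) (δ : ℝ) : Prop :=
  ∃ w : ℕ → Euc N → ℝ, (∀ n, Cut B Ω (w n) δ) ∧
    ∀ x, Tendsto (fun n => w n x) atTop (𝓝 (U.indicator (fun _ => (1:ℝ)) x))

lemma CutSet.union {B Ω U U' : Set (Euc N)} {δ δ' : ℝ} (h : CutSet B Ω U δ)
    (h' : CutSet B Ω U' δ') : CutSet B Ω (U ∪ U') (δ + δ') := by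
  obtain ⟨w, hw, hl⟩ := h
  obtain ⟨w', hw', hl'⟩ := h'
  refine ⟨_, fun n => (hw n).union (hw' n), fun x => ?_⟩
  have := (hl x).add (((hl x).const_sub 1).mul (hl' x))
  convert this using 2
  by_cases h1 : x ∈ U <;> by_cases h2 : x ∈ U' <;> simp [h1, h2]

lemma CutSet.empty {B Ω : Set (Euc N)} : CutSet B Ω ∅ 0 := by
  refine ⟨fun _ _ => 0, fun n => ⟨contDiff_const, HasCompactSupport.zero, fun _ => le_rfl,
    fun _ => zero_le_one, fun φ _ _ => ?_, ?_⟩, fun x => ?_⟩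
  · simp only [zero_smul]
    rw [DD_zero]
  · simp
  · simp

lemma CutSet.biUnion {B Ω : Set (Euc N)} {U : ℕ → Set (Euc N)} {δ : ℕ → ℝ}
    (h : ∀ m, CutSet B Ω (U m) (δ m)) (n : ℕ) :
    CutSet B Ω (⋃ m < n, U m) (∑ m ∈ Finset.range n, δ m) := by
  induction n with
  | zero => simpa using CutSet.empty
  | succ n ih =>
    rw [Finset.sum_range_succ, Set.biUnion_lt_succ]
    exact ih.union (h n)

lemma CutSet.DD_le {B Ω U : Set (Euc N)} (hU : MeasurableSet U) {δ : ℝ}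
    (h : CutSet B Ω U δ) {φ : Euc N → Euc N} (hφ : CC Ω φ) (hφ1 : ∀ x, ‖φ x‖ ≤ 1) :
    DD (B ∩ U) φ ≤ 2 * δ := by
  obtain ⟨w, hw, hl⟩ := h
  have hb : ∀ n, ∫ x in B, w n x * diverg φ x ≤ 2 * δ := by
    intro n
    obtain ⟨h1, h2, h3, h4, h5, h6⟩ := hw n
    have a := DD_smul_eq (B := B) hφ h1
    have b := h5 φ hφ hφ1
    have hwc := h1.continuous_fderiv one_ne_zero
    have c : ‖∫ x in B, fderiv ℝ (w n) x (φ x)‖ ≤ ∫ x in B, ‖fderiv ℝ (w n) x‖ := by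
      apply norm_integral_le_of_norm_le
      · exact ((hwc.norm).integrable_of_hasCompactSupport ((h2.fderiv ℝ).norm)).integrableOn
      · refine Eventually.of_forall fun x => ?_
        exact (ContinuousLinearMap.le_opNorm _ _).trans
          (mul_le_of_le_one_right (norm_nonneg _) (hφ1 x))
    rw [Real.norm_eq_abs, abs_le] at c
    linarith [c.1]
  have hlim : Tendsto (fun n => ∫ x in B, w n x * diverg φ x) atTop
      (𝓝 (∫ x in B, U.indicator (fun _ => (1:ℝ)) x * diverg φ x)) := by
    apply tendsto_integral_of_dominated_convergence (fun x => ‖diverg φ x‖)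
    · intro n
      exact ((hw n).1.continuous.mul (continuous_diverg hφ.1)).aestronglyMeasurable
    · exact hφ.integrable.norm.integrableOn
    · intro n
      refine Eventually.of_forall fun x => ?_
      rw [norm_mul]
      refine mul_le_of_le_one_left (norm_nonneg _) ?_
      rw [Real.norm_of_nonneg ((hw n).2.2.1 x)]
      exact (hw n).2.2.2.1 x
    · exact Eventually.of_forall fun x => (hl x).mul_const _
  have e : ∫ x in B, U.indicator (fun _ => (1:ℝ)) x * diverg φ x = DD (B ∩ U) φ := by
    unfold DD
    rw [inter_comm, ← Measure.restrict_restrict hU, ← integral_indicator hU]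
    congr 1; ext x
    by_cases hx : x ∈ U <;> simp [hx]
  rw [e] at hlim
  exact le_of_tendsto' hlim hb

lemma exists_level {m : ℝ → ℝ} (hm : Monotone m) {a b K : ℝ} (hab : a < b)
    (hK : m b - m a < K * (b - a)) :
    ∃ τ ∈ Ioo a b, DifferentiableAt ℝ m τ ∧ deriv m τ < K := by
  by_contra hcon
  push Not at hcon
  have h1 := (hm.monotoneOn (uIcc a b)).intervalIntegral_deriv_mem_uIcc
  have h2 := (hm.monotoneOn (uIcc a b)).intervalIntegrable_deriv
  rw [uIcc_of_le (sub_nonneg.2 (hm hab.le))] at h1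
  have h3 : ∫ t in a..b, K ≤ ∫ t in a..b, deriv m t := by
    have h2' := (intervalIntegrable_iff_integrableOn_Ioo_of_le hab.le).1 h2
    rw [intervalIntegral.integral_of_le hab.le, intervalIntegral.integral_of_le hab.le,
      integral_Ioc_eq_integral_Ioo, integral_Ioc_eq_integral_Ioo]
    apply setIntegral_mono_ae_restrict (by simp) h2'
    have := ae_restrict_of_ae (s := Ioo a b) hm.ae_differentiableAt
    filter_upwards [this, ae_restrict_mem measurableSet_Ioo] with t ht1 ht2 using hcon t ht2 ht1
  rw [intervalIntegral.integral_const, smul_eq_mul] at h3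
  linarith [h1.2]

lemma S_bound : ∃ C : ℝ, 0 < C ∧ (∀ t, |deriv Real.smoothTransition t| ≤ C) ∧
    (∀ t, t ≤ 0 → deriv Real.smoothTransition t = 0) ∧
    ∀ t, 1 ≤ t → deriv Real.smoothTransition t = 0 := by
  have hc : ContDiff ℝ 1 Real.smoothTransition := Real.smoothTransition.contDiff
  have hd : Continuous (deriv Real.smoothTransition) := hc.continuous_deriv le_rfl
  have z0 : ∀ t, t ≤ 0 → deriv Real.smoothTransition t = 0 := by
    intro t ht
    apply IsLocalMin.deriv_eq_zero
    refine Eventually.of_forall fun s => ?_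
    rw [Real.smoothTransition.zero_of_nonpos ht]
    exact Real.smoothTransition.nonneg s
  have z1 : ∀ t, 1 ≤ t → deriv Real.smoothTransition t = 0 := by
    intro t ht
    apply IsLocalMax.deriv_eq_zero
    refine Eventually.of_forall fun s => ?_
    rw [Real.smoothTransition.one_of_one_le ht]
    exact Real.smoothTransition.le_one s
  obtain ⟨C, hC⟩ := (isCompact_Icc (a := (0:ℝ)) (b := 1)).exists_bound_of_continuousOn hd.continuousOn
  refine ⟨|C| + 1, by positivity, fun t => ?_, z0, z1⟩
  rcases le_total t 0 with h | h
  · rw [z0 t h]; simp; positivity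
  rcases le_total 1 t with h' | h'
  · rw [z1 t h']; simp; positivity
  · have := hC t ⟨h, h'⟩
    rw [Real.norm_eq_abs] at this
    linarith [le_abs_self C]


lemma level_cut {B Ω : Set (Euc N)} (hB : MeasurableSet B) {ψ : Euc N → ℝ} (hψ : ContDiff ℝ 1 ψ)
    (hψc : HasCompactSupport ψ) (hψ0 : ∀ x, 0 ≤ ψ x) {δ : ℝ} (hδ : 0 < δ)
    (h1 : ∀ φ, CC Ω φ → (∀ x, ‖φ x‖ ≤ ψ x) → DD B φ ≤ δ)
    (h2 : ∫ x in B, ‖fderiv ℝ ψ x‖ ≤ δ) {C₀ : ℝ} (hC₀ : 0 < C₀)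
    (hS : ∀ t, |deriv Real.smoothTransition t| ≤ C₀)
    (hS0 : ∀ t, t ≤ 0 → deriv Real.smoothTransition t = 0)
    (hS1 : ∀ t, 1 ≤ t → deriv Real.smoothTransition t = 0) :
    ∃ τ ∈ Ioo (1/16 : ℝ) (1/8), CutSet B Ω {x | τ < ψ x} ((17 * C₀ + 16) * δ) := by
  have hg := hψ.continuous_fderiv one_ne_zero
  have hi : Integrable fun x => ‖fderiv ℝ ψ x‖ :=
    hg.norm.integrable_of_hasCompactSupport ((hψc.fderiv ℝ).norm)
  have hmeas : ∀ t, MeasurableSet {x | ψ x ≤ t} := fun t =>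
    (isClosed_le hψ.continuous continuous_const).measurableSet
  set m : ℝ → ℝ := fun t => ∫ x in B ∩ {x | ψ x ≤ t}, ‖fderiv ℝ ψ x‖ with hm
  have hmono : Monotone m := by
    intro s t hst
    refine setIntegral_mono_set hi.integrableOn (Eventually.of_forall fun x => norm_nonneg _)
      (Eventually.of_forall ?_)
    rintro x ⟨a, b⟩
    exact ⟨a, le_trans (show ψ x ≤ s from b) hst⟩
  have hm0 : ∀ t, 0 ≤ m t := fun t => integral_nonneg fun x => norm_nonneg _
  have hm1 : ∀ t, m t ≤ δ := fun t =>
    (setIntegral_mono_set hi.integrableOn (Eventually.of_forall fun x => norm_nonneg _)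
      (Eventually.of_forall fun x hx => hx.1)).trans h2
  obtain ⟨τ, hτ, hd, hdl⟩ := exists_level hmono (a := 1/16) (b := 1/8) (K := 17 * δ) (by norm_num)
    (by linarith [hm0 (1/16), hm1 (1/8)])
  refine ⟨τ, hτ, ?_⟩
  have hslope : ∀ᶠ t in 𝓝[>] τ, slope m τ t < 17 * δ := by
    have := hd.hasDerivAt.tendsto_slope
    exact (this.mono_left (nhdsWithin_mono _ fun x hx => ne_of_gt hx)).eventually_lt_const hdl
  rw [eventually_nhdsWithin_iff, Metric.eventually_nhds_iff] at hslope
  obtain ⟨e, he, hsl⟩ := hslope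
  have hinc : ∀ s, 0 < s → s < e → m (τ + s) - m τ ≤ 17 * δ * s := by
    intro s hs hse
    have := hsl (y := τ + s) (by simp [abs_of_pos hs, hse]) (by simp [hs])
    rw [slope_def_field, add_sub_cancel_left, div_lt_iff₀ hs] at this
    exact this.le
  have hτ0 : 0 < τ := by linarith [hτ.1]
  have hScd : ContDiff ℝ 1 Real.smoothTransition := Real.smoothTransition.contDiff
  -- a single cut-off
  have key : ∀ s, 0 < s → s < e → Cut B Ω (fun x => Real.smoothTransition ((ψ x - τ) / s))
      ((17 * C₀ + 16) * δ) := by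
    intro s hs hse
    have hw : ContDiff ℝ 1 (fun x => Real.smoothTransition ((ψ x - τ) / s)) :=
      hScd.comp ((hψ.sub contDiff_const).div_const s)
    refine ⟨hw, ?_, fun x => Real.smoothTransition.nonneg _,
      fun x => Real.smoothTransition.le_one _, ?_, ?_⟩
    · refine hψc.mono fun x hx h => hx ?_
      beta_reduce
      rw [h]
      apply Real.smoothTransition.zero_of_nonpos
      exact div_nonpos_of_nonpos_of_nonneg (by linarith) hs.le
    · intro φ hφ hφ1
      have hc := hφ.smul hw
      have a := h1 _ (hc.const_smul (1/16)) (by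
        intro x
        rw [norm_smul, norm_smul, Real.norm_of_nonneg (Real.smoothTransition.nonneg _)]
        by_cases hx : ψ x ≤ τ
        · rw [Real.smoothTransition.zero_of_nonpos
            (div_nonpos_of_nonpos_of_nonneg (by linarith) hs.le)]
          simpa using hψ0 x
        · push Not at hx
          have a1 := mul_le_one₀ (Real.smoothTransition.le_one ((ψ x - τ) / s)) (norm_nonneg _) (hφ1 x)
          rw [Real.norm_of_nonneg (by norm_num)]
          linarith [hτ.1])
      rw [DD_const_smul hc] at a
      nlinarith [mul_pos hC₀ hδ]
    · have hfd : ∀ x, ‖fderiv ℝ (fun x => Real.smoothTransition ((ψ x - τ) / s)) x‖ ≤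
          (C₀ / s) * ((B ∩ {x | ψ x ≤ τ + s}) \ (B ∩ {x | ψ x ≤ τ}) ∪ Bᶜ).indicator
            (fun x => ‖fderiv ℝ ψ x‖) x := by
        intro x
        have d1 : HasFDerivAt (fun x => (ψ x - τ) / s) (s⁻¹ • fderiv ℝ ψ x) x := by
          have := (((hψ.differentiable one_ne_zero x).hasFDerivAt).sub_const τ).const_mul s⁻¹
          refine this.congr_of_eventuallyEq (Eventually.of_forall fun y => ?_)
          show (ψ y - τ) / s = s⁻¹ * (ψ y - τ)
          field_simp
        have d2 := ((hScd.differentiable one_ne_zero _).hasDerivAt).comp_hasFDerivAt x d1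
        have d3 : fderiv ℝ (fun x => Real.smoothTransition ((ψ x - τ) / s)) x = _ := d2.fderiv
        rw [d3, norm_smul, norm_smul, Real.norm_eq_abs, Real.norm_of_nonneg (by positivity)]
        by_cases hx : x ∈ ((B ∩ {x | ψ x ≤ τ + s}) \ (B ∩ {x | ψ x ≤ τ}) ∪ Bᶜ)
        · rw [indicator_of_mem hx]
          have := mul_le_mul_of_nonneg_right (hS ((ψ x - τ) / s))
            (by positivity : 0 ≤ s⁻¹ * ‖fderiv ℝ ψ x‖)
          calc _ ≤ _ := this
            _ = _ := by ring
        · rw [indicator_of_notMem hx]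
          have : deriv Real.smoothTransition ((ψ x - τ) / s) = 0 := by
            by_cases h3 : ψ x ≤ τ
            · exact hS0 _ (div_nonpos_of_nonpos_of_nonneg (by linarith) hs.le)
            · apply hS1
              rw [le_div_iff₀ hs]
              by_contra h4
              push Not at h4
              apply hx
              by_cases hxB : x ∈ B
              · exact Or.inl ⟨⟨hxB, show ψ x ≤ τ + s by linarith⟩, fun h => h3 h.2⟩
              · exact Or.inr hxB
          rw [this]; simp
      have hms : MeasurableSet ((B ∩ {x | ψ x ≤ τ + s}) \ (B ∩ {x | ψ x ≤ τ}) ∪ Bᶜ) :=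
        ((hB.inter (hmeas _)).diff (hB.inter (hmeas _))).union hB.compl
      have i1 := ((hi.indicator hms).const_mul (C₀ / s))
      have a1 : ∫ x in B, ‖fderiv ℝ (fun x => Real.smoothTransition ((ψ x - τ) / s)) x‖ ≤
          ∫ x in B, (C₀ / s) * ((B ∩ {x | ψ x ≤ τ + s}) \ (B ∩ {x | ψ x ≤ τ}) ∪ Bᶜ).indicator
            (fun x => ‖fderiv ℝ ψ x‖) x :=
        integral_mono_of_nonneg (Eventually.of_forall fun x => norm_nonneg _) i1.integrableOn
          (Eventually.of_forall hfd)
      have hset : B ∩ ((B ∩ {x | ψ x ≤ τ + s}) \ (B ∩ {x | ψ x ≤ τ}) ∪ Bᶜ) =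
          (B ∩ {x | ψ x ≤ τ + s}) \ (B ∩ {x | ψ x ≤ τ}) := by
        ext x
        simp only [mem_inter_iff, mem_union, Set.mem_sdiff, mem_compl_iff]
        tauto
      rw [integral_const_mul, setIntegral_indicator hms, hset,
        setIntegral_sdiff (hB.inter (hmeas _)) hi.integrableOn (by
          rintro x ⟨a, b⟩
          have b : ψ x ≤ τ := b
          exact ⟨a, show ψ x ≤ τ + s by linarith⟩)] at a1
      have a2 := mul_le_mul_of_nonneg_left (hinc s hs hse) (by positivity : 0 ≤ C₀ / s)
      have a3 : C₀ / s * (17 * δ * s) = 17 * C₀ * δ := by field_simp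
      have a4 := a1.trans a2
      nlinarith
  refine ⟨fun n x => Real.smoothTransition ((ψ x - τ) / (e / (n + 2))), fun n => key _ (by positivity) ?_, ?_⟩
  · apply div_lt_self he
    have : (0:ℝ) ≤ n := n.cast_nonneg
    linarith
  · intro x
    by_cases hx : τ < ψ x
    · rw [indicator_of_mem (show x ∈ {x | τ < ψ x} from hx)]
      apply tendsto_const_nhds.congr'
      have : Tendsto (fun n : ℕ => (n:ℝ)) atTop atTop := tendsto_natCast_atTop_atTop
      filter_upwards [this.eventually_ge_atTop (e / (ψ x - τ))] with n hn
      symm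
      apply Real.smoothTransition.one_of_one_le
      have hp : 0 < ψ x - τ := by linarith
      rw [div_le_iff₀ hp] at hn
      rw [le_div_iff₀ (by positivity), one_mul, div_le_iff₀ (by positivity)]
      nlinarith
    · rw [indicator_of_notMem (show x ∉ {x | τ < ψ x} from hx)]
      push Not at hx
      apply tendsto_const_nhds.congr
      intro n
      symm
      apply Real.smoothTransition.zero_of_nonpos
      exact div_nonpos_of_nonpos_of_nonneg (by linarith) (by positivity)

lemma Cut.mono {B Ω : Set (Euc N)} {w : Euc N → ℝ} {δ δ' : ℝ} (h : Cut B Ω w δ) (hd : δ ≤ δ') :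
    Cut B Ω w δ' :=
  ⟨h.1, h.2.1, h.2.2.1, h.2.2.2.1, fun φ a b => (h.2.2.2.2.1 φ a b).trans hd,
    h.2.2.2.2.2.trans hd⟩

theorem core2 {B Ω : Set (Euc N)} (hB : MeasurableSet B) (hp : perimeter B Ω < ⊤)
    (hΩ : IsOpen Ω) {ζ : Euc N → ℝ} (hζ : ContDiff ℝ 1 ζ) (hζc : HasCompactSupport ζ)
    (hζs : tsupport ζ ⊆ Ω) (h0 : ∀ x, 0 ≤ ζ x) (h1 : ∀ x, ζ x ≤ 1) {δ : ℝ} (hδ : 0 < δ) :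
    ∃ U : Set (Euc N), IsOpen U ∧ CutSet B Ω U δ ∧ volume (B ∩ U) ≤ ENNReal.ofReal δ ∧
      ∀ x, ζ x = 1 → x ∉ U → ∃ r, 0 < r ∧ r < δ ∧
        ENNReal.ofReal (1/8) * volume (ball x r) ≤
          ENNReal.ofReal (Crho N * om N) * volume (B ∩ ball x r) := by
  obtain ⟨C₀, hC₀, hS, hS0, hS1⟩ := S_bound
  have hD : 1 ≤ 17 * C₀ + 16 := by linarith
  have hD0 : 0 < 17 * C₀ + 16 := by linarith
  have hδ' : 0 < δ / (17 * C₀ + 16) := by positivity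
  have hle : δ / (17 * C₀ + 16) ≤ δ := div_le_self hδ.le hD
  obtain ⟨ψ, p1, p2, p3, p4, p5, p6, p7, p8⟩ := core1 hB hp hΩ hζ hζc hζs h0 h1 hδ'
  obtain ⟨τ, hτ, w, hw, hl⟩ := level_cut hB p1 p2 p4 hδ' p5 p6 hC₀ hS hS0 hS1
  refine ⟨{x | τ < ψ x}, isOpen_lt continuous_const p1.continuous,
    ⟨w, fun n => (hw n).mono (by field_simp; exact le_rfl), hl⟩, ?_, ?_⟩
  · refine (measure_mono ?_).trans (p7.trans (ENNReal.ofReal_le_ofReal hle))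
    rintro x ⟨a, b⟩
    have b : τ < ψ x := b
    exact ⟨a, show 0 < ψ x by linarith [hτ.1]⟩
  · intro x hx hxU
    have hxU : ¬ τ < ψ x := hxU
    obtain ⟨r, r0, r1, r2⟩ := p8 x hx (by linarith [hτ.2])
    exact ⟨r, r0, r1.trans_le hle, r2⟩


lemma exists_exhaustion {Ω : Set (Euc N)} (hΩ : IsOpen Ω) :
    ∃ ζ : ℕ → Euc N → ℝ, (∀ m, ContDiff ℝ 1 (ζ m) ∧ HasCompactSupport (ζ m) ∧ tsupport (ζ m) ⊆ Ω ∧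
      (∀ x, 0 ≤ ζ m x) ∧ (∀ x, ζ m x ≤ 1)) ∧ ∀ x ∈ Ω, ∀ᶠ m in atTop, ζ m x = 1 := by
  obtain ⟨F, hF1, hF2, hF3, hF4⟩ := hΩ.exists_iUnion_isClosed
  have hK : ∀ m : ℕ, IsCompact (closedBall (0 : Euc N) m ∩ F m) := fun m =>
    (isCompact_closedBall _ _).inter_right (hF1 m)
  choose ζ h1 h2 h3 h4 h5 h6 using fun m =>
    exists_cutoff (hK m) hΩ (inter_subset_right.trans (hF2 m))
  refine ⟨ζ, fun m => ⟨h1 m, h2 m, h3 m, h4 m, h5 m⟩, fun x hx => ?_⟩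
  rw [← hF3, mem_iUnion] at hx
  obtain ⟨i, hi⟩ := hx
  have : Tendsto (fun n : ℕ => (n:ℝ)) atTop atTop := tendsto_natCast_atTop_atTop
  filter_upwards [this.eventually_ge_atTop ‖x‖, eventually_ge_atTop i] with m hm hm'
  exact h6 m x ⟨by simpa using hm, hF4 hm' hi⟩

lemma sum_geom_le (k n : ℕ) : ∑ j ∈ Finset.range n, (1/2 : ℝ) ^ (j + k) ≤ 2 * (1/2) ^ k := by
  simp_rw [pow_add, ← Finset.sum_mul]
  exact mul_le_mul_of_nonneg_right (sum_geometric_two_le n) (by positivity)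

lemma tail_DD {B Ω : Set (Euc N)} (hB : MeasurableSet B) {U : ℕ → Set (Euc N)}
    (hU : ∀ m, IsOpen (U m)) (h : ∀ m, CutSet B Ω (U m) ((1/2) ^ m)) (k : ℕ)
    {φ : Euc N → Euc N} (hφ : CC Ω φ) (hφ1 : ∀ x, ‖φ x‖ ≤ 1) :
    DD (B ∩ ⋃ j, U (j + k)) φ ≤ 4 * (1/2) ^ k := by
  have hms : ∀ n : ℕ, MeasurableSet (⋃ j < n, U (j + k)) := fun n =>
    (isOpen_biUnion fun j _ => hU _).measurableSet
  have h1 : ∀ n : ℕ, DD (B ∩ ⋃ j < n, U (j + k)) φ ≤ 4 * (1/2) ^ k := by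
    intro n
    have a := (CutSet.biUnion (U := fun j => U (j + k)) (fun j => h (j + k)) n).DD_le (hms n) hφ hφ1
    linarith [sum_geom_le k n]
  have h2 := tendsto_setIntegral_of_monotone (μ := volume) (f := diverg φ)
    (s := fun n : ℕ => B ∩ ⋃ j < n, U (j + k)) (fun n => hB.inter (hms n))
    (by
      intro a b hab
      refine inter_subset_inter_right _ (iUnion₂_subset fun j hj => ?_)
      exact subset_biUnion_of_mem (u := fun j => U (j + k)) (show j < b from lt_of_lt_of_le hj hab))
    hφ.integrable.integrableOn
  have h3 : (⋃ n : ℕ, B ∩ ⋃ j < n, U (j + k)) = B ∩ ⋃ j, U (j + k) := by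
    rw [← inter_iUnion]
    congr 1
    ext x
    simp only [mem_iUnion]
    constructor
    · rintro ⟨n, j, _, hx⟩; exact ⟨j, hx⟩
    · rintro ⟨j, hx⟩; exact ⟨j + 1, j, Nat.lt_succ_self j, hx⟩
  rw [h3] at h2
  exact le_of_tendsto' h2 h1

lemma tail_vol {B : Set (Euc N)} {U : ℕ → Set (Euc N)}
    (h : ∀ m, volume (B ∩ U m) ≤ ENNReal.ofReal ((1/2) ^ m)) (k : ℕ) :
    volume (B ∩ ⋃ j, U (j + k)) ≤ ENNReal.ofReal (2 * (1/2) ^ k) := by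
  rw [inter_iUnion]
  refine (measure_iUnion_le _).trans (ENNReal.tsum_le_of_sum_range_le fun n => ?_)
  refine (Finset.sum_le_sum fun j _ => h (j + k)).trans ?_
  rw [← ENNReal.ofReal_sum_of_nonneg fun j _ => by positivity]
  exact ENNReal.ofReal_le_ofReal (sum_geom_le k n)

lemma density_null {B Ω : Set (Euc N)} (hN : 1 ≤ N) (hB : MeasurableSet B) :
    volume (posUpperDensity B Ω \ B) = 0 := by
  have : Nonempty (Fin N) := ⟨⟨0, hN⟩⟩
  have h := Besicovitch.ae_tendsto_measure_inter_div_of_measurableSet (volume : Measure (Euc N)) hB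
  rw [measure_eq_zero_iff_ae_notMem]
  filter_upwards [h] with x hx hxm
  obtain ⟨⟨_, h1⟩, h2⟩ := hxm
  rw [indicator_of_notMem h2] at hx
  have h3 : limsup (fun ρ : ℝ => volume (B ∩ ball x ρ) / volume (ball x ρ)) (𝓝[>] 0) ≤
      limsup (fun r => volume (B ∩ closedBall x r) / volume (closedBall x r)) (𝓝[>] 0) := by
    refine limsup_le_limsup (Eventually.of_forall fun r => ?_)
    show volume (B ∩ ball x r) / volume (ball x r) ≤
      volume (B ∩ closedBall x r) / volume (closedBall x r)
    rw [Measure.addHaar_closedBall_eq_addHaar_ball]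
    exact ENNReal.div_le_div_right (measure_mono (inter_subset_inter_right _ ball_subset_closedBall)) _
  rw [hx.limsup_eq] at h3
  exact absurd (h1.trans_le h3) (lt_irrefl _)

lemma freq_small {P : ℝ → Prop} (h : ∀ e, 0 < e → ∃ r, 0 < r ∧ r < e ∧ P r) :
    ∃ᶠ r in 𝓝[>] (0:ℝ), P r := by
  intro hev
  rw [eventually_nhdsWithin_iff, Metric.eventually_nhds_iff] at hev
  obtain ⟨e, he, hsl⟩ := hev
  obtain ⟨r, r0, r1, r2⟩ := h e he
  exact hsl (by simpa [abs_of_pos r0] using r1) r0 r2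

lemma mem_pos {B Ω : Set (Euc N)} {x : Euc N} (hx : x ∈ Ω) {c : ℝ} (hc : 0 < c)
    (h : ∀ e, 0 < e → ∃ r, 0 < r ∧ r < e ∧ ENNReal.ofReal (1/8) * volume (ball x r) ≤
          ENNReal.ofReal c * volume (B ∩ ball x r)) : x ∈ posUpperDensity B Ω := by
  refine ⟨hx, ?_⟩
  have hc0 : ENNReal.ofReal c ≠ 0 := (ENNReal.ofReal_pos.2 hc).ne'
  have hpos : 0 < ENNReal.ofReal (1/8) / ENNReal.ofReal c :=
    ENNReal.div_pos (ENNReal.ofReal_pos.2 (by norm_num)).ne' ENNReal.ofReal_ne_top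
  refine hpos.trans_le (le_limsup_of_frequently_le (freq_small fun e he => ?_))
  obtain ⟨r, r0, r1, r2⟩ := h e he
  refine ⟨r, r0, r1, ?_⟩
  rw [ENNReal.le_div_iff_mul_le (Or.inl (measure_ball_pos _ _ r0).ne')
    (Or.inl measure_ball_lt_top.ne), ENNReal.mul_comm_div, ← mul_div_assoc]
  exact ENNReal.div_le_of_le_mul' r2

lemma pos_freq {B Ω : Set (Euc N)} {x : Euc N} (hx : x ∈ posUpperDensity B Ω) :
    ∃ η : ℝ, 0 < η ∧ ∃ᶠ r in 𝓝[>] (0:ℝ),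
      ENNReal.ofReal η * volume (ball x r) ≤ volume (B ∩ ball x r) := by
  obtain ⟨η, h1, h2⟩ := ENNReal.lt_iff_exists_nnreal_btwn.1 hx.2
  refine ⟨η, by exact_mod_cast h1, (frequently_lt_of_lt_limsup (by isBoundedDefault) h2).mono fun r hr => ?_⟩
  rw [ENNReal.ofReal_coe_nnreal]
  exact ENNReal.mul_le_of_le_div hr.le

theorem main_meas {Ω : Set (Euc N)} (hN : 1 ≤ N) (hΩ : IsOpen Ω) {B : Set (Euc N)} (hBΩ : B ⊆ Ω)
    (hB : MeasurableSet B) (hper : perimeter B Ω < ⊤) :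
    ∃ (C : ℕ → Set (Euc N)) (Z : Set (Euc N)),
      (∀ k, C k ⊆ Ω ∧ closure (C k) ∩ Ω = C k ∧ perimeter (C k) Ω < ⊤) ∧
      MeasurableSet Z ∧ Z ⊆ Ω ∧
      Tendsto (fun k =>
          variation (fun x => B.indicator (fun _ => (1 : ℝ)) x -
            (C k).indicator (fun _ => (1 : ℝ)) x) Ω) atTop (𝓝 0) ∧
      Tendsto (fun k => volume (B ∆ C k)) atTop (𝓝 0) ∧
      (∀ x ∈ Ω \ Z,
        Tendsto (fun k => (C k).indicator (fun _ => (1 : ℝ)) x) atTop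
          (𝓝 ((posUpperDensity B Ω).indicator (fun _ => (1 : ℝ)) x))) ∧
      (μH[(N : ℝ) - 1] : Measure (Euc N)) Z = 0 := by
  obtain ⟨ζ, hζ, hζ1⟩ := exists_exhaustion hΩ
  choose U hUo hUc hUv hUd using fun m => core2 hB hper hΩ (hζ m).1 (hζ m).2.1 (hζ m).2.2.1
    (hζ m).2.2.2.1 (hζ m).2.2.2.2 (δ := (1/2) ^ m) (by positivity)
  set V : ℕ → Set (Euc N) := fun k => ⋃ j, U (j + k) with hV
  have hVo : ∀ k, IsOpen (V k) := fun k => isOpen_iUnion fun j => hUo _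
  have hVanti : Antitone V := by
    intro a b hab
    refine iUnion_subset fun j => ?_
    have := subset_iUnion (fun j => U (j + a)) (j + (b - a))
    rwa [show j + (b - a) + a = j + b by omega] at this
  have hF1 : ∀ k φ, CC Ω φ → (∀ x, ‖φ x‖ ≤ 1) → DD (B ∩ V k) φ ≤ 4 * (1/2) ^ k :=
    fun k φ h h' => tail_DD hB hUo hUc k h h'
  have hFv : ∀ k, volume (B ∩ V k) ≤ ENNReal.ofReal (2 * (1/2) ^ k) := fun k => tail_vol hUv k
  have hlim : ∀ a : ℝ, Tendsto (fun k : ℕ => a * (1/2) ^ k) atTop (𝓝 0) := by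
    intro a
    have := (tendsto_pow_atTop_nhds_zero_of_lt_one (r := (1/2 : ℝ)) (by norm_num)
      (by norm_num)).const_mul a
    simpa using this
  have hlimE : ∀ a : ℝ, Tendsto (fun k : ℕ => ENNReal.ofReal (a * (1/2) ^ k)) atTop (𝓝 0) := by
    intro a
    simpa using ENNReal.tendsto_ofReal (hlim a)
  have hFp : ∀ k, perimeter (B ∩ V k) Ω ≤ ENNReal.ofReal (4 * (1/2) ^ k) :=
    fun k => perimeter_le_of (hF1 k)
  have hFv0 : Tendsto (fun k => volume (B ∩ V k)) atTop (𝓝 0) :=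
    tendsto_of_tendsto_of_tendsto_of_le_of_le tendsto_const_nhds (hlimE 2)
      (fun _ => zero_le) hFv
  have hFP0 : Tendsto (fun k => PP (B ∩ V k) Ω) atTop (𝓝 0) :=
    tendsto_of_tendsto_of_tendsto_of_le_of_le tendsto_const_nhds (hlim 4)
      (fun k => PP_nonneg _ _) fun k =>
        ENNReal.toReal_le_of_le_ofReal (by positivity) (hFp k)
  -- density
  have hdens : ∀ k, Ω \ V k ⊆ posUpperDensity B Ω := by
    rintro k x ⟨hx, hxV⟩
    refine mem_pos hx (mul_pos (Crho_pos (N := N)) (om_pos (N := N))) fun e he => ?_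
    have h1 : ∀ᶠ m : ℕ in atTop, (1:ℝ) * (1/2) ^ m < e := (hlim 1).eventually_lt_const he
    obtain ⟨m, hm1, hm2, hm3⟩ := (h1.and ((hζ1 x hx).and (eventually_ge_atTop k))).exists
    have hxU : x ∉ U m := by
      intro h
      apply hxV
      have := subset_iUnion (fun j => U (j + k)) (m - k)
      rw [show m - k + k = m by omega] at this
      exact this h
    obtain ⟨r, r0, r1, r2⟩ := hUd m x hm2 hxU
    exact ⟨r, r0, by linarith, r2⟩
  have hnull : ∀ k, volume ((Ω \ V k) \ B) = 0 := fun k =>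
    measure_mono_null (sdiff_subset_sdiff_left (hdens k)) (density_null hN hB)
  have hae : ∀ k, (Ω \ V k : Set (Euc N)) =ᵐ[volume] (B \ V k : Set (Euc N)) := by
    intro k
    have := measure_eq_zero_iff_ae_notMem.1 (hnull k)
    rw [Filter.eventuallyEq_set]
    filter_upwards [this] with x hx
    constructor
    · intro h
      exact ⟨by_contra fun h' => hx ⟨h, h'⟩, h.2⟩
    · intro h
      exact ⟨hBΩ h.1, h.2⟩
  have hsplit : ∀ k φ, CC Ω φ → DD (Ω \ V k) φ = DD B φ - DD (B ∩ V k) φ := by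
    intro k φ hφ
    have a := integral_inter_add_sdiff (s := B) (hVo k).measurableSet
      (hφ.integrable.integrableOn (s := B))
    have b : DD (Ω \ V k) φ = ∫ x in B \ V k, diverg φ x := setIntegral_congr_set (hae k)
    rw [b]
    unfold DD
    linarith
  set Z₀ : Set (Euc N) := posUpperDensity B Ω \ ⋃ k, (Ω \ V k) with hZ₀
  have hZ₀Ω : Z₀ ⊆ Ω := fun x hx => hx.1.1
  have hZ0 : (μH[(N : ℝ) - 1] : Measure (Euc N)) Z₀ = 0 := by
    refine HZ hN hΩ (F := fun k => B ∩ V k) (fun k => hB.inter (hVo k).measurableSet)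
      (fun k => (hFp k).trans_lt ENNReal.ofReal_lt_top) hFP0 hFv0 hZ₀Ω fun x hx => ?_
    obtain ⟨η, hη, hfr⟩ := pos_freq hx.1
    refine ⟨η, hη, fun k => ?_⟩
    have hxV : x ∈ V k := by
      by_contra h
      exact hx.2 (mem_iUnion.2 ⟨k, hx.1.1, h⟩)
    obtain ⟨e, he, hball⟩ := Metric.isOpen_iff.1 (hVo k) x hxV
    have hev : ∀ᶠ r in 𝓝[>] (0:ℝ), r < e :=
      (eventually_lt_nhds he).filter_mono nhdsWithin_le_nhds
    refine (hfr.and_eventually hev).mono ?_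
    rintro r ⟨h1, h2⟩
    refine h1.trans (measure_mono ?_)
    rintro y ⟨y1, y2⟩
    exact ⟨⟨y1, hball (ball_subset_ball h2.le y2)⟩, y2⟩
  refine ⟨fun k => Ω \ V k, toMeasurable (μH[(N : ℝ) - 1]) Z₀ ∩ Ω, fun k => ⟨sdiff_subset, ?_, ?_⟩,
    (measurableSet_toMeasurable _ _).inter hΩ.measurableSet, inter_subset_right, ?_, ?_, ?_, ?_⟩
  · apply Subset.antisymm
    · rintro x ⟨h1, h2⟩
      refine ⟨h2, ?_⟩
      have : closure (Ω \ V k) ⊆ (V k)ᶜ :=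
        closure_minimal (fun y hy => hy.2) (hVo k).isClosed_compl
      exact this h1
    · exact fun x hx => ⟨subset_closure hx, hx.1⟩
  · refine (perimeter_le_of (c := PP B Ω + 4 * (1/2) ^ k) fun φ hφ hφ1 => ?_).trans_lt
      ENNReal.ofReal_lt_top
    rw [hsplit k φ hφ]
    have a := DD_le_one hper hφ hφ1
    have b := hF1 k _ (hφ.const_smul (-1)) (by
      intro x
      rw [norm_smul]; simpa using hφ1 x)
    rw [DD_const_smul hφ] at b
    linarith
  · refine tendsto_of_tendsto_of_tendsto_of_le_of_le tendsto_const_nhds (hlimE 4)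
      (fun _ => zero_le) fun k => ?_
    refine iSup₂_le fun φ hφ => ENNReal.ofReal_le_ofReal ?_
    have hc : CC Ω φ := ⟨hφ.1, hφ.2.1, hφ.2.2.1⟩
    refine le_trans (le_of_eq ?_) (hF1 k φ hc hφ.2.2.2)
    have e : ∀ᵐ x ∂(volume.restrict Ω), (B.indicator (fun _ => (1 : ℝ)) x -
            (Ω \ V k).indicator (fun _ => (1 : ℝ)) x) * diverg φ x =
          (B ∩ V k).indicator (diverg φ) x := by
      have := measure_eq_zero_iff_ae_notMem.1 (hnull k)
      filter_upwards [ae_restrict_of_ae this, ae_restrict_mem hΩ.measurableSet] with x hx hxΩ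
      by_cases h1 : x ∈ B <;> by_cases h2 : x ∈ V k
      · simp [h1, h2]
      · simp [h1, h2, hxΩ]
      · simp [h1, h2]
      · exact absurd ⟨⟨hxΩ, h2⟩, h1⟩ hx
    rw [integral_congr_ae e, setIntegral_indicator (hB.inter (hVo k).measurableSet)]
    unfold DD
    congr 2
    exact inter_eq_right.2 (inter_subset_left.trans hBΩ)
  · refine tendsto_of_tendsto_of_tendsto_of_le_of_le tendsto_const_nhds hFv0
      (fun _ => zero_le) fun k => ?_
    have : B ∆ (Ω \ V k) ⊆ (B ∩ V k) ∪ ((Ω \ V k) \ B) := by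
      rintro x (⟨h1, h2⟩ | h)
      · exact Or.inl ⟨h1, by_contra fun h => h2 ⟨hBΩ h1, h⟩⟩
      · exact Or.inr h
    refine (measure_mono this).trans ((measure_union_le _ _).trans ?_)
    rw [hnull k, add_zero]
  · rintro x ⟨hx, hxZ⟩
    by_cases h : x ∈ posUpperDensity B Ω
    · have h1 : x ∈ ⋃ k, (Ω \ V k) := by
        by_contra h1
        exact hxZ ⟨subset_toMeasurable _ _ ⟨h, h1⟩, hx⟩
      obtain ⟨k, hk⟩ := mem_iUnion.1 h1
      apply tendsto_const_nhds.congr'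
      filter_upwards [eventually_ge_atTop k] with m hm
      rw [indicator_of_mem h, indicator_of_mem]
      exact ⟨hx, fun h2 => hk.2 (hVanti hm h2)⟩
    · apply tendsto_const_nhds.congr
      intro k
      rw [indicator_of_notMem h, indicator_of_notMem]
      exact fun h2 => h (hdens k h2)
  · refine measure_mono_null inter_subset_left ?_
    rw [measure_toMeasurable, hZ0]

lemma main_zero (Ω : Set (Euc 0)) (B : Set (Euc 0)) {x : Euc 0} (hx : x ∈ Ω) :
    (posUpperDensity B Ω).indicator (fun _ => (1 : ℝ)) x = B.indicator (fun _ => (1:ℝ)) x := by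
  by_cases h : x ∈ B
  · have hB : B = univ := eq_univ_of_forall fun y => by rwa [Subsingleton.elim y x]
    rw [indicator_of_mem h, indicator_of_mem]
    refine ⟨hx, ?_⟩
    have : limsup (fun ρ : ℝ => volume (B ∩ ball x ρ) / volume (ball x ρ)) (𝓝[>] 0) =
        limsup (fun ρ : ℝ => (1 : ℝ≥0∞)) (𝓝[>] 0) := by
      apply limsup_congr
      filter_upwards [self_mem_nhdsWithin] with r hr
      rw [hB, univ_inter]
      exact ENNReal.div_self (measure_ball_pos _ _ hr).ne' measure_ball_lt_top.ne
    rw [this]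
    simp
  · rw [indicator_of_notMem h, indicator_of_notMem]
    rintro ⟨_, h2⟩
    have hB : B = ∅ := eq_empty_of_forall_notMem fun y => by rwa [Subsingleton.elim y x]
    simp [hB] at h2


/-- if `B ⊆ Ω` is a measurable set of finite perimeter in the open set `Ω`
and `ε > 0`, then there are relatively closed sets `C_k ⊆ Ω` of finite perimeter in `Ω`
and a Borel set `Z ⊆ Ω` such that: (a) `V(1_B − 1_{C_k}, Ω) → 0` and `λ^N(B Δ C_k) → 0`;
(b) `1_{C_k}(x) → 1_{B⁺}(x)` for every `x ∈ Ω \ Z`; (c) `H^{N-1}(Z) < ε`. -/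
theorem statement14 {N : ℕ} (Ω : Set (Euc N)) (hΩ : IsOpen Ω)
    (B : Set (Euc N)) (hB : B ⊆ Ω) (hmB : NullMeasurableSet B volume)
    (hper : perimeter B Ω < ⊤) (ε : ℝ) (hε : 0 < ε) :
    ∃ (C : ℕ → Set (Euc N)) (Z : Set (Euc N)),
      (∀ k, C k ⊆ Ω ∧ closure (C k) ∩ Ω = C k ∧ perimeter (C k) Ω < ⊤) ∧
      MeasurableSet Z ∧ Z ⊆ Ω ∧
      Tendsto (fun k =>
          variation (fun x => B.indicator (fun _ => (1 : ℝ)) x -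
            (C k).indicator (fun _ => (1 : ℝ)) x) Ω) atTop (𝓝 0) ∧
      Tendsto (fun k => volume (B ∆ C k)) atTop (𝓝 0) ∧
      (∀ x ∈ Ω \ Z,
        Tendsto (fun k => (C k).indicator (fun _ => (1 : ℝ)) x) atTop
          (𝓝 ((posUpperDensity B Ω).indicator (fun _ => (1 : ℝ)) x))) ∧
      (μH[(N : ℝ) - 1] : Measure (Euc N)) Z < ENNReal.ofReal ε := by
  have hε' : 0 < ENNReal.ofReal ε := ENNReal.ofReal_pos.2 hε
  rcases Nat.eq_zero_or_pos N with rfl | hN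
  · refine ⟨fun _ => B, ∅, fun k => ⟨hB, ?_, hper⟩, MeasurableSet.empty, empty_subset _, ?_, ?_, ?_, ?_⟩
    · rw [(subsingleton_of_subsingleton (s := B)).isClosed.closure_eq]
      exact inter_eq_left.2 hB
    · simp [variation]
    · simp
    · rintro x ⟨hx, _⟩
      rw [main_zero Ω B hx]
      exact tendsto_const_nhds
    · simpa using hε'
  · obtain ⟨B', hB'B, hB'm, hB'e⟩ := hmB.exists_measurable_subset_ae_eq
    have hper' : perimeter B' Ω = perimeter B Ω := by
      unfold perimeter
      refine iSup_congr fun φ => iSup_congr fun _ => ?_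
      rw [setIntegral_congr_set hB'e]
    have hpos : posUpperDensity B' Ω = posUpperDensity B Ω := by
      unfold posUpperDensity
      ext x
      have : ∀ ρ : ℝ, volume (B' ∩ ball x ρ) = volume (B ∩ ball x ρ) := fun ρ =>
        measure_congr (hB'e.inter (ae_eq_refl _))
      show (_ ∧ 0 < limsup (fun ρ : ℝ => volume (B' ∩ ball x ρ) / _) _) ↔
        (_ ∧ 0 < limsup (fun ρ : ℝ => volume (B ∩ ball x ρ) / _) _)
      simp only [this]
    obtain ⟨C, Z, h1, h2, h3, h4, h5, h6, h7⟩ := main_meas hN hΩ (hB'B.trans hB) hB'm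
      (hper'.trans_lt hper)
    refine ⟨C, Z, h1, h2, h3, ?_, ?_, ?_, by rwa [h7]⟩
    · convert h4 using 2 with k
      unfold variation
      refine iSup_congr fun φ => iSup_congr fun _ => ?_
      congr 1
      apply integral_congr_ae
      have := indicator_ae_eq_of_ae_eq_set (f := fun _ => (1:ℝ)) hB'e
      filter_upwards [ae_restrict_of_ae this] with x hx
      rw [hx]
    · convert h5 using 2 with k
      exact measure_congr (hB'e.symm.symmDiff (ae_eq_refl _))
    · rw [hpos] at h6
      exact h6
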